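/- arXiv:1111.0796 — 4 statements merged into one kernel-verified Lean document; each statement's English description precedes it below -/
import Mathlib

section
/- Let s ∈ (0,1) and t > 0. Then lim_{x→+∞} x^{2s} (1 − v^t_s(x)) = t (2/π) sin(πs) Γ(2s) > 0, and lim_{x→−∞} |x|^{2s} (1 + v^t_s(x)) = t (2/π) sin(πs) Γ(2s). -/
open Real MeasureTheory Filter Set

/-- Normalizing constant of the one-dimensional fractional Laplacian. -/
noncomputable def fracLapCoef (s : ℝ) : ℝ :=
  (4:ℝ) ^ s * s * Real.Gamma (s + 1/2) / (Real.sqrt π * Real.Gamma (1 - s))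

/-- The one-dimensional fractional Laplacian `(-∂ₓₓ)^s v (x)`. -/
noncomputable def fracLap (s : ℝ) (v : ℝ → ℝ) (x : ℝ) : ℝ :=
  fracLapCoef s * ∫ y in Set.Ioi (0:ℝ), (2 * v x - v (x + y) - v (x - y)) * y ^ (-1 - 2*s)

/-- `f` is of class `C^{1,γ}`: continuously differentiable with `γ`-Hölder derivative. -/
def IsC1Holder (γ : ℝ) (f : ℝ → ℝ) : Prop :=
  ContDiff ℝ 1 f ∧ ∃ C : ℝ, ∀ x y : ℝ, |deriv f x - deriv f y| ≤ C * |x - y| ^ γ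

/-- A layer solution of `(-∂ₓₓ)^s v = f(v)` in `ℝ`. -/
structure IsLayerSolution (s : ℝ) (f : ℝ → ℝ) (v : ℝ → ℝ) : Prop where
  bounded : ∃ M : ℝ, ∀ x, |v x| ≤ M
  smooth : ContDiff ℝ 2 v
  eqn : ∀ x, fracLap s v x = f (v x)
  mono : ∀ x, 0 < deriv v x
  limNeg : Tendsto v atBot (nhds (-1))
  limPos : Tendsto v atTop (nhds 1)

/-- The potential `G(r) = -∫₀^r f`. -/
noncomputable def potG (f : ℝ → ℝ) (r : ℝ) : ℝ := -∫ u in (0:ℝ)..r, f u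
/-- The fundamental solution `p_s(t,x)` of the fractional heat equation. -/
noncomputable def fracHeatKernel (s t x : ℝ) : ℝ :=
  (1/π) * ∫ r in Set.Ioi (0:ℝ), Real.cos (x*r) * Real.exp (-(t * r ^ (2*s)))

/-- The explicit layer solution `v^t_s`. -/
noncomputable def layerV (s t : ℝ) (x : ℝ) : ℝ :=
  (2/π) * ∫ r in Set.Ioi (0:ℝ), (Real.sin (x*r) / r) * Real.exp (-(t * r ^ (2*s)))


noncomputable def rotW (a ε ρ θ : ℝ) : ℂ :=
  Complex.I * ρ * Complex.exp (θ * Complex.I) - ε * ((ρ ^ a : ℝ) : ℂ) * Complex.exp ((a * θ : ℝ) * Complex.I)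

noncomputable def rotK (a ε ρ θ : ℝ) : ℂ :=
  Complex.exp (rotW a ε ρ θ) * (Complex.I * Complex.exp (θ * Complex.I)
    - ε * ((a * ρ ^ (a - 1) : ℝ) : ℂ) * Complex.exp ((a * θ : ℝ) * Complex.I))

lemma rotW_re (a ε ρ θ : ℝ) : (rotW a ε ρ θ).re = -ρ * sin θ - ε * ρ ^ a * cos (a * θ) := by
  unfold rotW
  rw [Complex.exp_mul_I, Complex.exp_mul_I, ← Complex.ofReal_cos, ← Complex.ofReal_cos,
    ← Complex.ofReal_sin, ← Complex.ofReal_sin]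
  simp only [Complex.sub_re, Complex.mul_re, Complex.mul_im, Complex.add_re, Complex.add_im,
    Complex.ofReal_re, Complex.ofReal_im, Complex.I_re, Complex.I_im]
  ring

lemma hasDerivAt_rho (a ε ρ θ : ℝ) (hρ : 0 < ρ) :
    HasDerivAt (fun ρ => Complex.exp (rotW a ε ρ θ)) (rotK a ε ρ θ) ρ := by
  unfold rotK
  apply HasDerivAt.cexp
  unfold rotW
  have h1 : HasDerivAt (fun ρ : ℝ => (ρ : ℂ)) 1 ρ := Complex.ofRealCLM.hasDerivAt
  have h2 : HasDerivAt (fun ρ : ℝ => ((ρ ^ a : ℝ) : ℂ)) ((a * ρ ^ (a - 1) : ℝ) : ℂ) ρ :=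
    (Real.hasDerivAt_rpow_const (Or.inl hρ.ne')).ofReal_comp
  convert! ((h1.const_mul Complex.I).mul_const (Complex.exp (θ * Complex.I))).sub
    ((h2.const_mul (ε : ℂ)).mul_const (Complex.exp ((a * θ : ℝ) * Complex.I))) using 1
  ring

lemma hasDerivAt_theta (a ε ρ θ : ℝ) (hρ : 0 < ρ) :
    HasDerivAt (fun θ => Complex.exp (rotW a ε ρ θ)) (Complex.I * ρ * rotK a ε ρ θ) θ := by
  have hp : ρ ^ a = ρ * ρ ^ (a - 1) := by
    rw [Real.rpow_sub_one hρ.ne']; field_simp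
  have h1 : HasDerivAt (fun θ : ℝ => (θ : ℂ)) 1 θ := Complex.ofRealCLM.hasDerivAt
  have h2 : HasDerivAt (fun θ : ℝ => ((a * θ : ℝ) : ℂ)) (a : ℂ) θ := by
    simpa using ((hasDerivAt_id θ).const_mul a).ofReal_comp
  have h3 := ((h1.mul_const Complex.I).cexp.const_mul (Complex.I * ρ)).sub
    ((h2.mul_const Complex.I).cexp.const_mul (ε * ((ρ ^ a : ℝ) : ℂ)))
  have h4 := h3.cexp
  unfold rotK
  convert! h4 using 1
  simp only [rotW, hp]
  simp only [Pi.sub_apply]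
  push_cast
  ring

lemma measurable_rotK (a ε : ℝ) : Measurable (fun p : ℝ × ℝ => rotK a ε p.1 p.2) := by
  unfold rotK rotW
  fun_prop

lemma norm_rotK_le (a ε ρ θ : ℝ) (ha : 0 < a) (hε : 0 ≤ ε) (hρ : 0 < ρ) :
    ‖rotK a ε ρ θ‖ ≤ ‖Complex.exp (rotW a ε ρ θ)‖ * (1 + ε * a * ρ ^ (a - 1)) := by
  unfold rotK
  rw [norm_mul]
  gcongr
  refine (norm_sub_le _ _).trans ?_
  rw [norm_mul, norm_mul, norm_mul, Complex.norm_exp_ofReal_mul_I, Complex.norm_exp_ofReal_mul_I,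
    Complex.norm_I, Complex.norm_real, Complex.norm_real, Real.norm_of_nonneg hε,
    Real.norm_of_nonneg (by positivity)]
  apply le_of_eq; ring

lemma rot_gen (H K : ℝ → ℝ → ℂ) (c : ℂ) (g : ℝ → ℝ) (θ₁ θ₂ : ℝ) (hθ : θ₁ ≤ θ₂)
    (hdρ : ∀ ρ > 0, ∀ θ, HasDerivAt (fun ρ => H ρ θ) (K ρ θ) ρ)
    (hdθ : ∀ ρ > 0, ∀ θ, HasDerivAt (fun θ => H ρ θ) (Complex.I * ρ * K ρ θ) θ)
    (hKm : Measurable (fun p : ℝ × ℝ => K p.1 p.2))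
    (hKc : ∀ ρ, Continuous (fun θ => K ρ θ))
    (hKb : ∀ ρ > 0, ∀ θ ∈ Icc θ₁ θ₂, ‖K ρ θ‖ ≤ g ρ)
    (hg : IntegrableOn g (Ioi 0))
    (hHc : ∀ θ, Continuous (fun ρ => H ρ θ)) (hH0 : ∀ θ, H 0 θ = c)
    (hlim : ∀ θ ∈ Icc θ₁ θ₂, Tendsto (fun ρ => H ρ θ) atTop (nhds 0)) :
    IntegrableOn (fun ρ : ℝ => (H ρ θ₂ - H ρ θ₁) / ρ) (Ioi 0) ∧
    ∫ ρ in Ioi (0:ℝ), (H ρ θ₂ - H ρ θ₁) / ρ = -Complex.I * c * (θ₂ - θ₁ : ℝ) := by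
  have hprod : Integrable (fun p : ℝ × ℝ => Complex.I * K p.1 p.2)
      ((volume.restrict (Ioi (0:ℝ))).prod (volume.restrict (Ioc θ₁ θ₂))) := by
    refine (Integrable.comp_fst hg (volume.restrict (Ioc θ₁ θ₂))).mono'
      (hKm.const_mul _).aestronglyMeasurable ?_
    rw [Measure.prod_restrict, ae_restrict_iff' (measurableSet_Ioi.prod measurableSet_Ioc)]
    refine Eventually.of_forall fun p hp => ?_
    rw [norm_mul, Complex.norm_I, one_mul]
    exact hKb p.1 hp.1 p.2 ⟨hp.2.1.le, hp.2.2⟩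
  have hθint : ∀ ρ ∈ Ioi (0:ℝ), ∫ θ in Ioc θ₁ θ₂, Complex.I * K ρ θ
      = (H ρ θ₂ - H ρ θ₁) / ρ := by
    intro ρ hρ
    have hρ' : (0:ℝ) < ρ := hρ
    have hc : (ρ : ℂ) ≠ 0 := by exact_mod_cast hρ'.ne'
    rw [← intervalIntegral.integral_of_le hθ]
    have := intervalIntegral.integral_eq_sub_of_hasDerivAt
      (a := θ₁) (b := θ₂) (f := fun θ => H ρ θ)
      (fun θ _ => hdθ ρ hρ' θ)
      (Continuous.intervalIntegrable (continuous_const.mul (hKc ρ)) _ _)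
    rw [← this, eq_div_iff hc, mul_comm, ← intervalIntegral.integral_const_mul]
    congr 1; ext θ; ring
  have hρint : ∀ θ ∈ Ioc θ₁ θ₂, ∫ ρ in Ioi (0:ℝ), Complex.I * K ρ θ = -Complex.I * c := by
    intro θ hθ'
    have hθ'' : θ ∈ Icc θ₁ θ₂ := ⟨hθ'.1.le, hθ'.2⟩
    rw [integral_const_mul]
    rw [integral_Ioi_of_hasDerivAt_of_tendsto (f := fun ρ => H ρ θ) (m := 0)]
    · simp [hH0]
    · exact (hHc θ).continuousWithinAt
    · intro ρ hρ; exact hdρ ρ hρ θ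
    · refine Integrable.mono' hg ?_ ?_
      · exact (hKm.comp (measurable_id.prodMk measurable_const)).aestronglyMeasurable
      · rw [ae_restrict_iff' measurableSet_Ioi]
        exact Eventually.of_forall fun ρ hρ => hKb ρ hρ θ hθ''
    · exact hlim θ hθ''
  constructor
  · refine IntegrableOn.congr_fun (f := fun ρ => ∫ θ in Ioc θ₁ θ₂, Complex.I * K ρ θ) ?_ hθint
      measurableSet_Ioi
    exact hprod.integral_prod_left
  · rw [← setIntegral_congr_fun measurableSet_Ioi hθint]
    rw [integral_integral_swap hprod, setIntegral_congr_fun measurableSet_Ioc hρint]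
    simp [hθ, mul_comm]

lemma rot_main (a ε θ₁ θ₂ : ℝ) (B : ℝ → ℝ) (ha : 0 < a) (hε : 0 ≤ ε) (hθ : θ₁ ≤ θ₂)
    (hB : ∀ ρ > 0, ∀ θ ∈ Icc θ₁ θ₂, ‖Complex.exp (rotW a ε ρ θ)‖ ≤ B ρ)
    (hBi : IntegrableOn (fun ρ => B ρ * (1 + ε * a * ρ ^ (a - 1))) (Ioi 0))
    (hB0 : Tendsto B atTop (nhds 0)) :
    IntegrableOn (fun ρ : ℝ => (Complex.exp (rotW a ε ρ θ₂) - Complex.exp (rotW a ε ρ θ₁)) / ρ) (Ioi 0) ∧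
    ∫ ρ in Ioi (0:ℝ), (Complex.exp (rotW a ε ρ θ₂) - Complex.exp (rotW a ε ρ θ₁)) / ρ
      = -Complex.I * (θ₂ - θ₁ : ℝ) := by
  have := rot_gen (fun ρ θ => Complex.exp (rotW a ε ρ θ)) (rotK a ε) 1
    (fun ρ => B ρ * (1 + ε * a * ρ ^ (a - 1))) θ₁ θ₂ hθ
    (fun ρ hρ θ => hasDerivAt_rho a ε ρ θ hρ) (fun ρ hρ θ => hasDerivAt_theta a ε ρ θ hρ)
    (measurable_rotK a ε) (fun ρ => by unfold rotK rotW; fun_prop)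
    (by
      intro ρ hρ θ hθ
      refine (norm_rotK_le a ε ρ θ ha hε hρ).trans ?_
      gcongr
      exact hB ρ hρ θ hθ)
    hBi
    (by
      intro θ
      unfold rotW
      have : Continuous fun ρ : ℝ => ρ ^ a := Real.continuous_rpow_const ha.le
      fun_prop)
    (by intro θ; simp [rotW, Real.zero_rpow ha.ne'])
    (by
      intro θ hθ
      refine squeeze_zero_norm' ?_ hB0
      filter_upwards [eventually_gt_atTop 0] with ρ hρ
      exact hB ρ hρ θ hθ)
  simpa using this

lemma norm_exp_sub_one_le_of_re {z : ℂ} (hz : z.re ≤ 0) : ‖Complex.exp z - 1‖ ≤ ‖z‖ := by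
  have := Convex.norm_image_sub_le_of_norm_hasDerivWithin_le (s := {z : ℂ | z.re ≤ 0}) (C := 1)
    (f := Complex.exp) (f' := Complex.exp) (x := 0) (y := z)
    (fun x _ => (Complex.hasDerivAt_exp x).hasDerivWithinAt)
    (fun x hx => by rw [Complex.norm_exp]; exact Real.exp_le_one_iff.2 hx)
    (convex_halfSpace_re_le 0) (by simp) hz
  simpa using this

lemma int_aux {c p q : ℝ} (hc : 0 < c) (hp : 0 < p) (hq : -1 < q) :
    IntegrableOn (fun x : ℝ => exp (-c * x ^ p) * x ^ q) (Ioi 0) := by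
  simpa only [mul_comm] using integrableOn_rpow_mul_exp_neg_mul_rpow hq hp hc

lemma int_aux0 {c p : ℝ} (hc : 0 < c) (hp : 0 < p) :
    IntegrableOn (fun x : ℝ => exp (-c * x ^ p)) (Ioi 0) := by
  simpa using int_aux hc hp (q := 0) (by norm_num)

lemma tend_aux {c p : ℝ} (hc : 0 < c) (hp : 0 < p) :
    Tendsto (fun x : ℝ => exp (-c * x ^ p)) atTop (nhds 0) := by
  apply Real.tendsto_exp_atBot.comp
  exact (tendsto_rpow_atTop hp).const_mul_atTop_of_neg (by linarith)

lemma rotW_split (a ε ρ θ : ℝ) : rotW a ε ρ θ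
    = rotW a 0 ρ θ + -(ε * ((ρ ^ a : ℝ) : ℂ) * Complex.exp ((a * θ : ℝ) * Complex.I)) := by
  unfold rotW; push_cast; ring

lemma norm_exp_W0 (a ρ : ℝ) :
    ‖Complex.exp (rotW a 0 ρ (π / 4))‖ = exp (-(sin (π / 4)) * ρ ^ (1:ℝ)) := by
  rw [Complex.norm_exp, rotW_re, Real.rpow_one]; congr 1; ring

lemma sin_pi4 : 0 < sin (π / 4) := Real.sin_pos_of_pos_of_lt_pi (by positivity) (by linarith [pi_pos])

lemma cos_pi4 {a : ℝ} (ha : 0 < a) (ha2 : a < 2) : 0 < cos (a * (π / 4)) := by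
  apply Real.cos_pos_of_mem_Ioo
  constructor <;> nlinarith [pi_pos]

/-- pointwise bound -/
lemma diff_bound (a ε ρ : ℝ) (ha : 0 < a) (ha2 : a < 2) (hε : 0 < ε) (hρ : 0 < ρ) :
    ‖(Complex.exp (rotW a 0 ρ (π/4)) - Complex.exp (rotW a ε ρ (π/4))) / ρ / ε‖
      ≤ exp (-(sin (π / 4)) * ρ ^ (1:ℝ)) * ρ ^ (a - 1) := by
  rw [rotW_split a ε, Complex.exp_add]
  set u : ℂ := -(ε * ((ρ ^ a : ℝ) : ℂ) * Complex.exp ((a * (π/4) : ℝ) * Complex.I)) with hu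
  have hre : u.re ≤ 0 := by
    have : u.re = -(ε * ρ ^ a * cos (a * (π/4))) := by
      rw [hu, Complex.exp_mul_I, ← Complex.ofReal_cos, ← Complex.ofReal_sin]
      simp only [Complex.neg_re, Complex.mul_re, Complex.mul_im, Complex.add_re, Complex.add_im,
        Complex.ofReal_re, Complex.ofReal_im, Complex.I_re, Complex.I_im]
      ring
    rw [this]
    have := cos_pi4 ha ha2
    have : 0 ≤ ε * ρ ^ a * cos (a * (π/4)) := by positivity
    linarith
  have hn : ‖u‖ = ε * ρ ^ a := by
    rw [hu, norm_neg, norm_mul, norm_mul, Complex.norm_exp_ofReal_mul_I, Complex.norm_real,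
      Complex.norm_real, Real.norm_of_nonneg hε.le, Real.norm_of_nonneg (by positivity), mul_one]
  have h1 := norm_exp_sub_one_le_of_re hre
  rw [show Complex.exp (rotW a 0 ρ (π/4)) - Complex.exp (rotW a 0 ρ (π/4)) * Complex.exp u
    = -(Complex.exp (rotW a 0 ρ (π/4)) * (Complex.exp u - 1)) by ring]
  rw [norm_div, norm_div, norm_neg, norm_mul, norm_exp_W0, Complex.norm_real,
    Complex.norm_real, Real.norm_of_nonneg hε.le, Real.norm_of_nonneg hρ.le,
    Real.rpow_sub_one hρ.ne', div_div, mul_div_assoc]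
  rw [hn] at h1
  refine mul_le_mul_of_nonneg_left ?_ (exp_pos _).le
  calc _ ≤ (ε * ρ ^ a) / (ρ * ε) := by gcongr
    _ = _ := by field_simp

lemma diff_meas (a ε : ℝ) : Measurable fun ρ : ℝ =>
    (Complex.exp (rotW a 0 ρ (π/4)) - Complex.exp (rotW a ε ρ (π/4))) / ρ := by
  unfold rotW; fun_prop

lemma diff_int (a ε : ℝ) (ha : 0 < a) (ha2 : a < 2) (hε : 0 < ε) :
    IntegrableOn (fun ρ : ℝ =>
    (Complex.exp (rotW a 0 ρ (π/4)) - Complex.exp (rotW a ε ρ (π/4))) / ρ) (Ioi 0) := by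
  have h : IntegrableOn (fun ρ : ℝ =>
    (Complex.exp (rotW a 0 ρ (π/4)) - Complex.exp (rotW a ε ρ (π/4))) / ρ / ε) (Ioi 0) := by
    refine Integrable.mono' (int_aux sin_pi4 one_pos (q := a - 1) (by linarith))
      ((diff_meas a ε).div_const _).aestronglyMeasurable ?_
    rw [ae_restrict_iff' measurableSet_Ioi]
    exact Eventually.of_forall fun ρ hρ => diff_bound a ε ρ ha ha2 hε hρ
  have := h.mul_const (ε : ℂ)
  have hc : (ε : ℂ) ≠ 0 := by exact_mod_cast hε.ne'
  simp only [div_mul_cancel₀ _ hc] at this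
  exact this

lemma sin_int (a ε : ℝ) (ha : 0 < a) (hε : 0 < ε) :
    IntegrableOn (fun ρ : ℝ => sin ρ / ρ * exp (-(ε * ρ ^ a))) (Ioi 0) := by
  refine Integrable.mono' (int_aux0 hε ha) (by fun_prop) ?_
  rw [ae_restrict_iff' measurableSet_Ioi]
  refine Eventually.of_forall fun ρ hρ => ?_
  have hρ' : (0:ℝ) < ρ := hρ
  rw [norm_mul, Real.norm_of_nonneg (exp_pos _).le, norm_div, Real.norm_of_nonneg hρ'.le, neg_mul]
  have : ‖sin ρ‖ / ρ ≤ 1 := by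
    rw [div_le_one hρ', Real.norm_eq_abs]
    have := Real.abs_sin_le_abs (x := ρ)
    rwa [abs_of_pos hρ'] at this
  exact mul_le_of_le_one_left (exp_pos _).le this

lemma exp_W_half (a ρ : ℝ) : Complex.exp (rotW a 0 ρ (π/2)) = ((exp (-ρ) : ℝ) : ℂ) := by
  have : rotW a 0 ρ (π/2) = ((-ρ : ℝ) : ℂ) := by
    unfold rotW
    have : Complex.exp (((π / 2 : ℝ) : ℂ) * Complex.I) = Complex.I := by
      rw [Complex.exp_mul_I, ← Complex.ofReal_cos, ← Complex.ofReal_sin]; simp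
    rw [this]
    simp only [Complex.ofReal_zero, zero_mul, sub_zero]
    rw [mul_right_comm, Complex.I_mul_I]; simp
  rw [this, Complex.ofReal_exp]

lemma rot_identity (a ε : ℝ) (ha : 0 < a) (ha2 : a < 2) (hε : 0 < ε) :
    π / 2 - ∫ ρ in Ioi (0:ℝ), sin ρ / ρ * exp (-(ε * ρ ^ a))
     = (∫ ρ in Ioi (0:ℝ), (Complex.exp (rotW a 0 ρ (π/4)) - Complex.exp (rotW a ε ρ (π/4))) / ρ).im := by
  have hcp := cos_pi4 ha ha2
  have hc : 0 < ε * cos (a * (π/4)) := by positivity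
  obtain ⟨i1, e1⟩ := rot_main a ε 0 (π/4) (fun ρ => exp (-(ε * cos (a * (π/4))) * ρ ^ a)) ha hε.le
    (by positivity)
    (by
      intro ρ hρ θ hθ
      rw [Complex.norm_exp, rotW_re]
      apply Real.exp_le_exp.2
      have h1 : 0 ≤ sin θ := Real.sin_nonneg_of_nonneg_of_le_pi hθ.1 (by linarith [hθ.2, pi_pos])
      have h2 : cos (a * (π/4)) ≤ cos (a * θ) := by
        apply Real.cos_le_cos_of_nonneg_of_le_pi
        · have := hθ.1; positivity
        · nlinarith [pi_pos]
        · have := hθ.2; gcongr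
      have h3 : ε * ρ ^ a * cos (a * (π/4)) ≤ ε * ρ ^ a * cos (a * θ) := by gcongr
      have h4 : 0 ≤ ρ * sin θ := by positivity
      linarith)
    (by
      have := (int_aux0 hc ha).add ((int_aux hc ha (q := a - 1) (by linarith)).const_mul (ε * a))
      refine this.congr (Eventually.of_forall fun ρ => ?_)
      simp only [Pi.add_apply]; ring)
    (tend_aux hc ha)
  obtain ⟨i2, e2⟩ := rot_main a 0 (π/4) (π/2) (fun ρ => exp (-(sin (π/4)) * ρ ^ (1:ℝ))) ha le_rfl
    (by linarith [pi_pos])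
    (by
      intro ρ hρ θ hθ
      rw [Complex.norm_exp, rotW_re]
      apply Real.exp_le_exp.2
      have h2 : sin (π/4) ≤ sin θ := by
        apply Real.sin_le_sin_of_le_of_le_pi_div_two
        · linarith [pi_pos]
        · exact hθ.2
        · exact hθ.1
      have h3 : ρ * sin (π/4) ≤ ρ * sin θ := by gcongr
      rw [Real.rpow_one]
      linarith)
    (by simpa using int_aux0 sin_pi4 one_pos)
    (tend_aux sin_pi4 one_pos)
  have i3 := diff_int a ε ha ha2 hε
  have hsum : ∫ ρ in Ioi (0:ℝ), sin ρ / ρ * exp (-(ε * ρ ^ a)) =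
      ∫ ρ in Ioi (0:ℝ), (-((Complex.exp (rotW a ε ρ (π/4)) - Complex.exp (rotW a ε ρ 0)) / ρ
        + (Complex.exp (rotW a 0 ρ (π/2)) - Complex.exp (rotW a 0 ρ (π/4))) / ρ
        + (Complex.exp (rotW a 0 ρ (π/4)) - Complex.exp (rotW a ε ρ (π/4))) / ρ)).im := by
    refine setIntegral_congr_fun measurableSet_Ioi fun ρ hρ => ?_
    have e0 := exp_W_half a ρ
    have e3 : (Complex.exp (rotW a ε ρ 0)).im = sin ρ * exp (-(ε * ρ ^ a)) := by
      have : rotW a ε ρ 0 = ((-(ε * ρ ^ a) : ℝ) : ℂ) + ((ρ : ℝ) : ℂ) * Complex.I := by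
        unfold rotW; simp; ring
      rw [this, Complex.exp_im]; simp; ring
    try simp only
    rw [show -((Complex.exp (rotW a ε ρ (π/4)) - Complex.exp (rotW a ε ρ 0)) / ρ
        + (Complex.exp (rotW a 0 ρ (π/2)) - Complex.exp (rotW a 0 ρ (π/4))) / ρ
        + (Complex.exp (rotW a 0 ρ (π/4)) - Complex.exp (rotW a ε ρ (π/4))) / ρ)
        = (Complex.exp (rotW a ε ρ 0) - Complex.exp (rotW a 0 ρ (π/2))) / ρ by ring,
      Complex.div_ofReal_im, Complex.sub_im, e0, e3, Complex.ofReal_im]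
    ring
  have i12 := i1.add i2
  have i123 := (i12.add i3).neg
  have him := integral_im (𝕜 := ℂ) i123
  have e4 := integral_add i12 i3
  have e5 := integral_add i1 i2
  simp only [Pi.add_apply, Pi.neg_apply, RCLike.im_to_complex] at him e4 e5
  rw [hsum, him, integral_neg, e4, e5, e1, e2]
  simp
  try ring

lemma rot_limit (a : ℝ) (ha : 0 < a) (ha2 : a < 2) :
    Tendsto (fun ε : ℝ => ∫ ρ in Ioi (0:ℝ),
      (Complex.exp (rotW a 0 ρ (π/4)) - Complex.exp (rotW a ε ρ (π/4))) / ρ / ε)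
      (nhdsWithin 0 (Ioi 0))
      (nhds (∫ ρ in Ioi (0:ℝ), Complex.exp (rotW a 0 ρ (π/4)) * ((ρ ^ (a - 1) : ℝ) : ℂ)
        * Complex.exp ((a * (π/4) : ℝ) * Complex.I))) := by
  refine tendsto_integral_filter_of_dominated_convergence
    (fun ρ => exp (-(sin (π / 4)) * ρ ^ (1:ℝ)) * ρ ^ (a - 1)) ?_ ?_
    (int_aux sin_pi4 one_pos (q := a - 1) (by linarith)) ?_
  · exact Eventually.of_forall fun ε => ((diff_meas a ε).div_const _).aestronglyMeasurable
  · filter_upwards [self_mem_nhdsWithin] with ε hε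
    rw [ae_restrict_iff' measurableSet_Ioi]
    exact Eventually.of_forall fun ρ hρ => diff_bound a ε ρ ha ha2 hε hρ
  · rw [ae_restrict_iff' measurableSet_Ioi]
    refine Eventually.of_forall fun ρ hρ => ?_
    have hρ' : (0:ℝ) < ρ := hρ
    have hc : (ρ : ℂ) ≠ 0 := by exact_mod_cast hρ'.ne'
    set b : ℂ := ((ρ ^ a : ℝ) : ℂ) * Complex.exp ((a * (π/4) : ℝ) * Complex.I) with hb
    have hd : HasDerivAt (fun ε : ℝ => Complex.exp (rotW a ε ρ (π/4)))
        (Complex.exp (rotW a 0 ρ (π/4)) * (-b)) 0 := by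
      apply HasDerivAt.cexp
      have h1 : HasDerivAt (fun ε : ℝ => (ε : ℂ)) 1 0 := Complex.ofRealCLM.hasDerivAt
      unfold rotW
      convert! ((h1.mul_const ((ρ ^ a : ℝ) : ℂ)).mul_const
        (Complex.exp ((a * (π/4) : ℝ) * Complex.I))).const_sub
          (Complex.I * ρ * Complex.exp ((π/4 : ℝ) * Complex.I)) using 1
      simp [hb]
    have h2 := (hasDerivAt_iff_tendsto_slope.1 hd).mono_left
      (nhdsWithin_mono 0 (fun x (hx : 0 < x) => hx.ne'))
    have h3 := h2.mul_const (-(1 / (ρ : ℂ)))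
    refine (h3.congr' ?_).trans_eq ?_
    · filter_upwards with ε
      simp only [slope, vsub_eq_sub, sub_zero, Complex.real_smul, Complex.ofReal_inv]
      ring
    · congr 1
      rw [Real.rpow_sub_one hρ'.ne', hb]
      push_cast
      field_simp

lemma gamma_val (a : ℝ) (ha : 0 < a) :
    (∫ ρ in Ioi (0:ℝ), Complex.exp (rotW a 0 ρ (π/4)) * ((ρ ^ (a - 1) : ℝ) : ℂ)
        * Complex.exp ((a * (π/4) : ℝ) * Complex.I)).im = sin (a * (π/2)) * Gamma a := by
  have hp : ∀ ρ : ℝ, 0 < ρ → ρ ^ a = ρ * ρ ^ (a - 1) := by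
    intro ρ hρ
    rw [Real.rpow_sub_one hρ.ne']; field_simp
  have hbd : ∀ ρ > 0, ∀ θ ∈ Icc (π/4) (π/2),
      ‖Complex.exp (rotW a 0 ρ θ)‖ ≤ exp (-(sin (π/4)) * ρ ^ (1:ℝ)) := by
    intro ρ hρ θ hθ
    rw [Complex.norm_exp, rotW_re]
    apply Real.exp_le_exp.2
    have h2 : sin (π/4) ≤ sin θ := by
      apply Real.sin_le_sin_of_le_of_le_pi_div_two
      · linarith [pi_pos]
      · exact hθ.2
      · exact hθ.1
    have h3 : ρ * sin (π/4) ≤ ρ * sin θ := by gcongr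
    rw [Real.rpow_one]
    linarith
  have hlim0 : Tendsto (fun ρ : ℝ => exp (-(sin (π/4)) * ρ ^ (1:ℝ)) * ρ ^ a) atTop (nhds 0) := by
    have := tendsto_rpow_mul_exp_neg_mul_atTop_nhds_zero a (sin (π/4)) sin_pi4
    simpa only [Real.rpow_one, mul_comm] using this
  obtain ⟨-, e⟩ := rot_gen
    (fun ρ θ => Complex.exp (rotW a 0 ρ θ) * (((ρ ^ a : ℝ) : ℂ) * Complex.exp ((a * θ : ℝ) * Complex.I)))
    (fun ρ θ => rotK a 0 ρ θ * (((ρ ^ a : ℝ) : ℂ) * Complex.exp ((a * θ : ℝ) * Complex.I))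
      + Complex.exp (rotW a 0 ρ θ) * (((a * ρ ^ (a - 1) : ℝ) : ℂ) * Complex.exp ((a * θ : ℝ) * Complex.I)))
    0 (fun ρ => exp (-(sin (π/4)) * ρ ^ (1:ℝ)) * ρ ^ a
      + a * (exp (-(sin (π/4)) * ρ ^ (1:ℝ)) * ρ ^ (a - 1))) (π/4) (π/2) (by linarith [pi_pos])
    (by
      intro ρ hρ θ
      have h2 : HasDerivAt (fun ρ : ℝ => ((ρ ^ a : ℝ) : ℂ)) ((a * ρ ^ (a - 1) : ℝ) : ℂ) ρ :=
        (Real.hasDerivAt_rpow_const (Or.inl hρ.ne')).ofReal_comp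
      exact (hasDerivAt_rho a 0 ρ θ hρ).mul (h2.mul_const _))
    (by
      intro ρ hρ θ
      have h2 : HasDerivAt (fun θ : ℝ => ((a * θ : ℝ) : ℂ)) (a : ℂ) θ := by
        simpa using ((hasDerivAt_id θ).const_mul a).ofReal_comp
      convert! (hasDerivAt_theta a 0 ρ θ hρ).mul
        ((h2.mul_const Complex.I).cexp.const_mul ((ρ ^ a : ℝ) : ℂ)) using 1
      rw [hp ρ hρ]
      push_cast
      ring)
    (by unfold rotK rotW; fun_prop)
    (by intro ρ; unfold rotK rotW; fun_prop)
    (by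
      intro ρ hρ θ hθ
      have hr : 0 < ρ := hρ
      refine (norm_add_le _ _).trans ?_
      have h1 := norm_rotK_le a 0 ρ θ ha le_rfl hρ
      have h2 := hbd ρ hρ θ hθ
      rw [zero_mul, zero_mul, add_zero, mul_one] at h1
      rw [norm_mul, norm_mul, norm_mul, norm_mul, Complex.norm_exp_ofReal_mul_I,
        Complex.norm_real, Complex.norm_real, Real.norm_of_nonneg (by positivity),
        Real.norm_of_nonneg (by positivity), mul_one, mul_one, mul_left_comm a]
      have h3 := h1.trans h2
      gcongr)
    ((int_aux sin_pi4 one_pos (q := a) (by linarith)).add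
      ((int_aux sin_pi4 one_pos (q := a - 1) (by linarith)).const_mul a))
    (by
      intro θ
      unfold rotW
      have : Continuous fun ρ : ℝ => ρ ^ a := Real.continuous_rpow_const ha.le
      fun_prop)
    (by intro θ; simp [Real.zero_rpow ha.ne'])
    (by
      intro θ hθ
      refine squeeze_zero_norm' ?_ hlim0
      filter_upwards [eventually_gt_atTop 0] with ρ hρ
      rw [norm_mul, norm_mul, Complex.norm_exp_ofReal_mul_I, Complex.norm_real,
        Real.norm_of_nonneg (by positivity), mul_one]
      gcongr
      exact hbd ρ hρ θ hθ)
  have hi : ∀ θ ∈ Icc (π/4) (π/2), IntegrableOn (fun ρ : ℝ => Complex.exp (rotW a 0 ρ θ)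
      * ((ρ ^ (a - 1) : ℝ) : ℂ) * Complex.exp ((a * θ : ℝ) * Complex.I)) (Ioi 0) := by
    intro θ hθ
    refine Integrable.mono' (int_aux sin_pi4 one_pos (q := a - 1) (by linarith))
      (Measurable.aestronglyMeasurable (by unfold rotW; fun_prop)) ?_
    rw [ae_restrict_iff' measurableSet_Ioi]
    refine Eventually.of_forall fun ρ hρ => ?_
    have hr : 0 < ρ := hρ
    rw [norm_mul, norm_mul, Complex.norm_exp_ofReal_mul_I, Complex.norm_real,
      Real.norm_of_nonneg (by positivity), mul_one]
    gcongr
    exact hbd ρ hρ θ hθ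
  have hp4 := hi (π/4) ⟨le_rfl, by linarith [pi_pos]⟩
  have hp2 := hi (π/2) ⟨by linarith [pi_pos], le_rfl⟩
  have hsub := integral_sub hp2 hp4
  have hcongr : ∫ ρ in Ioi (0:ℝ), (Complex.exp (rotW a 0 ρ (π/2)) * ((ρ ^ (a - 1) : ℝ) : ℂ)
        * Complex.exp ((a * (π/2) : ℝ) * Complex.I)
      - Complex.exp (rotW a 0 ρ (π/4)) * ((ρ ^ (a - 1) : ℝ) : ℂ)
        * Complex.exp ((a * (π/4) : ℝ) * Complex.I)) = 0 := by
    rw [mul_zero, zero_mul] at e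
    rw [← e]
    refine setIntegral_congr_fun measurableSet_Ioi fun ρ hρ => ?_
    have hr : 0 < ρ := hρ
    have hc : (ρ : ℂ) ≠ 0 := by exact_mod_cast hr.ne'
    beta_reduce
    rw [hp ρ hr]
    push_cast
    field_simp
  rw [hcongr] at hsub
  rw [← sub_eq_zero.1 hsub.symm]
  have hval : ∫ ρ in Ioi (0:ℝ), Complex.exp (rotW a 0 ρ (π/2)) * ((ρ ^ (a - 1) : ℝ) : ℂ)
        * Complex.exp ((a * (π/2) : ℝ) * Complex.I)
      = (Gamma a : ℝ) * Complex.exp ((a * (π/2) : ℝ) * Complex.I) := by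
    rw [integral_mul_const, Real.Gamma_eq_integral ha, ← integral_complex_ofReal]
    congr 1
    refine setIntegral_congr_fun measurableSet_Ioi fun ρ hρ => ?_
    beta_reduce
    rw [exp_W_half]
    push_cast
    ring
  rw [hval, Complex.im_ofReal_mul, Complex.exp_ofReal_mul_I_im, mul_comm]

lemma layer_scale (s t x : ℝ) (hx : 0 < x) : layerV s t x =
    (2/π) * ∫ ρ in Ioi (0:ℝ), sin ρ / ρ * exp (-((t * x ^ (-(2*s))) * ρ ^ (2*s))) := by
  unfold layerV
  congr 1
  have := integral_comp_mul_left_Ioi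
    (fun ρ => sin ρ / ρ * exp (-((t * x ^ (-(2*s))) * ρ ^ (2*s)))) 0 hx
  rw [mul_zero, smul_eq_mul, eq_comm, inv_mul_eq_iff_eq_mul₀ hx.ne', ← integral_const_mul] at this
  rw [this]
  refine setIntegral_congr_fun measurableSet_Ioi fun ρ hρ => ?_
  have hρ' : (0:ℝ) < ρ := hρ
  try simp only
  rw [Real.mul_rpow hx.le hρ'.le, Real.rpow_neg hx.le]
  have : x ^ (2*s) ≠ 0 := (Real.rpow_pos_of_pos hx _).ne'
  have e : t * (x ^ (2*s))⁻¹ * (x ^ (2*s) * ρ ^ (2*s)) = t * ρ ^ (2*s) := by field_simp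
  rw [e]
  field_simp

lemma layer_pos (s t : ℝ) (hs : s ∈ Set.Ioo (0:ℝ) 1) (ht : 0 < t) :
    Tendsto (fun x : ℝ => x ^ (2*s) * (1 - layerV s t x)) atTop
      (nhds (t * (2/π) * Real.sin (π*s) * Real.Gamma (2*s))) := by
  have ha : 0 < 2 * s := by linarith [hs.1]
  have ha2 : 2 * s < 2 := by linarith [hs.2]
  have hε : Tendsto (fun x : ℝ => t * x ^ (-(2*s))) atTop (nhdsWithin 0 (Ioi 0)) := by
    rw [tendsto_nhdsWithin_iff]
    constructor
    · simpa using (tendsto_rpow_neg_atTop ha).const_mul t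
    · filter_upwards [eventually_gt_atTop 0] with x hx
      exact mul_pos ht (Real.rpow_pos_of_pos hx _)
  have h1 := (Complex.continuous_im.tendsto _).comp ((rot_limit (2*s) ha ha2).comp hε)
  rw [gamma_val _ ha] at h1
  have h2 := h1.const_mul (t * (2/π))
  refine (h2.congr' ?_).trans_eq ?_
  · filter_upwards [eventually_gt_atTop 0] with x hx
    have hx2 : 0 < x ^ (2*s) := Real.rpow_pos_of_pos hx _
    have hpos : 0 < t * x ^ (-(2*s)) := mul_pos ht (Real.rpow_pos_of_pos hx _)
    simp only [Function.comp]
    rw [integral_div, Complex.div_ofReal_im, ← rot_identity _ _ ha ha2 hpos, layer_scale s t x hx]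
    set Q := ∫ ρ in Ioi (0:ℝ), sin ρ / ρ * exp (-((t * x ^ (-(2*s))) * ρ ^ (2*s)))
    rw [Real.rpow_neg hx.le]
    have := pi_pos.ne'
    field_simp
  · congr 1
    rw [show 2 * s * (π / 2) = π * s by ring]; ring

lemma layer_odd (s t x : ℝ) : layerV s t (-x) = - layerV s t x := by
  unfold layerV
  rw [← mul_neg, ← integral_neg]
  congr 2; ext r
  rw [neg_mul, Real.sin_neg]; ring

/-- Asymptotics of `v^t_s` at `±∞`. -/
theorem statement12 (s t : ℝ) (hs : s ∈ Set.Ioo (0:ℝ) 1) (ht : 0 < t) :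
    Tendsto (fun x : ℝ => x ^ (2*s) * (1 - layerV s t x)) atTop
      (nhds (t * (2/π) * Real.sin (π*s) * Real.Gamma (2*s))) ∧
    0 < t * (2/π) * Real.sin (π*s) * Real.Gamma (2*s) ∧
    Tendsto (fun x : ℝ => |x| ^ (2*s) * (1 + layerV s t x)) atBot
      (nhds (t * (2/π) * Real.sin (π*s) * Real.Gamma (2*s))) := by
  have hpos := layer_pos s t hs ht
  refine ⟨hpos, ?_, ?_⟩
  · have h1 : 0 < Real.sin (π * s) :=
      Real.sin_pos_of_pos_of_lt_pi (mul_pos pi_pos hs.1) (by nlinarith [pi_pos, hs.2])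
    have h2 : 0 < Real.Gamma (2*s) := Real.Gamma_pos_of_pos (by linarith [hs.1])
    have := pi_pos
    positivity
  · refine (hpos.comp tendsto_neg_atBot_atTop).congr' ?_
    filter_upwards [eventually_lt_atBot 0] with x hx
    simp only [Function.comp]
    rw [layer_odd, abs_of_neg hx, sub_neg_eq_add]
end

section
/- Let s ∈ (0,1), let q(x) = (1/π) ∫₀^∞ cos(xr) e^{−r^{2s}} dr, and let q′ denote its derivative. Then lim_{x→+∞} x^{1+4s} ((1+2s) q(x) + x q′(x)) = (8 s²/π) sin(πs) cos(πs) Γ(4s). -/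
open Real MeasureTheory Filter Set

lemma cv_int {E : Type*} [NormedAddCommGroup E] [NormedSpace ℝ E] (g : ℝ → E) :
    ∫ r in Ioi (0:ℝ), g r = ∫ t : ℝ, rexp t • g (rexp t) := by
  have h := integral_image_eq_integral_abs_deriv_smul
      (MeasurableSet.univ) (fun x _ ↦ (Real.hasDerivAt_exp x).hasDerivWithinAt)
      (fun x _ y _ hxy ↦ Real.exp_injective hxy) g
  rw [image_univ, Real.range_exp] at h
  simpa [abs_of_pos (Real.exp_pos _)] using h

lemma cv_integrable {E : Type*} [NormedAddCommGroup E] [NormedSpace ℝ E] (g : ℝ → E) :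
    IntegrableOn g (Ioi (0:ℝ)) ↔ Integrable (fun t : ℝ => rexp t • g (rexp t)) := by
  have h := integrableOn_image_iff_integrableOn_abs_deriv_smul
      (MeasurableSet.univ) (fun x _ ↦ (Real.hasDerivAt_exp x).hasDerivWithinAt)
      (fun x _ y _ hxy ↦ Real.exp_injective hxy) g
  rw [image_univ, Real.range_exp] at h
  simpa [abs_of_pos (Real.exp_pos _)] using h

lemma bound_integrable {α β c : ℝ} (hα : 0 < α) (hβ : 0 < β) (hc : 0 < c) :
    Integrable (fun t : ℝ => rexp (β * t - c * rexp (α * t))) := by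
  have h := integrableOn_rpow_mul_exp_neg_mul_rpow (p := α) (s := β - 1) (b := c)
    (by linarith) hα hc
  rw [cv_integrable] at h
  refine h.congr (Eventually.of_forall fun t => ?_)
  simp only [smul_eq_mul]
  rw [← Real.exp_mul, ← Real.exp_mul, ← Real.exp_add, ← Real.exp_add]
  congr 1
  rw [mul_comm t α]
  ring

lemma bound_tendsto_top {α β c : ℝ} (hα : 0 < α) (hc : 0 < c) :
    Tendsto (fun t : ℝ => rexp (β * t - c * rexp (α * t))) atTop (nhds 0) := by
  have h1 := tendsto_rpow_mul_exp_neg_mul_atTop_nhds_zero (β / α) c hc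
  have h2 : Tendsto (fun t : ℝ => rexp (α * t)) atTop atTop :=
    Real.tendsto_exp_atTop.comp (tendsto_id.const_mul_atTop hα)
  refine (h1.comp h2).congr fun t => ?_
  simp only [Function.comp]
  rw [← Real.exp_mul, ← Real.exp_add]
  congr 1
  field_simp
  ring

lemma bound_tendsto_bot {α β c : ℝ} (hβ : 0 < β) (hc : 0 < c) :
    Tendsto (fun t : ℝ => rexp (β * t - c * rexp (α * t))) atBot (nhds 0) := by
  have h2 : Tendsto (fun t : ℝ => rexp (β * t)) atBot (nhds 0) :=
    Real.tendsto_exp_atBot.comp (tendsto_id.const_mul_atBot hβ)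
  refine squeeze_zero (fun t => (Real.exp_pos _).le) (fun t => ?_) h2
  apply Real.exp_le_exp.2
  have := Real.exp_pos (α * t)
  nlinarith

/-- the integrand in logarithmic coordinates -/
noncomputable def GG (α β ε : ℝ) (z : ℂ) : ℂ :=
  Complex.exp (Complex.I * Complex.exp z + β * z - ε * Complex.exp (α * z))

lemma GG_norm (α β ε t y : ℝ) : ‖GG α β ε (t + y * Complex.I)‖ =
    rexp (-rexp t * Real.sin y + β * t - ε * (rexp (α * t) * Real.cos (α * y))) := by
  rw [GG, Complex.norm_exp]
  congr 1
  have : (α:ℂ) * (t + y * Complex.I) = ((α * t : ℝ) : ℂ) + ((α * y : ℝ) : ℂ) * Complex.I := by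
    push_cast; ring
  rw [this]
  simp [Complex.exp_re, Complex.exp_im]

lemma GG_bound {α β ε t y : ℝ} (hα : 0 < α) (hα2 : α < 2) (hε : 0 ≤ ε)
    (hy : y ∈ Icc 0 (π/4)) : ‖GG α β ε (t + y * Complex.I)‖ ≤
      rexp (β * t - (ε * Real.cos (α * (π/4))) * rexp (α * t)) := by
  rw [GG_norm]
  apply Real.exp_le_exp.2
  have h1 : 0 ≤ Real.sin y := Real.sin_nonneg_of_nonneg_of_le_pi hy.1 (by linarith [hy.2, Real.pi_pos])
  have h2 : Real.cos (α * (π/4)) ≤ Real.cos (α * y) := by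
    apply Real.cos_le_cos_of_nonneg_of_le_pi
    · have := hy.1; positivity
    · nlinarith [Real.pi_pos]
    · exact mul_le_mul_of_nonneg_left hy.2 hα.le
  have h3 := mul_le_mul_of_nonneg_left h2 (mul_nonneg hε (Real.exp_pos (α*t)).le)
  have h4 := mul_nonneg (Real.exp_pos t).le h1
  nlinarith

lemma cos_pos' {α : ℝ} (hα : 0 < α) (hα2 : α < 2) : 0 < Real.cos (α * (π/4)) := by
  apply Real.cos_pos_of_mem_Ioo
  constructor <;> nlinarith [Real.pi_pos]

lemma GG_diff (α β ε : ℝ) : Differentiable ℂ (GG α β ε) := by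
  unfold GG; fun_prop

lemma strip_shift {G : ℂ → ℂ} (hG : Differentiable ℂ G) {α β c a b : ℝ} (hα : 0 < α)
    (hβ : 0 < β) (hc : 0 < c) (hab : a ≤ b)
    (hB : ∀ t : ℝ, ∀ y ∈ Icc a b, ‖G (t + y * Complex.I)‖ ≤ rexp (β * t - c * rexp (α * t))) :
    ∫ t : ℝ, G (t + a * Complex.I) = ∫ t : ℝ, G (t + b * Complex.I) := by
  have hGc := hG.continuous
  have int : ∀ y ∈ Icc a b, Integrable (fun t : ℝ => G (t + y * Complex.I)) := fun y hy => by
    refine (bound_integrable hα hβ hc).mono' ?_ (Eventually.of_forall fun t => hB t y hy)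
    exact Continuous.aestronglyMeasurable (by fun_prop)
  have vert : ∀ t : ℝ, ‖∫ y : ℝ in a..b, G (t + y * Complex.I)‖ ≤
      rexp (β * t - c * rexp (α * t)) * |b - a| := fun t => by
    refine intervalIntegral.norm_integral_le_of_norm_le_const (fun y hy => ?_)
    rw [uIoc_of_le hab] at hy
    exact hB t y ⟨hy.1.le, hy.2⟩
  have t0 := intervalIntegral_tendsto_integral (int a ⟨le_rfl, hab⟩)
    tendsto_neg_atTop_atBot tendsto_id
  have t1 := intervalIntegral_tendsto_integral (int b ⟨hab, le_rfl⟩)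
    tendsto_neg_atTop_atBot tendsto_id
  have v1 : Tendsto (fun T : ℝ => ∫ y : ℝ in a..b, G (T + y * Complex.I)) atTop
      (nhds 0) := by
    apply squeeze_zero_norm vert
    simpa using (bound_tendsto_top hα hc).mul_const |b - a|
  have v0 : Tendsto (fun T : ℝ => ∫ y : ℝ in a..b, G (T + y * Complex.I)) atBot
      (nhds 0) := by
    apply squeeze_zero_norm vert
    simpa using (bound_tendsto_bot hβ hc).mul_const |b - a|
  have v0' := v0.comp tendsto_neg_atTop_atBot
  have key : Tendsto (fun T : ℝ => (∫ t in (-T)..T, G (t + a * Complex.I)) -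
      (∫ t in (-T)..T, G (t + b * Complex.I))) atTop (nhds 0) := by
    have := (v0'.const_smul Complex.I).sub (v1.const_smul Complex.I)
    simp only [smul_zero, sub_zero] at this
    refine this.congr fun T => ?_
    have h := Complex.integral_boundary_rect_eq_zero_of_differentiableOn G
      (((-T : ℝ) : ℂ) + a * Complex.I) ((T : ℝ) + b * Complex.I) hG.differentiableOn
    simp only [Complex.ofReal_re, Complex.ofReal_im, Complex.add_re, Complex.add_im,
      Complex.mul_re, Complex.mul_im, Complex.I_re, Complex.I_im, mul_zero, mul_one, zero_mul,
      sub_zero, add_zero, zero_add, Complex.ofReal_zero] at h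
    simp only [Function.comp]
    linear_combination -h
  have := tendsto_nhds_unique key (t0.sub t1)
  exact (sub_eq_zero.1 this.symm)

lemma GG_shift {α β ε : ℝ} (hα : 0 < α) (hα2 : α < 2) (hβ : 0 < β) (hε : 0 < ε) :
    ∫ t : ℝ, GG α β ε t = ∫ t : ℝ, GG α β ε (t + (π/4 : ℝ) * Complex.I) := by
  have := strip_shift (GG_diff α β ε) hα hβ (mul_pos hε (cos_pos' hα hα2)) (a := 0) (b := π/4)
    (by positivity) (fun t y hy => GG_bound hα hα2 hε.le hy)
  simpa using this

lemma GG_lim {α β : ℝ} (hα : 0 < α) (hα2 : α < 2) (hβ : 0 < β) :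
    Tendsto (fun ε : ℝ => ∫ t : ℝ, GG α β ε (t + (π/4 : ℝ) * Complex.I)) (nhdsWithin 0 (Ioi 0))
      (nhds (∫ t : ℝ, GG α β 0 (t + (π/4 : ℝ) * Complex.I))) := by
  have hp := Real.pi_pos
  have hs : 0 < Real.sin (π/4) := Real.sin_pos_of_pos_of_lt_pi (by linarith) (by linarith)
  apply tendsto_integral_filter_of_dominated_convergence
    (fun t => rexp (β * t - Real.sin (π/4) * rexp (1 * t)))
  · refine Eventually.of_forall fun ε => ?_
    have := (GG_diff α β ε).continuous
    exact Continuous.aestronglyMeasurable (by fun_prop)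
  · filter_upwards [self_mem_nhdsWithin] with ε hε
    refine Eventually.of_forall fun t => ?_
    rw [GG_norm]
    apply Real.exp_le_exp.2
    have h1 := mul_pos (mem_Ioi.1 hε) (mul_pos (Real.exp_pos (α * t)) (cos_pos' hα hα2))
    rw [one_mul]
    linarith
  · exact bound_integrable one_pos hβ hs
  · refine Eventually.of_forall fun t => ?_
    apply tendsto_nhdsWithin_of_tendsto_nhds
    apply Continuous.tendsto'
    · unfold GG; fun_prop
    · rfl

lemma GG_zero {α β : ℝ} (hβ : 0 < β) :
    ∫ t : ℝ, GG α β 0 (t + (π/4 : ℝ) * Complex.I) =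
      Complex.exp ((β * (π/2) : ℝ) * Complex.I) * (Real.Gamma β : ℝ) := by
  have hp := Real.pi_pos
  have hs : 0 < Real.sin (π/4) := Real.sin_pos_of_pos_of_lt_pi (by linarith) (by linarith)
  rw [strip_shift (GG_diff α β 0) one_pos hβ hs (a := π/4) (b := π/2) (by linarith)]
  · rw [Real.Gamma_eq_integral hβ, cv_int, ← integral_complex_ofReal, ← integral_const_mul]
    congr 1
    ext t
    have h1 : Complex.exp (t + (π/2 : ℝ) * Complex.I) = Complex.exp t * Complex.I := by
      rw [Complex.exp_add]; push_cast; rw [Complex.exp_pi_div_two_mul_I]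
    rw [GG, h1, smul_eq_mul, ← Real.exp_mul, ← Real.exp_add, ← Real.exp_add, Complex.ofReal_exp,
      ← Complex.exp_add]
    congr 1
    push_cast
    linear_combination Complex.exp t * Complex.I_mul_I
  · intro t y hy
    rw [GG_norm]
    apply Real.exp_le_exp.2
    have h2 : Real.sin (π/4) ≤ Real.sin y :=
      Real.sin_le_sin_of_le_of_le_pi_div_two (by linarith) hy.2 hy.1
    have := mul_le_mul_of_nonneg_left h2 (Real.exp_pos t).le
    rw [one_mul, zero_mul]
    linarith

lemma GG_real (α β ε t : ℝ) : GG α β ε t =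
    ((rexp (β * t - ε * rexp (α * t)) : ℝ) : ℂ) * Complex.exp ((rexp t : ℝ) * Complex.I) := by
  rw [GG, Complex.ofReal_exp, ← Complex.exp_add]
  congr 1
  push_cast
  ring

lemma sin_lim {α β : ℝ} (hα : 0 < α) (hα2 : α < 2) (hβ : 0 < β) :
    Tendsto (fun ε : ℝ => ∫ u in Ioi (0:ℝ), Real.sin u * (u ^ (β - 1) * rexp (-(ε * u ^ α))))
      (nhdsWithin 0 (Ioi 0)) (nhds (Real.sin (β * (π/2)) * Real.Gamma β)) := by
  have h := GG_lim hα hα2 hβ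
  rw [GG_zero hβ] at h
  have h2 := (Complex.continuous_im.tendsto _).comp h
  rw [Complex.im_mul_ofReal, Complex.exp_ofReal_mul_I_im] at h2
  refine h2.congr' ?_
  filter_upwards [self_mem_nhdsWithin] with ε hε
  have hε' : 0 < ε := hε
  simp only [Function.comp]
  rw [← GG_shift hα hα2 hβ hε', cv_int]
  have hi : Integrable (fun t : ℝ => GG α β ε t) := by
    refine (bound_integrable hα hβ (mul_pos hε' (cos_pos' hα hα2))).mono' ?_
      (Eventually.of_forall fun t => ?_)
    · have := (GG_diff α β ε).continuous
      exact Continuous.aestronglyMeasurable (by fun_prop)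
    · have := GG_bound (β := β) (t := t) (y := 0) hα hα2 hε'.le ⟨le_rfl, by positivity⟩
      simpa using this
  have := integral_im (𝕜 := ℂ) hi
  simp only [RCLike.im_to_complex] at this
  rw [← this]
  congr 1
  ext t
  rw [GG_real, Complex.im_ofReal_mul, Complex.exp_ofReal_mul_I_im, smul_eq_mul, ← Real.exp_mul,
    ← Real.exp_mul, show β * t - ε * rexp (α * t) = t + (t * (β - 1) + -(ε * rexp (t * α))) by
      rw [mul_comm t α]; ring, Real.exp_add, Real.exp_add]
  ring

lemma sin_lim_x {α β : ℝ} (hα : 0 < α) (hα2 : α < 2) (hβ : 0 < β) :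
    Tendsto (fun x : ℝ => x ^ β * ∫ r in Ioi (0:ℝ), Real.sin (x * r) *
      (r ^ (β - 1) * rexp (-(r ^ α))))
      atTop (nhds (Real.sin (β * (π/2)) * Real.Gamma β)) := by
  have h1 : Tendsto (fun x : ℝ => x ^ (-α)) atTop (nhdsWithin 0 (Ioi 0)) := by
    rw [tendsto_nhdsWithin_iff]
    refine ⟨tendsto_rpow_neg_atTop hα, ?_⟩
    filter_upwards [eventually_gt_atTop 0] with x hx
    exact Real.rpow_pos_of_pos hx _
  refine ((sin_lim hα hα2 hβ).comp h1).congr' ?_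
  filter_upwards [eventually_gt_atTop 0] with x hx
  simp only [Function.comp]
  have := integral_comp_mul_left_Ioi' (fun u => Real.sin u *
    (u ^ (β - 1) * rexp (-(x ^ (-α) * u ^ α)))) 0 hx
  rw [mul_zero] at this
  rw [← this, smul_eq_mul, ← integral_const_mul, ← integral_const_mul]
  refine setIntegral_congr_fun measurableSet_Ioi fun r hr => ?_
  have hr' : 0 < r := hr
  rw [Real.mul_rpow hx.le hr'.le, Real.mul_rpow hx.le hr'.le, ← mul_assoc (x ^ (-α)),
    ← Real.rpow_add hx, neg_add_cancel, Real.rpow_zero, one_mul, Real.rpow_sub_one hx.ne']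
  field_simp

lemma E_int {α γ : ℝ} (hα : 0 < α) (hγ : -1 < γ) :
    IntegrableOn (fun r : ℝ => r ^ γ * rexp (-(r ^ α))) (Ioi 0) :=
  integrableOn_rpow_mul_exp_neg_rpow hγ hα

lemma osc_int {f g : ℝ → ℝ} (hf : Continuous f) (hb : ∀ r, |f r| ≤ 1)
    (hg : IntegrableOn g (Ioi 0)) : IntegrableOn (fun r => f r * g r) (Ioi 0) :=
  Integrable.bdd_mul hg hf.aestronglyMeasurable (Eventually.of_forall hb)

lemma E_tendsto {α γ : ℝ} (hα : 0 < α) :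
    Tendsto (fun r : ℝ => r ^ γ * rexp (-(r ^ α))) atTop (nhds 0) := by
  have h1 := tendsto_rpow_mul_exp_neg_mul_atTop_nhds_zero (γ / α) 1 one_pos
  refine (h1.comp (tendsto_rpow_atTop hα)).congr' ?_
  filter_upwards [eventually_gt_atTop 0] with r hr
  simp only [Function.comp]
  rw [← Real.rpow_mul hr.le, mul_div_cancel₀ _ hα.ne']
  ring_nf

lemma osc_tendsto {f g : ℝ → ℝ} (hb : ∀ r, |f r| ≤ 1) (hg : Tendsto g atTop (nhds 0)) :
    Tendsto (fun r => f r * g r) atTop (nhds 0) := by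
  apply squeeze_zero_norm (a := fun r => |g r|) _ (by simpa using hg.abs)
  intro r
  rw [norm_mul, Real.norm_eq_abs, Real.norm_eq_abs]
  exact mul_le_of_le_one_left (abs_nonneg _) (hb r)

lemma by_parts {α : ℝ} (hα : 0 < α) (x : ℝ) :
    x * ((1 + α) * (∫ r in Ioi (0:ℝ), Real.cos (x * r) * rexp (-(r ^ α))) +
      x * ∫ r in Ioi (0:ℝ), -Real.sin (x * r) * (r ^ (1:ℝ) * rexp (-(r ^ α)))) =
    α ^ 2 * ∫ r in Ioi (0:ℝ), Real.sin (x * r) * (r ^ (2 * α - 1) * rexp (-(r ^ α))) := by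
  have I0 : IntegrableOn (fun r : ℝ => Real.cos (x * r) * rexp (-(r ^ α))) (Ioi 0) := by
    refine osc_int (by fun_prop) (fun r => Real.abs_cos_le_one _) ?_
    simpa using E_int (γ := 0) hα (by norm_num)
  have I1 : IntegrableOn (fun r : ℝ => -Real.sin (x * r) * (r ^ (1:ℝ) * rexp (-(r ^ α)))) (Ioi 0) :=
    osc_int (by fun_prop) (fun r => by rw [abs_neg]; exact Real.abs_sin_le_one _)
      (E_int hα (by norm_num))
  have I2 : IntegrableOn (fun r : ℝ => Real.sin (x * r) * (r ^ (2 * α - 1) * rexp (-(r ^ α))))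
      (Ioi 0) :=
    osc_int (by fun_prop) (fun r => Real.abs_sin_le_one _) (E_int hα (by linarith))
  set H : ℝ → ℝ := fun r => α * (Real.sin (x * r) * (r ^ (0:ℝ) * rexp (-(r ^ α)))) +
    α * (Real.sin (x * r) * (r ^ α * rexp (-(r ^ α)))) +
    x * (Real.cos (x * r) * (r ^ (1:ℝ) * rexp (-(r ^ α)))) with hH
  have hlim : Tendsto H atTop (nhds 0) := by
    have a1 := (osc_tendsto (f := fun r => Real.sin (x * r))
      (fun r => Real.abs_sin_le_one _) (E_tendsto (γ := 0) hα)).const_mul α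
    have a2 := (osc_tendsto (f := fun r => Real.sin (x * r))
      (fun r => Real.abs_sin_le_one _) (E_tendsto (γ := α) hα)).const_mul α
    have a3 := (osc_tendsto (f := fun r => Real.cos (x * r))
      (fun r => Real.abs_cos_le_one _) (E_tendsto (γ := 1) hα)).const_mul x
    have a4 := (a1.add a2).add a3
    simp only [mul_zero, add_zero] at a4
    exact a4
  have hcont : Continuous H := by
    have : Continuous (fun r : ℝ => r ^ α) := Real.continuous_rpow_const hα.le
    simp only [hH, Real.rpow_zero, Real.rpow_one]
    fun_prop
  have key := integral_Ioi_of_hasDerivAt_of_tendsto (a := 0) (f := H)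
    (f' := fun r => x * (1 + α) * (Real.cos (x * r) * rexp (-(r ^ α))) +
      x * x * (-Real.sin (x * r) * (r ^ (1:ℝ) * rexp (-(r ^ α)))) -
      α ^ 2 * (Real.sin (x * r) * (r ^ (2 * α - 1) * rexp (-(r ^ α)))))
    hcont.continuousWithinAt ?_ ?_ hlim
  · have hH0 : H 0 = 0 := by simp [hH]
    rw [hH0, sub_zero, integral_sub, integral_add, integral_const_mul, integral_const_mul,
      integral_const_mul] at key
    · linarith
    · exact I0.const_mul _
    · exact I1.const_mul _
    · exact (I0.const_mul _).add (I1.const_mul _)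
    · exact I2.const_mul _
  · intro r hr
    have hr' : 0 < r := hr
    have dp : HasDerivAt (fun r : ℝ => r ^ α) (α * r ^ (α - 1)) r :=
      Real.hasDerivAt_rpow_const (Or.inl hr'.ne')
    have de := dp.neg.exp
    have dl : HasDerivAt (fun r : ℝ => x * r) x r := by
      simpa using (hasDerivAt_id r).const_mul x
    have ds := dl.sin
    have dc := dl.cos
    have D := (((ds.mul de).const_mul α).add ((ds.mul (dp.mul de)).const_mul α)).add
      ((dc.mul ((hasDerivAt_id r).mul de)).const_mul x)
    have e1 : r ^ (2 * α - 1) = r ^ α * r ^ α / r := by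
      rw [Real.rpow_sub_one hr'.ne', two_mul, Real.rpow_add hr']
    have e2 : r ^ (α - 1) = r ^ α / r := Real.rpow_sub_one hr'.ne' _
    convert D using 1
    · ext r
      simp [hH]
    · simp only [e1, e2, Real.rpow_one, Pi.neg_apply, Pi.mul_apply, id]
      field_simp
      ring
  · exact ((I0.const_mul _).add (I1.const_mul _)).sub (I2.const_mul _)

lemma deriv_q {α : ℝ} (hα : 0 < α) (x : ℝ) :
    HasDerivAt (fun x : ℝ => ∫ r in Ioi (0:ℝ), Real.cos (x * r) * rexp (-(r ^ α)))
      (∫ r in Ioi (0:ℝ), -Real.sin (x * r) * (r ^ (1:ℝ) * rexp (-(r ^ α)))) x := by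
  have hm : Measurable (fun r : ℝ => rexp (-(r ^ α))) := by fun_prop
  refine (hasDerivAt_integral_of_dominated_loc_of_deriv_le (s := univ) univ_mem
    (F := fun x r => Real.cos (x * r) * rexp (-(r ^ α)))
    (F' := fun x r => -Real.sin (x * r) * (r ^ (1:ℝ) * rexp (-(r ^ α))))
    (μ := volume.restrict (Ioi 0)) (x₀ := x)
    (bound := fun r => r ^ (1:ℝ) * rexp (-(r ^ α))) ?_ ?_ ?_ ?_ ?_ ?_).2
  · exact Eventually.of_forall fun x => Measurable.aestronglyMeasurable (by fun_prop)
  · refine osc_int (by fun_prop) (fun r => Real.abs_cos_le_one _) ?_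
    simpa using E_int (γ := 0) hα (by norm_num)
  · exact Measurable.aestronglyMeasurable (by fun_prop)
  · refine (ae_restrict_mem measurableSet_Ioi).mono fun r hr y _ => ?_
    have hr' : 0 < r := hr
    have : 0 ≤ r ^ (1:ℝ) * rexp (-(r ^ α)) := by positivity
    rw [norm_mul, Real.norm_eq_abs, abs_neg, Real.norm_of_nonneg this]
    exact mul_le_of_le_one_left this (Real.abs_sin_le_one _)
  · exact E_int hα (by norm_num)
  · refine Eventually.of_forall fun r y _ => ?_
    have dl : HasDerivAt (fun y : ℝ => y * r) r y := by
      simpa using (hasDerivAt_id y).mul_const r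
    have := dl.cos.mul_const (rexp (-(r ^ α)))
    simp only [Real.rpow_one]
    rw [← mul_assoc]
    exact this

/-- Asymptotics of `(1+2s)q(x) + x q'(x)` for `q(x) = (1/π)∫₀^∞ cos(xr) e^{-r^{2s}} dr`. -/
theorem statement13 (s : ℝ) (hs : s ∈ Set.Ioo (0:ℝ) 1)
    (q : ℝ → ℝ)
    (hq : q = fun x : ℝ => (1/π) * ∫ r in Set.Ioi (0:ℝ), Real.cos (x*r) * Real.exp (-(r ^ (2*s)))) :
    Tendsto (fun x : ℝ => x ^ (1 + 4*s) * ((1 + 2*s) * q x + x * deriv q x)) atTop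
      (nhds ((8 * s^2 / π) * Real.sin (π*s) * Real.cos (π*s) * Real.Gamma (4*s))) := by
  have hα : 0 < 2 * s := by linarith [hs.1]
  have hα2 : 2 * s < 2 := by linarith [hs.2]
  have h := (sin_lim_x (β := 2 * (2 * s)) hα hα2 (by linarith)).const_mul ((2 * s) ^ 2 / π)
  have e : (2 * s) ^ 2 / π * (Real.sin (2 * (2 * s) * (π/2)) * Real.Gamma (2 * (2 * s))) =
      (8 * s^2 / π) * Real.sin (π*s) * Real.cos (π*s) * Real.Gamma (4*s) := by
    rw [show 2 * (2 * s) * (π/2) = 2 * (π * s) by ring, Real.sin_two_mul,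
      show 2 * (2 * s) = 4 * s by ring]
    ring
  rw [e] at h
  refine h.congr' ?_
  filter_upwards [eventually_gt_atTop 0] with x hx
  have hd : deriv q x = 1 / π *
      ∫ r in Ioi (0:ℝ), -Real.sin (x * r) * (r ^ (1:ℝ) * rexp (-(r ^ (2 * s)))) := by
    rw [hq]; exact ((deriv_q hα x).const_mul (1/π)).deriv
  have hb := by_parts hα x
  rw [hd, hq, Real.rpow_add hx, Real.rpow_one, show 4 * s = 2 * (2 * s) by ring]
  simp only
  linear_combination (-(1 / π) * x ^ (2 * (2 * s))) * hb
end

section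
/- Let s ∈ (0,1) and t > 0, and set φ^t(x) = 2 p_s(t,x) = (2/π) ∫₀^∞ cos(xr) e^{−t r^{2s}} dr. Then φ^t > 0 on ℝ, and there exists R > 0 such that for every x with |x| ≥ R one has ((-∂ₓₓ)^s φ^t)(x) + (2/t) φ^t(x) ≥ 0 and ((-∂ₓₓ)^s φ^t)(x) + (1/(2t)) φ^t(x) ≤ 0. Moreover the limit lim_{x→+∞} x^{1+2s} φ^t(x) exists and belongs to (0, +∞). -/
open Real MeasureTheory Filter Set

lemma aux_intOn {g : ℝ → ℝ} {C a b : ℝ} (hg : Measurable g) (ha : -1 < a) (hb : b < -1)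
    (h1 : ∀ y, 0 < y → y ≤ 1 → |g y| ≤ C * y ^ a) (h2 : ∀ y, 1 < y → |g y| ≤ C * y ^ b) :
    IntegrableOn g (Ioi 0) := by
  have hu : Ioi (0:ℝ) = Ioc 0 1 ∪ Ioi 1 := (Ioc_union_Ioi_eq_Ioi zero_le_one).symm
  rw [hu]
  refine IntegrableOn.union ?_ ?_
  · have : IntegrableOn (fun y : ℝ => C * y ^ a) (Ioc 0 1) := by
      have h := (intervalIntegral.integrableOn_Ioo_rpow_iff (s := a) (t := 1) one_pos).2 ha
      rw [← integrableOn_Ioc_iff_integrableOn_Ioo] at h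
      exact h.const_mul C
    refine Integrable.mono' this hg.aestronglyMeasurable ?_
    filter_upwards [ae_restrict_mem measurableSet_Ioc] with y hy
    exact h1 y hy.1 hy.2
  · have : IntegrableOn (fun y : ℝ => C * y ^ b) (Ioi 1) :=
      (integrableOn_Ioi_rpow_of_lt hb one_pos).const_mul C
    refine Integrable.mono' this hg.aestronglyMeasurable ?_
    filter_upwards [ae_restrict_mem measurableSet_Ioi] with y hy
    exact h2 y hy

lemma aux_exp_int {s : ℝ} (hs0 : 0 < s) (hs1 : s < 1) :
    IntegrableOn (fun w : ℝ => (1 - rexp (-w)) * w ^ (-1 - s)) (Ioi 0) := by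
  refine aux_intOn (C := 1) (a := -s) (b := -1 - s) (by fun_prop) (by linarith) (by linarith) ?_ ?_
  · intro y hy _
    have h1 : 0 ≤ 1 - rexp (-y) := by
      have := Real.exp_le_one_iff.2 (by linarith : -y ≤ 0); linarith
    have h2 : 1 - rexp (-y) ≤ y := by have := Real.add_one_le_exp (-y); linarith
    rw [abs_of_nonneg (by positivity), show -s = 1 + (-1 - s) by ring, Real.rpow_add hy, Real.rpow_one, one_mul]
    gcongr
  · intro y hy
    have hy0 : 0 < y := by linarith
    have h1 : 0 ≤ 1 - rexp (-y) := by
      have := Real.exp_le_one_iff.2 (by linarith : -y ≤ 0); linarith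
    have h2 : 1 - rexp (-y) ≤ 1 := by have := Real.exp_pos (-y); linarith
    rw [abs_of_nonneg (by positivity)]
    gcongr

lemma aux_exp_eq {s : ℝ} (hs0 : 0 < s) (hs1 : s < 1) :
    ∫ w in Ioi (0:ℝ), (1 - rexp (-w)) * w ^ (-1 - s) = Real.Gamma (1 - s) / s := by
  have hI := aux_exp_int hs0 hs1
  have hG := Real.GammaIntegral_convergent (s := 1 - s) (by linarith)
  have key : ∫ w in Ioi (0:ℝ), ((1 - rexp (-w)) * w ^ (-1 - s) - (rexp (-w) * w ^ (1 - s - 1)) / s)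
      = 0 - (fun w : ℝ => -(1 - rexp (-w)) * w ^ (-s) / s) 0 := by
    have hI2 : IntegrableOn (fun w : ℝ => (1 - rexp (-w)) * w ^ (-1 - s) - (rexp (-w) * w ^ (1 - s - 1)) / s) (Ioi 0) :=
      hI.sub (hG.div_const s)
    refine integral_Ioi_of_hasDerivAt_of_tendsto (f := fun w : ℝ => -(1 - rexp (-w)) * w ^ (-s) / s) ?_ ?_ hI2 ?_
    · have h0 : -(1 - rexp (-0)) * (0:ℝ) ^ (-s) / s = 0 := by simp
      rw [ContinuousWithinAt, h0]
      have ht : Tendsto (fun w : ℝ => w ^ (1 - s) / s) (nhdsWithin 0 (Ici 0)) (nhds 0) := by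
        have : ContinuousAt (fun w : ℝ => w ^ (1 - s) / s) 0 :=
          (Real.continuousAt_rpow_const _ _ (Or.inr (by linarith))).div_const s
        have h := this.tendsto
        rw [Real.zero_rpow (by linarith), zero_div] at h
        exact h.mono_left nhdsWithin_le_nhds
      refine squeeze_zero_norm' ?_ ht
      filter_upwards [self_mem_nhdsWithin] with y hy
      rcases (show (0:ℝ) ≤ y from hy).eq_or_lt with rfl | hy
      · simp; positivity
      have h1 : 0 ≤ 1 - rexp (-y) := by
        have := Real.exp_le_one_iff.2 (by linarith : -y ≤ 0); linarith
      have h2 : 1 - rexp (-y) ≤ y := by have := Real.add_one_le_exp (-y); linarith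
      rw [neg_mul, neg_div, norm_neg, Real.norm_of_nonneg (by positivity), show 1 - s = 1 + (-s) by ring,
        Real.rpow_add hy, Real.rpow_one]
      gcongr
    · intro x hx
      have hx : 0 < x := hx
      have h1 : HasDerivAt (fun w : ℝ => -(1 - rexp (-w))) (-(rexp (-x))) x := by
        have h := (((hasDerivAt_neg x).exp).const_sub 1).fun_neg
        exact h.congr_deriv (by ring)
      have h2 := (h1.mul (Real.hasDerivAt_rpow_const (x := x) (p := -s) (Or.inl hx.ne'))).div_const s
      refine h2.congr_deriv ?_
      rw [show -s - 1 = -1 - s by ring, show 1 - s - 1 = -s by ring]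
      field_simp
      ring
    · have ht : Tendsto (fun w : ℝ => w ^ (-s) / s) atTop (nhds 0) := by
        simpa using (tendsto_rpow_neg_atTop hs0).div_const s
      refine squeeze_zero_norm' ?_ ht
      filter_upwards [eventually_gt_atTop 0] with y hy
      have h1 : 0 ≤ 1 - rexp (-y) := by
        have := Real.exp_le_one_iff.2 (by linarith : -y ≤ 0); linarith
      have h2 : 1 - rexp (-y) ≤ 1 := by have := Real.exp_pos (-y); linarith
      rw [neg_mul, neg_div, norm_neg, Real.norm_of_nonneg (by positivity)]
      gcongr
      exact mul_le_of_le_one_left (by positivity) h2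
  rw [integral_sub hI (hG.div_const s), integral_div, ← Real.Gamma_eq_integral (by linarith)] at key
  simp at key
  linarith

lemma aux_exp_scale_int {s c : ℝ} (hs0 : 0 < s) (hs1 : s < 1) (hc : 0 ≤ c) :
    IntegrableOn (fun u : ℝ => (1 - rexp (-(c * u))) * u ^ (-1 - s)) (Ioi 0) := by
  rcases hc.eq_or_lt with rfl | hc
  · simp
  have h := (integrableOn_Ioi_comp_mul_left_iff (fun w : ℝ => (1 - rexp (-w)) * w ^ (-1 - s)) 0 hc).2
    (by simpa using aux_exp_int hs0 hs1)
  refine IntegrableOn.congr_fun (h.const_mul (c ^ (1 + s))) ?_ measurableSet_Ioi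
  intro u hu
  have hu : 0 < u := hu
  have : c ^ (1 + s) * c ^ (-1 - s) = 1 := by
    rw [← Real.rpow_add hc]; ring_nf; simp
  simp only
  rw [Real.mul_rpow hc.le hu.le]
  linear_combination (1 - rexp (-(c * u))) * u ^ (-1 - s) * this

lemma aux_exp_scale {s c : ℝ} (hs0 : 0 < s) (hs1 : s < 1) (hc : 0 ≤ c) :
    ∫ u in Ioi (0:ℝ), (1 - rexp (-(c * u))) * u ^ (-1 - s) = c ^ s * (Real.Gamma (1 - s) / s) := by
  rcases hc.eq_or_lt with rfl | hc
  · simp [Real.zero_rpow hs0.ne']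
  have h := integral_comp_mul_left_Ioi (fun w : ℝ => (1 - rexp (-w)) * w ^ (-1 - s)) 0 hc
  rw [mul_zero, aux_exp_eq hs0 hs1] at h
  have h3 : ∫ u in Ioi (0:ℝ), (1 - rexp (-(c * u))) * u ^ (-1 - s)
      = ∫ u in Ioi (0:ℝ), c ^ (1 + s) * ((1 - rexp (-(c * u))) * (c * u) ^ (-1 - s)) := by
    refine setIntegral_congr_fun measurableSet_Ioi ?_
    intro u hu
    have hu : 0 < u := hu
    have : c ^ (1 + s) * c ^ (-1 - s) = 1 := by
      rw [← Real.rpow_add hc]; ring_nf; simp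
    simp only
    rw [Real.mul_rpow hc.le hu.le]
    linear_combination (-(1 - rexp (-(c * u))) * u ^ (-1 - s)) * this
  rw [h3, integral_const_mul, h, Real.rpow_add hc, Real.rpow_one, smul_eq_mul]
  field_simp

lemma aux_gauss_cos {b : ℝ} (hb : 0 < b) (x : ℝ) :
    ∫ y in Ioi (0:ℝ), Real.cos (x * y) * rexp (-b * y ^ 2)
      = Real.sqrt (π / b) / 2 * rexp (-x ^ 2 / (4 * b)) := by
  have h := fourierIntegral_gaussian (b := (b:ℂ)) (by simpa using hb) (x:ℂ)
  have hIntg : Integrable (fun y : ℝ => Complex.exp (Complex.I * x * y) * Complex.exp (-b * (y:ℂ) ^ 2)) := by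
    have := integrable_cexp_quadratic (b := (b:ℂ)) (by simpa using hb) (Complex.I * x) 0
    refine this.congr (Eventually.of_forall fun y => ?_)
    simp only
    rw [← Complex.exp_add]; congr 1; ring
  have h2 := congrArg Complex.re h
  have h2' : (∫ y : ℝ, Complex.exp (Complex.I * x * y) * Complex.exp (-b * (y:ℂ) ^ 2)).re
     = ∫ y : ℝ, (Complex.exp (Complex.I * x * y) * Complex.exp (-b * (y:ℂ) ^ 2)).re :=
     (integral_re hIntg).symm
  rw [h2'] at h2
  have h3 : ∀ y : ℝ, (Complex.exp (Complex.I * x * y) * Complex.exp (-b * (y:ℂ) ^ 2)).re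
      = (fun y => Real.cos (x * y) * rexp (-b * y ^ 2)) |y| := by
    intro y
    have e1 : Complex.exp (-b * (y:ℂ) ^ 2) = ((rexp (-b * y^2) : ℝ) : ℂ) := by push_cast; rfl
    have e2 : Complex.I * x * y = ((x * y : ℝ) : ℂ) * Complex.I := by push_cast; ring
    rw [e1, e2, Complex.re_mul_ofReal, Complex.exp_ofReal_mul_I_re]
    simp only [sq_abs]
    congr 1
    rcases abs_choice y with h | h <;> rw [h]
    rw [mul_neg, Real.cos_neg]
  rw [integral_congr_ae (Eventually.of_forall h3), integral_comp_abs (f := fun y => Real.cos (x * y) * rexp (-b * y ^ 2))] at h2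
  have e3 : ((π:ℂ) / b) ^ (1 / 2 : ℂ) * Complex.exp (-(x:ℂ) ^ 2 / (4 * b))
      = ((Real.sqrt (π / b) * rexp (-x ^ 2 / (4 * b)) : ℝ) : ℂ) := by
    rw [Real.sqrt_eq_rpow]
    push_cast
    rw [Complex.ofReal_cpow (by positivity)]
    push_cast
    rfl
  rw [e3, Complex.ofReal_re] at h2
  linarith

lemma aux_cos_int {s : ℝ} (hs0 : 0 < s) (hs1 : s < 1) :
    IntegrableOn (fun y : ℝ => (1 - Real.cos y) * y ^ (-1 - 2 * s)) (Ioi 0) := by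
  refine aux_intOn (C := 2) (a := 1 - 2 * s) (b := -1 - 2 * s) (by fun_prop) (by linarith) (by linarith) ?_ ?_
  · intro y hy _
    have h1 : 0 ≤ 1 - Real.cos y := by linarith [Real.cos_le_one y]
    have h2 : 1 - Real.cos y ≤ y ^ 2 := by nlinarith [Real.one_sub_sq_div_two_le_cos (x := y)]
    rw [abs_of_nonneg (by positivity), show 1 - 2 * s = 2 + (-1 - 2 * s) by ring, Real.rpow_add hy,
      ← mul_assoc, show (-1 - 2 * s) = -1 - 2 * s by ring, Real.rpow_two]
    gcongr
    nlinarith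
  · intro y hy
    have h1 : 0 ≤ 1 - Real.cos y := by linarith [Real.cos_le_one y]
    have h2 : 1 - Real.cos y ≤ 2 := by linarith [Real.neg_one_le_cos y]
    rw [abs_of_nonneg (by positivity)]
    gcongr

lemma aux_cos_eq {s : ℝ} (hs0 : 0 < s) (hs1 : s < 1) :
    Real.Gamma (s + 1/2) * ∫ y in Ioi (0:ℝ), (1 - Real.cos y) * y ^ (-1 - 2 * s)
      = Real.sqrt π * Real.Gamma (1 - s) / (2 * 4 ^ s * s) := by
  have hin : ∀ y : ℝ, 0 < y → ∫ u in Ioi (0:ℝ), (1 - Real.cos y) * (u ^ (s - 1/2) * rexp (-(y ^ 2 * u)))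
      = Real.Gamma (s + 1/2) * ((1 - Real.cos y) * y ^ (-1 - 2 * s)) := by
    intro y hy
    rw [integral_const_mul]
    have := Real.integral_rpow_mul_exp_neg_mul_Ioi (a := s + 1/2) (r := y ^ 2) (by linarith) (by positivity)
    rw [show s + 1/2 - 1 = s - 1/2 by ring] at this
    rw [this, one_div, ← Real.rpow_natCast y 2, ← Real.rpow_neg hy.le, ← Real.rpow_mul hy.le,
      show -((2:ℕ):ℝ) * (s + 1/2) = -1 - 2 * s by push_cast; ring]
    ring
  have hintu : ∀ y : ℝ, 0 < y → IntegrableOn (fun u : ℝ => u ^ (s - 1/2) * rexp (-(y ^ 2 * u))) (Ioi 0) := by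
    intro y hy
    have := integrableOn_rpow_mul_exp_neg_mul_rpow (p := 1) (s := s - 1/2) (b := y ^ 2) (by linarith) one_pos (by positivity)
    simpa using this
  have hF : Integrable (Function.uncurry fun y u : ℝ => (1 - Real.cos y) * (u ^ (s - 1/2) * rexp (-(y ^ 2 * u))))
      ((volume.restrict (Ioi 0)).prod (volume.restrict (Ioi 0))) := by
    rw [integrable_prod_iff (by
      refine Measurable.aestronglyMeasurable ?_
      unfold Function.uncurry
      fun_prop)]
    constructor
    · filter_upwards [ae_restrict_mem measurableSet_Ioi] with y hy
      have := (hintu y hy).const_mul (1 - Real.cos y)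
      exact this
    · refine ((aux_cos_int hs0 hs1).const_mul (Real.Gamma (s + 1/2))).congr ?_
      filter_upwards [ae_restrict_mem measurableSet_Ioi] with y hy
      rw [← hin y hy]
      refine setIntegral_congr_fun measurableSet_Ioi ?_
      intro u hu
      have hu : 0 < u := hu
      have h1 : 0 ≤ 1 - Real.cos y := by linarith [Real.cos_le_one y]
      simp only [Function.uncurry]
      rw [Real.norm_of_nonneg (by positivity)]
  have hsw := integral_integral_swap hF
  rw [setIntegral_congr_fun measurableSet_Ioi (fun y hy => hin y hy), integral_const_mul] at hsw
  rw [hsw]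
  have hin2 : ∀ u ∈ Ioi (0:ℝ), ∫ y in Ioi (0:ℝ), (1 - Real.cos y) * (u ^ (s - 1/2) * rexp (-(y ^ 2 * u)))
      = (Real.sqrt π / 2) * ((|(-1:ℝ)| * u ^ ((-1:ℝ) - 1)) • ((1 - rexp (-((1/4) * u ^ (-1:ℝ)))) * (u ^ (-1:ℝ)) ^ (-1 - s))) := by
    intro u hu
    have hu : 0 < u := hu
    have g1 := integral_gaussian_Ioi u
    have g2 := aux_gauss_cos hu 1
    have i1 : IntegrableOn (fun y : ℝ => rexp (-u * y ^ 2)) (Ioi 0) := (integrable_exp_neg_mul_sq hu).integrableOn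
    have i2 : IntegrableOn (fun y : ℝ => Real.cos (1 * y) * rexp (-u * y ^ 2)) (Ioi 0) := by
      refine Integrable.mono' i1 (by fun_prop) (Eventually.of_forall fun y => ?_)
      rw [norm_mul, Real.norm_of_nonneg (Real.exp_pos _).le]
      exact mul_le_of_le_one_left (Real.exp_pos _).le (Real.abs_cos_le_one _)
    have e : ∀ y : ℝ, (1 - Real.cos y) * (u ^ (s - 1/2) * rexp (-(y ^ 2 * u)))
        = u ^ (s - 1/2) * (rexp (-u * y ^ 2) - Real.cos (1 * y) * rexp (-u * y ^ 2)) := by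
      intro y; rw [one_mul, show -(y^2 * u) = -u * y ^ 2 by ring]; ring
    simp_rw [e]
    rw [integral_const_mul, integral_sub i1 i2, g1, g2, ← Real.rpow_mul hu.le, Real.rpow_neg_one]
    rw [show -1 ^ 2 / (4 * u) = -(1/4 * u⁻¹) by field_simp, Real.sqrt_div pi_pos.le, Real.sqrt_eq_rpow u, smul_eq_mul]
    rw [abs_neg, abs_one, one_mul]
    have : u ^ (s - 1/2) / u ^ (1/2:ℝ) = u ^ ((-1:ℝ) - 1) * u ^ (-1 * (-1 - s)) := by
      rw [← Real.rpow_sub hu, ← Real.rpow_add hu]; ring_nf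
    linear_combination (√π / 2) * (1 - rexp (-(1/4 * u⁻¹))) * this
  rw [setIntegral_congr_fun measurableSet_Ioi hin2, integral_const_mul,
    integral_comp_rpow_Ioi (fun w : ℝ => (1 - rexp (-((1/4) * w))) * w ^ (-1 - s)) (by norm_num),
    aux_exp_scale hs0 hs1 (by norm_num), one_div, Real.inv_rpow (by norm_num)]
  field_simp

lemma aux_coef {s : ℝ} (hs0 : 0 < s) (hs1 : s < 1) :
    fracLapCoef s * (2 * ∫ y in Ioi (0:ℝ), (1 - Real.cos y) * y ^ (-1 - 2 * s)) = 1 := by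
  have h := aux_cos_eq hs0 hs1
  have hG1 : 0 < Real.Gamma (s + 1/2) := Real.Gamma_pos_of_pos (by linarith)
  have hG2 : 0 < Real.Gamma (1 - s) := Real.Gamma_pos_of_pos (by linarith)
  set K := ∫ y in Ioi (0:ℝ), (1 - Real.cos y) * y ^ (-1 - 2 * s)
  have hp : 0 < Real.sqrt π := Real.sqrt_pos.2 pi_pos
  have h4 : (0:ℝ) < 4 ^ s := by positivity
  unfold fracLapCoef
  rw [eq_div_iff (by positivity)] at h
  rw [div_mul_eq_mul_div, div_eq_one_iff_eq (by positivity)]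
  linarith

/-- cosine transform with weight `r^β`. -/
noncomputable def cosT (s t β x : ℝ) : ℝ :=
  ∫ r in Ioi (0:ℝ), r ^ β * (Real.cos (x * r) * rexp (-(t * r ^ (2 * s))))

lemma aux_wint {s t β : ℝ} (hs0 : 0 < s) (ht : 0 < t) (hβ : 0 ≤ β) :
    IntegrableOn (fun r : ℝ => r ^ β * rexp (-(t * r ^ (2 * s)))) (Ioi 0) := by
  have := integrableOn_rpow_mul_exp_neg_mul_rpow (p := 2 * s) (s := β) (b := t) (by linarith) (by linarith) ht
  simpa only [neg_mul] using this

lemma aux_cosT_int {s t β : ℝ} (hs0 : 0 < s) (ht : 0 < t) (hβ : 0 ≤ β) (x : ℝ) :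
    IntegrableOn (fun r : ℝ => r ^ β * (Real.cos (x * r) * rexp (-(t * r ^ (2 * s))))) (Ioi 0) := by
  refine Integrable.mono' (aux_wint hs0 ht hβ) (Measurable.aestronglyMeasurable (by fun_prop)) ?_
  filter_upwards [ae_restrict_mem measurableSet_Ioi] with r hr
  have hr : 0 < r := hr
  rw [norm_mul, norm_mul, Real.norm_of_nonneg (by positivity), Real.norm_of_nonneg (Real.exp_pos _).le]
  gcongr
  exact mul_le_of_le_one_left (Real.exp_pos _).le (Real.abs_cos_le_one _)

lemma aux_kernel_eq (s t x : ℝ) : fracHeatKernel s t x = (1/π) * cosT s t 0 x := by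
  unfold fracHeatKernel cosT
  simp

lemma aux_cosT_even (s t β x : ℝ) : cosT s t β (-x) = cosT s t β x := by
  unfold cosT
  simp [neg_mul]

lemma aux_cos_scale_int {s r : ℝ} (hs0 : 0 < s) (hs1 : s < 1) (hr : 0 < r) :
    IntegrableOn (fun y : ℝ => (1 - Real.cos (r * y)) * y ^ (-1 - 2 * s)) (Ioi 0) := by
  have h := (integrableOn_Ioi_comp_mul_left_iff (fun w : ℝ => (1 - Real.cos w) * w ^ (-1 - 2 * s)) 0 hr).2
    (by simpa using aux_cos_int hs0 hs1)
  refine IntegrableOn.congr_fun (h.const_mul (r ^ (1 + 2 * s))) ?_ measurableSet_Ioi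
  intro u hu
  have hu : 0 < u := hu
  have : r ^ (1 + 2 * s) * r ^ (-1 - 2 * s) = 1 := by
    rw [← Real.rpow_add hr]; ring_nf; simp
  simp only
  rw [Real.mul_rpow hr.le hu.le]
  linear_combination (1 - Real.cos (r * u)) * u ^ (-1 - 2 * s) * this

lemma aux_cos_scale {s r : ℝ} (hr : 0 < r) :
    ∫ y in Ioi (0:ℝ), (1 - Real.cos (r * y)) * y ^ (-1 - 2 * s)
      = r ^ (2 * s) * ∫ y in Ioi (0:ℝ), (1 - Real.cos y) * y ^ (-1 - 2 * s) := by
  have h := integral_comp_mul_left_Ioi (fun w : ℝ => (1 - Real.cos w) * w ^ (-1 - 2 * s)) 0 hr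
  rw [mul_zero] at h
  have h3 : ∫ u in Ioi (0:ℝ), (1 - Real.cos (r * u)) * u ^ (-1 - 2 * s)
      = ∫ u in Ioi (0:ℝ), r ^ (1 + 2 * s) * ((1 - Real.cos (r * u)) * (r * u) ^ (-1 - 2 * s)) := by
    refine setIntegral_congr_fun measurableSet_Ioi ?_
    intro u hu
    have hu : 0 < u := hu
    have : r ^ (1 + 2 * s) * r ^ (-1 - 2 * s) = 1 := by
      rw [← Real.rpow_add hr]; ring_nf; simp
    simp only
    rw [Real.mul_rpow hr.le hu.le]
    linear_combination (-(1 - Real.cos (r * u)) * u ^ (-1 - 2 * s)) * this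
  rw [h3, integral_const_mul, h, Real.rpow_add hr, Real.rpow_one, smul_eq_mul]
  field_simp

lemma aux_fracLap {s t : ℝ} (hs0 : 0 < s) (hs1 : s < 1) (ht : 0 < t) (x : ℝ) :
    IntegrableOn (fun y : ℝ => (2 * (2 * fracHeatKernel s t x) - 2 * fracHeatKernel s t (x + y)
      - 2 * fracHeatKernel s t (x - y)) * y ^ (-1 - 2 * s)) (Ioi 0) ∧
    fracLap s (fun x' => 2 * fracHeatKernel s t x') x = (2 / π) * cosT s t (2 * s) x := by
  set K := ∫ y in Ioi (0:ℝ), (1 - Real.cos y) * y ^ (-1 - 2 * s) with hK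
  have hpt : ∀ y : ℝ, (2 * (2 * fracHeatKernel s t x) - 2 * fracHeatKernel s t (x + y)
      - 2 * fracHeatKernel s t (x - y)) * y ^ (-1 - 2 * s)
      = ∫ r in Ioi (0:ℝ), (4 / π) * (Real.cos (x * r) * rexp (-(t * r ^ (2 * s))))
          * ((1 - Real.cos (r * y)) * y ^ (-1 - 2 * s)) := by
    intro y
    have i := fun z => aux_cosT_int (β := 0) hs0 ht le_rfl z
    simp only [Real.rpow_zero, one_mul] at i
    unfold fracHeatKernel
    have : ∀ r : ℝ, (4 / π) * (Real.cos (x * r) * rexp (-(t * r ^ (2 * s))))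
          * ((1 - Real.cos (r * y)) * y ^ (-1 - 2 * s)) =
        (2 / π) * y ^ (-1 - 2 * s) * (2 * (Real.cos (x * r) * rexp (-(t * r ^ (2 * s))))
          - Real.cos ((x + y) * r) * rexp (-(t * r ^ (2 * s)))
          - Real.cos ((x - y) * r) * rexp (-(t * r ^ (2 * s)))) := by
      intro r
      rw [add_mul x y r, sub_mul x y r, Real.cos_add, Real.cos_sub, mul_comm y r]
      ring
    simp_rw [this]
    have i12 : IntegrableOn (fun r : ℝ => 2 * (Real.cos (x * r) * rexp (-(t * r ^ (2 * s))))
          - Real.cos ((x + y) * r) * rexp (-(t * r ^ (2 * s)))) (Ioi 0) :=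
      Integrable.sub ((i x).const_mul 2) (i (x+y))
    rw [integral_const_mul, integral_sub i12 (i (x - y)),
      integral_sub ((i x).const_mul 2) (i (x+y)), integral_const_mul]
    ring
  have hF : Integrable (Function.uncurry fun r y : ℝ => (4 / π) * (Real.cos (x * r) * rexp (-(t * r ^ (2 * s))))
          * ((1 - Real.cos (r * y)) * y ^ (-1 - 2 * s)))
      ((volume.restrict (Ioi 0)).prod (volume.restrict (Ioi 0))) := by
    rw [integrable_prod_iff (by
      refine Measurable.aestronglyMeasurable ?_
      unfold Function.uncurry
      fun_prop)]
    constructor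
    · filter_upwards [ae_restrict_mem measurableSet_Ioi] with r hr
      have := (aux_cos_scale_int hs0 hs1 hr).const_mul ((4 / π) * (Real.cos (x * r) * rexp (-(t * r ^ (2 * s)))))
      exact this
    · refine (((aux_cosT_int hs0 ht (by linarith : 0 ≤ 2 * s) x).norm).const_mul (4 / π * K)).congr ?_
      filter_upwards [ae_restrict_mem measurableSet_Ioi] with r hr
      have hr : 0 < r := hr
      have e : ∀ y ∈ Ioi (0:ℝ), ‖Function.uncurry (fun r y : ℝ => (4 / π) * (Real.cos (x * r) * rexp (-(t * r ^ (2 * s))))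
          * ((1 - Real.cos (r * y)) * y ^ (-1 - 2 * s))) (r, y)‖
          = (4 / π) * ‖Real.cos (x * r) * rexp (-(t * r ^ (2 * s)))‖ * ((1 - Real.cos (r * y)) * y ^ (-1 - 2 * s)) := by
        intro y hy
        have hy : 0 < y := hy
        have h1 : 0 ≤ 1 - Real.cos (r * y) := by linarith [Real.cos_le_one (r * y)]
        simp only [Function.uncurry]
        rw [norm_mul, norm_mul (4 / π), Real.norm_of_nonneg (by positivity : 0 ≤ (1 - Real.cos (r * y)) * y ^ (-1 - 2 * s)),
          Real.norm_of_nonneg (by positivity : 0 ≤ 4 / π)]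
      rw [setIntegral_congr_fun measurableSet_Ioi e, integral_const_mul, aux_cos_scale hr, norm_mul (r ^ (2 * s)),
        Real.norm_of_nonneg (by positivity : 0 ≤ r ^ (2 * s))]
      ring
  constructor
  · have h := hF.integral_prod_right
    refine h.congr (Eventually.of_forall fun y => ?_)
    exact (hpt y).symm
  · unfold fracLap
    simp only [hpt]
    rw [← integral_integral_swap hF]
    have : ∀ r ∈ Ioi (0:ℝ), ∫ y in Ioi (0:ℝ), (4 / π) * (Real.cos (x * r) * rexp (-(t * r ^ (2 * s))))
          * ((1 - Real.cos (r * y)) * y ^ (-1 - 2 * s))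
        = (4 / π * K) * (r ^ (2 * s) * (Real.cos (x * r) * rexp (-(t * r ^ (2 * s))))) := by
      intro r hr
      rw [integral_const_mul, aux_cos_scale hr]; ring
    rw [setIntegral_congr_fun measurableSet_Ioi this, integral_const_mul]
    have hc := aux_coef hs0 hs1
    rw [← hK] at hc
    unfold cosT
    linear_combination (2 / π * ∫ r in Ioi (0:ℝ), r ^ (2 * s) * (Real.cos (x * r) * rexp (-(t * r ^ (2 * s))))) * hc

/-- Functions whose Gaussian-damped cosine transforms are nonnegative. -/
structure InP (f : ℝ → ℝ) : Prop where
  meas : Measurable f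
  bdd : ∃ B, ∀ r, |f r| ≤ B
  pos : ∀ ε, 0 < ε → ∀ x, 0 ≤ ∫ r in Ioi (0:ℝ), f r * (Real.cos (x * r) * rexp (-ε * r ^ 2))

lemma aux_gint {ε : ℝ} (hε : 0 < ε) : IntegrableOn (fun r : ℝ => rexp (-ε * r ^ 2)) (Ioi 0) :=
  (integrable_exp_neg_mul_sq hε).integrableOn

lemma aux_cos_exp_le (x ε r : ℝ) : |Real.cos (x * r) * rexp (-ε * r ^ 2)| ≤ rexp (-ε * r ^ 2) := by
  rw [abs_mul, abs_of_nonneg (Real.exp_pos _).le]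
  exact mul_le_of_le_one_left (Real.exp_pos _).le (Real.abs_cos_le_one _)

lemma aux_P_int {f : ℝ → ℝ} (hm : Measurable f) (hb : ∃ B, ∀ r, |f r| ≤ B) {ε : ℝ} (hε : 0 < ε) (x : ℝ) :
    IntegrableOn (fun r : ℝ => f r * (Real.cos (x * r) * rexp (-ε * r ^ 2))) (Ioi 0) := by
  obtain ⟨B, hB⟩ := hb
  refine Integrable.mono' ((aux_gint hε).const_mul B) (Measurable.aestronglyMeasurable (by fun_prop)) ?_
  refine Eventually.of_forall fun r => ?_
  rw [norm_mul]
  exact mul_le_mul (hB r) (aux_cos_exp_le x ε r) (abs_nonneg _) ((abs_nonneg _).trans (hB r))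

lemma InP.one : InP (fun _ => 1) where
  meas := measurable_const
  bdd := ⟨1, by simp⟩
  pos := by
    intro ε hε x
    simp only [one_mul]
    rw [aux_gauss_cos hε]
    positivity

lemma InP.add {f g : ℝ → ℝ} (hf : InP f) (hg : InP g) : InP (fun r => f r + g r) where
  meas := hf.meas.add hg.meas
  bdd := by
    obtain ⟨A, hA⟩ := hf.bdd
    obtain ⟨B, hB⟩ := hg.bdd
    exact ⟨A + B, fun r => (abs_add_le _ _).trans (add_le_add (hA r) (hB r))⟩
  pos := by
    intro ε hε x
    simp only [add_mul]
    rw [integral_add (aux_P_int hf.meas hf.bdd hε x) (aux_P_int hg.meas hg.bdd hε x)]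
    exact add_nonneg (hf.pos ε hε x) (hg.pos ε hε x)

lemma InP.smul {f : ℝ → ℝ} (hf : InP f) {c : ℝ} (hc : 0 ≤ c) : InP (fun r => c * f r) where
  meas := hf.meas.const_mul c
  bdd := by
    obtain ⟨A, hA⟩ := hf.bdd
    exact ⟨c * A, fun r => by rw [abs_mul, abs_of_nonneg hc]; exact mul_le_mul_of_nonneg_left (hA r) hc⟩
  pos := by
    intro ε hε x
    simp only [mul_assoc]
    rw [integral_const_mul]
    exact mul_nonneg hc (hf.pos ε hε x)

lemma InP.lim {F : ℕ → ℝ → ℝ} {f : ℝ → ℝ} (hF : ∀ n, InP (F n)) {B : ℝ} (hB : ∀ n r, |F n r| ≤ B)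
    (h : ∀ r, Tendsto (fun n => F n r) atTop (nhds (f r))) : InP f where
  meas := measurable_of_tendsto_metrizable (fun n => (hF n).meas) (tendsto_pi_nhds.2 h)
  bdd := ⟨B, fun r => le_of_tendsto (h r).abs (Eventually.of_forall fun n => hB n r)⟩
  pos := by
    intro ε hε x
    have := tendsto_integral_of_dominated_convergence (μ := volume.restrict (Ioi (0:ℝ)))
      (F := fun n r => F n r * (Real.cos (x * r) * rexp (-ε * r ^ 2)))
      (f := fun r => f r * (Real.cos (x * r) * rexp (-ε * r ^ 2)))
      (fun r => B * rexp (-ε * r ^ 2))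
      (fun n => by
        have := (hF n).meas
        exact Measurable.aestronglyMeasurable (by fun_prop))
      ((aux_gint hε).const_mul B)
      (fun n => Eventually.of_forall fun r => by
        rw [norm_mul]
        exact mul_le_mul (hB n r) (aux_cos_exp_le x ε r) (abs_nonneg _) ((abs_nonneg _).trans (hB n r)))
      (Eventually.of_forall fun r => (h r).mul_const _)
    exact ge_of_tendsto' this (fun n => (hF n).pos ε hε x)

/-- truncated Laplace transform of the jump measure -/
noncomputable def jm (s δ r : ℝ) : ℝ := ∫ u in Ioi δ, rexp (-(r ^ 2 * u)) * u ^ (-1 - s)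

lemma aux_jm_int {s δ : ℝ} (hs0 : 0 < s) (hδ : 0 < δ) : IntegrableOn (fun u : ℝ => u ^ (-1 - s)) (Ioi δ) :=
  integrableOn_Ioi_rpow_of_lt (by linarith) hδ

lemma aux_jm_int2 {s δ : ℝ} (hs0 : 0 < s) (hδ : 0 < δ) (r : ℝ) :
    IntegrableOn (fun u : ℝ => rexp (-(r ^ 2 * u)) * u ^ (-1 - s)) (Ioi δ) := by
  refine Integrable.mono' (aux_jm_int hs0 hδ) (Measurable.aestronglyMeasurable (by fun_prop)) ?_
  filter_upwards [ae_restrict_mem measurableSet_Ioi] with u hu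
  have hu : 0 < u := hδ.trans hu
  rw [Real.norm_of_nonneg (by positivity)]
  exact mul_le_of_le_one_left (by positivity) (Real.exp_le_one_iff.2 (by
    have : 0 ≤ r ^ 2 * u := by positivity
    linarith))

lemma aux_jm_nonneg {s δ : ℝ} (hδ : 0 < δ) (r : ℝ) : 0 ≤ jm s δ r := by
  refine setIntegral_nonneg measurableSet_Ioi fun u hu => ?_
  have hu : 0 < u := hδ.trans hu
  positivity

lemma aux_jm_le {s δ : ℝ} (hs0 : 0 < s) (hδ : 0 < δ) (r : ℝ) :
    jm s δ r ≤ ∫ u in Ioi δ, u ^ (-1 - s) := by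
  refine setIntegral_mono_on (aux_jm_int2 hs0 hδ r) (aux_jm_int hs0 hδ) measurableSet_Ioi fun u hu => ?_
  have hu : 0 < u := hδ.trans hu
  exact mul_le_of_le_one_left (by positivity) (Real.exp_le_one_iff.2 (by
    have : 0 ≤ r ^ 2 * u := by positivity
    linarith))

lemma aux_jm_meas (s δ : ℝ) : Measurable (jm s δ) := by
  have : StronglyMeasurable (Function.uncurry fun r u : ℝ => rexp (-(r ^ 2 * u)) * u ^ (-1 - s)) := by
    refine Measurable.stronglyMeasurable ?_
    unfold Function.uncurry
    fun_prop
  exact (StronglyMeasurable.integral_prod_right (ν := volume.restrict (Ioi δ)) this).measurable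

lemma InP.mul_jm {f : ℝ → ℝ} (hf : InP f) {s δ : ℝ} (hs0 : 0 < s) (hδ : 0 < δ) :
    InP (fun r => f r * jm s δ r) where
  meas := hf.meas.mul (aux_jm_meas s δ)
  bdd := by
    obtain ⟨A, hA⟩ := hf.bdd
    refine ⟨A * ∫ u in Ioi δ, u ^ (-1 - s), fun r => ?_⟩
    rw [abs_mul, abs_of_nonneg (aux_jm_nonneg hδ r)]
    exact mul_le_mul (hA r) (aux_jm_le hs0 hδ r) (aux_jm_nonneg hδ r) ((abs_nonneg _).trans (hA r))
  pos := by
    intro ε hε x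
    have hF : Integrable (Function.uncurry fun r u : ℝ => f r * (Real.cos (x * r) * rexp (-ε * r ^ 2))
        * (rexp (-(r ^ 2 * u)) * u ^ (-1 - s))) ((volume.restrict (Ioi 0)).prod (volume.restrict (Ioi δ))) := by
      have h := Integrable.mul_prod (aux_P_int hf.meas hf.bdd hε x) (aux_jm_int hs0 hδ)
      refine Integrable.mono h ?_ ?_
      · have := hf.meas
        refine Measurable.aestronglyMeasurable ?_
        unfold Function.uncurry
        fun_prop
      · rw [Measure.prod_restrict]
        filter_upwards [ae_restrict_mem (measurableSet_Ioi.prod measurableSet_Ioi)] with z hz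
        have hu : 0 < z.2 := hδ.trans hz.2
        simp only [Function.uncurry]
        rw [norm_mul, norm_mul (rexp (-(z.1 ^ 2 * z.2))), norm_mul (f z.1 * (Real.cos (x * z.1) * rexp (-ε * z.1 ^ 2))) (z.2 ^ (-1 - s))]
        refine mul_le_mul_of_nonneg_left ?_ (norm_nonneg _)
        refine mul_le_of_le_one_left (norm_nonneg _) ?_
        rw [Real.norm_of_nonneg (Real.exp_pos _).le]
        exact Real.exp_le_one_iff.2 (by
          have : 0 ≤ z.1 ^ 2 * z.2 := by positivity
          linarith)
    have hsw := integral_integral_swap hF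
    have e : ∀ r : ℝ, f r * jm s δ r * (Real.cos (x * r) * rexp (-ε * r ^ 2))
        = ∫ u in Ioi δ, f r * (Real.cos (x * r) * rexp (-ε * r ^ 2))
        * (rexp (-(r ^ 2 * u)) * u ^ (-1 - s)) := by
      intro r
      rw [integral_const_mul]; unfold jm; ring
    simp_rw [e]
    rw [hsw]
    refine setIntegral_nonneg measurableSet_Ioi fun u hu => ?_
    have hu : 0 < u := hδ.trans hu
    have e2 : ∀ r : ℝ, f r * (Real.cos (x * r) * rexp (-ε * r ^ 2))
        * (rexp (-(r ^ 2 * u)) * u ^ (-1 - s)) =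
        u ^ (-1 - s) * (f r * (Real.cos (x * r) * rexp (-(ε + u) * r ^ 2))) := by
      intro r
      rw [show -(ε + u) * r ^ 2 = -ε * r ^ 2 + -(r ^ 2 * u) by ring, Real.exp_add]
      ring
    simp_rw [e2]
    rw [integral_const_mul]
    exact mul_nonneg (by positivity) (hf.pos _ (by linarith) x)

lemma aux_InP_exp {s δ c : ℝ} (hs0 : 0 < s) (hδ : 0 < δ) (hc : 0 ≤ c) :
    InP (fun r => rexp (c * jm s δ r)) := by
  have h1 : ∀ (d : ℝ) (hd : 0 ≤ d) (n : ℕ), InP (fun r => (1 + d * jm s δ r) ^ n) := by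
    intro d hd n
    induction n with
    | zero => simpa using InP.one
    | succ n ih =>
      have := ih.add ((ih.mul_jm hs0 hδ).smul hd)
      convert this using 2 with r
      ring
  refine InP.lim (F := fun n r => (1 + (c / n) * jm s δ r) ^ n) (B := rexp (c * ∫ u in Ioi δ, u ^ (-1 - s)))
    (fun n => h1 _ (by positivity) n) ?_ ?_
  · intro n r
    have h0 := aux_jm_nonneg (s := s) hδ r
    rw [abs_of_nonneg (by positivity)]
    calc (1 + (c / n) * jm s δ r) ^ n ≤ (rexp ((c / n) * jm s δ r)) ^ n := by
          gcongr
          rw [add_comm]; exact Real.add_one_le_exp _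
      _ = rexp (n * ((c / n) * jm s δ r)) := by rw [← Real.exp_nat_mul]
      _ ≤ _ := by
        rcases Nat.eq_zero_or_pos n with rfl | hn
        · simp
          refine mul_nonneg hc ?_
          exact h0.trans (aux_jm_le hs0 hδ r)
        · have : (n:ℝ) ≠ 0 := by positivity
          rw [show (n:ℝ) * (c / n * jm s δ r) = c * jm s δ r by field_simp]
          gcongr
          exact aux_jm_le hs0 hδ r
  · intro r
    have := Real.tendsto_one_add_div_pow_exp (c * jm s δ r)
    refine this.congr fun n => ?_
    rw [mul_div_right_comm]

lemma aux_InP_stable {s t : ℝ} (hs0 : 0 < s) (hs1 : s < 1) (ht : 0 < t) :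
    InP (fun r => rexp (-(t * (r ^ 2) ^ s))) := by
  have hG2 : 0 < Real.Gamma (1 - s) := Real.Gamma_pos_of_pos (by linarith)
  set c := t * s / Real.Gamma (1 - s) with hc
  have hc0 : 0 < c := by positivity
  have hδ : ∀ n : ℕ, (0:ℝ) < 1 / ((n:ℝ) + 1) := fun n => by positivity
  have heq : ∀ (n : ℕ) (r : ℝ), rexp (-(c * ∫ u in Ioi (1 / ((n:ℝ) + 1)), u ^ (-1 - s))) * rexp (c * jm s (1 / ((n:ℝ) + 1)) r)
      = rexp (-(c * ∫ u in Ioi (1 / ((n:ℝ) + 1)), (1 - rexp (-(r ^ 2 * u))) * u ^ (-1 - s))) := by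
    intro n r
    rw [← Real.exp_add]
    congr 1
    simp only [sub_mul, one_mul]
    rw [integral_sub (aux_jm_int hs0 (hδ n)) (aux_jm_int2 hs0 (hδ n) r)]
    unfold jm
    ring
  refine InP.lim (F := fun n r => rexp (-(c * ∫ u in Ioi (1 / ((n:ℝ) + 1)), u ^ (-1 - s))) *
    rexp (c * jm s (1 / ((n:ℝ) + 1)) r)) (B := 1)
    (fun n => (aux_InP_exp hs0 (hδ n) hc0.le).smul (Real.exp_pos _).le) ?_ ?_
  · intro n r
    rw [heq, abs_of_nonneg (Real.exp_pos _).le, Real.exp_le_one_iff, neg_nonpos]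
    refine mul_nonneg hc0.le (setIntegral_nonneg measurableSet_Ioi fun u hu => ?_)
    have hu : 0 < u := (hδ n).trans hu
    have : 0 ≤ 1 - rexp (-(r ^ 2 * u)) := by
      have : 0 ≤ r ^ 2 * u := by positivity
      have := Real.exp_le_one_iff.2 (by linarith : -(r ^ 2 * u) ≤ 0); linarith
    positivity
  · intro r
    simp only [heq]
    have hU : (⋃ n : ℕ, Ioi (1 / ((n:ℝ) + 1))) = Ioi 0 := by
      ext u
      simp only [mem_iUnion, mem_Ioi]
      constructor
      · rintro ⟨n, hn⟩; exact (hδ n).trans hn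
      · intro hu; exact exists_nat_one_div_lt hu
    have hIntg := aux_exp_scale_int (c := r ^ 2) hs0 hs1 (sq_nonneg r)
    have ht1 := tendsto_setIntegral_of_monotone (μ := volume)
      (f := fun u : ℝ => (1 - rexp (-(r ^ 2 * u))) * u ^ (-1 - s))
      (s := fun n : ℕ => Ioi (1 / ((n:ℝ) + 1))) (fun n => measurableSet_Ioi)
      (fun m n hmn => Ioi_subset_Ioi (Nat.one_div_le_one_div hmn)) (by rw [hU]; exact hIntg)
    rw [hU, aux_exp_scale hs0 hs1 (sq_nonneg r)] at ht1
    have h2 := ((ht1.const_mul c).neg).rexp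
    convert h2 using 3
    rw [hc]; field_simp

lemma aux_cosT_nonneg {s t : ℝ} (hs0 : 0 < s) (hs1 : s < 1) (ht : 0 < t) (x : ℝ) : 0 ≤ cosT s t 0 x := by
  have hP := aux_InP_stable hs0 hs1 ht
  have hlim := tendsto_integral_of_dominated_convergence (μ := volume.restrict (Ioi (0:ℝ)))
      (F := fun (n : ℕ) r => rexp (-(t * (r ^ 2) ^ s)) * (Real.cos (x * r) * rexp (-(1 / ((n:ℝ) + 1)) * r ^ 2)))
      (f := fun r => r ^ (0:ℝ) * (Real.cos (x * r) * rexp (-(t * r ^ (2 * s)))))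
      (fun r => r ^ (0:ℝ) * rexp (-(t * r ^ (2 * s))))
      (fun n => Measurable.aestronglyMeasurable (by fun_prop))
      (aux_wint hs0 ht le_rfl)
      (fun n => by
        filter_upwards [ae_restrict_mem measurableSet_Ioi] with r hr
        have hr : 0 < r := hr
        have e : (r ^ 2) ^ s = r ^ (2 * s) := by
          rw [Real.rpow_mul hr.le, Real.rpow_two]
        rw [norm_mul, Real.norm_of_nonneg (Real.exp_pos _).le, Real.rpow_zero, one_mul, e]
        refine mul_le_of_le_one_right (Real.exp_pos _).le ?_
        rw [Real.norm_eq_abs]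
        refine (aux_cos_exp_le x (1 / ((n:ℝ) + 1)) r).trans (Real.exp_le_one_iff.2 ?_)
        have : 0 ≤ (1 / ((n:ℝ) + 1)) * r ^ 2 := by positivity
        linarith)
      (by
        filter_upwards [ae_restrict_mem measurableSet_Ioi] with r hr
        have hr : 0 < r := hr
        have h1 : Tendsto (fun n : ℕ => rexp (-(1 / ((n:ℝ) + 1)) * r ^ 2)) atTop (nhds 1) := by
          have := ((tendsto_one_div_add_atTop_nhds_zero_nat (𝕜 := ℝ)).neg.mul_const (r ^ 2)).rexp
          simpa using this
        have h2 := (h1.const_mul (Real.cos (x * r))).const_mul (rexp (-(t * (r ^ 2) ^ s)))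
        convert h2 using 2
        have e : (r ^ 2) ^ s = r ^ (2 * s) := by
          rw [Real.rpow_mul hr.le, Real.rpow_two]
        rw [Real.rpow_zero, e]
        ring)
  exact ge_of_tendsto' hlim (fun n => hP.pos _ (by positivity) x)

/-- exponent -/
noncomputable def rE (s t : ℝ) (q a : ℂ) (v : ℝ) : ℂ :=
  q * a * v - t * a ^ ((2 * s : ℝ) : ℂ) * ((v ^ (2 * s) : ℝ) : ℂ)

noncomputable def rPhi (s t β : ℝ) (q a : ℂ) (v : ℝ) : ℂ :=
  a ^ ((1 + β : ℝ) : ℂ) * (((v ^ β : ℝ) : ℂ) * Complex.exp (rE s t q a v))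

noncomputable def rPsi (s t β : ℝ) (q a : ℂ) (v : ℝ) : ℂ :=
  ((v ^ β : ℝ) : ℂ) * Complex.exp (rE s t q a v) *
    ((1 + β : ℝ) + q * a * v - (2 * s * t : ℝ) * a ^ ((2 * s : ℝ) : ℂ) * ((v ^ (2 * s) : ℝ) : ℂ))

lemma aux_rE_meas (s t : ℝ) (q a : ℂ) : Measurable (rE s t q a) := by
  unfold rE; fun_prop

lemma aux_rPhi_meas (s t β : ℝ) (q a : ℂ) : Measurable (rPhi s t β q a) := by
  have := aux_rE_meas s t q a
  unfold rPhi; fun_prop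

lemma aux_rPsi_meas (s t β : ℝ) (q a : ℂ) : Measurable (rPsi s t β q a) := by
  have := aux_rE_meas s t q a
  unfold rPsi; fun_prop

lemma aux_rPhi_deriv (s t β : ℝ) (q a : ℂ) (v : ℝ) (ha : 0 < a.re) :
    HasDerivAt (fun a => rPhi s t β q a v) (a ^ (β : ℂ) * rPsi s t β q a v) a := by
  have hsl : a ∈ Complex.slitPlane := Or.inl ha
  have ha0 : a ≠ 0 := Complex.slitPlane_ne_zero hsl
  have h1 : HasDerivAt (fun a : ℂ => a ^ ((1 + β : ℝ) : ℂ)) (((1 + β : ℝ) : ℂ) * a ^ (((1 + β : ℝ) : ℂ) - 1) * 1) a :=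
    (hasDerivAt_id a).cpow_const hsl
  have h2 : HasDerivAt (fun a : ℂ => a ^ ((2 * s : ℝ) : ℂ)) (((2 * s : ℝ) : ℂ) * a ^ (((2 * s : ℝ) : ℂ) - 1) * 1) a :=
    (hasDerivAt_id a).cpow_const hsl
  have h3 : HasDerivAt (fun a => rE s t q a v) (q * 1 * v - t * (((2 * s : ℝ) : ℂ) * a ^ (((2 * s : ℝ) : ℂ) - 1) * 1)
      * ((v ^ (2 * s) : ℝ) : ℂ)) a :=
    (((hasDerivAt_id a).const_mul q).mul_const (v:ℂ)).sub ((h2.const_mul (t:ℂ)).mul_const _)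
  have h4 := h1.mul ((h3.cexp).const_mul ((v ^ β : ℝ) : ℂ))
  refine h4.congr_deriv ?_
  unfold rPsi
  have e1 : a ^ ((1 + β : ℝ) : ℂ) = a * a ^ (β : ℂ) := by
    push_cast; rw [Complex.cpow_add _ _ ha0, Complex.cpow_one]
  have e2 : a ^ (((1 + β : ℝ) : ℂ) - 1) = a ^ (β : ℂ) := by congr 1; push_cast; ring
  have e3 : a * a ^ (((2 * s : ℝ) : ℂ) - 1) = a ^ ((2 * s : ℝ) : ℂ) := by
    rw [Complex.cpow_sub _ _ ha0, Complex.cpow_one]; field_simp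
  rw [e1, e2, ← e3]
  push_cast
  ring

lemma aux_rPsi_int_zero {s t β : ℝ} {q a : ℂ} {w : ℝ → ℝ} (hs0 : 0 < s) (hβ : 0 ≤ β)
    (hw : ∀ v, 0 < v → ‖Complex.exp (rE s t q a v)‖ ≤ w v)
    (i1 : IntegrableOn (fun v => v ^ (1 + β) * w v) (Ioi 0))
    (hψ : IntegrableOn (rPsi s t β q a) (Ioi 0)) :
    ∫ v in Ioi (0:ℝ), rPsi s t β q a v = 0 := by
  set g : ℝ → ℂ := fun v => ((v ^ (1 + β) : ℝ) : ℂ) * Complex.exp (rE s t q a v) with hg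
  have hd : ∀ v ∈ Ioi (0:ℝ), HasDerivAt g (rPsi s t β q a v) v := by
    intro v hv
    have hv : 0 < v := hv
    have h1 := (Real.hasDerivAt_rpow_const (x := v) (p := 1 + β) (Or.inl hv.ne')).ofReal_comp
    have h2 := (Real.hasDerivAt_rpow_const (x := v) (p := 2 * s) (Or.inl hv.ne')).ofReal_comp
    have h0 : HasDerivAt (fun v : ℝ => (v : ℂ)) 1 v := Complex.ofRealCLM.hasDerivAt
    have h3 : HasDerivAt (rE s t q a) (q * a * 1 - t * a ^ ((2 * s : ℝ) : ℂ) * ((2 * s * v ^ (2 * s - 1) : ℝ) : ℂ)) v :=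
      (h0.const_mul (q * a)).sub (h2.const_mul (t * a ^ ((2 * s : ℝ) : ℂ)))
    have h4 := h1.mul h3.cexp
    refine h4.congr_deriv ?_
    unfold rPsi
    have e1 : v ^ (1 + β) = v * v ^ β := by rw [Real.rpow_add hv, Real.rpow_one]
    have e2 : v ^ (1 + β - 1) = v ^ β := by congr 1; ring
    have e3 : v ^ (2 * s) = v * v ^ (2 * s - 1) := by
      rw [Real.rpow_sub_one hv.ne']; field_simp
    rw [e1, e2, e3]
    push_cast
    ring
  have hgi : IntegrableOn g (Ioi 0) := by
    refine Integrable.mono' i1 ?_ ?_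
    · have := aux_rE_meas s t q a
      exact Measurable.aestronglyMeasurable (by fun_prop)
    · filter_upwards [ae_restrict_mem measurableSet_Ioi] with v hv
      have hv : 0 < v := hv
      rw [hg, norm_mul, Complex.norm_real, Real.norm_of_nonneg (by positivity)]
      exact mul_le_mul_of_nonneg_left (hw v hv) (by positivity)
  have hlim := tendsto_zero_of_hasDerivAt_of_integrableOn_Ioi hd hψ hgi
  have hc : ContinuousWithinAt g (Ici 0) 0 := by
    refine ContinuousAt.continuousWithinAt ?_
    have c1 : ContinuousAt (fun v : ℝ => v ^ (1 + β)) 0 :=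
      Real.continuousAt_rpow_const _ _ (Or.inr (by linarith))
    have c2 : ContinuousAt (fun v : ℝ => v ^ (2 * s)) 0 :=
      Real.continuousAt_rpow_const _ _ (Or.inr (by linarith))
    have c3 : ContinuousAt (rE s t q a) 0 := by
      unfold rE
      exact ((continuousAt_const.mul Complex.continuous_ofReal.continuousAt)).sub
        (continuousAt_const.mul (Complex.continuous_ofReal.continuousAt.comp c2))
    exact (Complex.continuous_ofReal.continuousAt.comp c1).mul c3.cexp
  have := integral_Ioi_of_hasDerivAt_of_tendsto hc hd hψ hlim
  rw [this, hg]
  simp [Real.zero_rpow (by linarith : 1 + β ≠ 0)]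

lemma aux_rot {s t β M : ℝ} {q p d : ℂ} {w : ℝ → ℝ} (hs0 : 0 < s) (hβ : 0 ≤ β) (ht : 0 ≤ t)
    (hre : ∀ τ : ℝ, 0 ≤ τ → τ ≤ 1 → 0 < (p + τ * d).re)
    (hM : ∀ τ : ℝ, 0 ≤ τ → τ ≤ 1 → ‖p + τ * d‖ ≤ M)
    (hw : ∀ τ : ℝ, 0 ≤ τ → τ ≤ 1 → ∀ v, 0 < v → ‖Complex.exp (rE s t q (p + τ * d) v)‖ ≤ w v)
    (i0 : IntegrableOn (fun v => v ^ β * w v) (Ioi 0))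
    (i1 : IntegrableOn (fun v => v ^ (1 + β) * w v) (Ioi 0))
    (i2 : IntegrableOn (fun v => v ^ (2 * s + β) * w v) (Ioi 0)) :
    ∫ v in Ioi (0:ℝ), rPhi s t β q p v = ∫ v in Ioi (0:ℝ), rPhi s t β q (p + (1 / 2 : ℝ) * d) v := by
  have hM0 : 0 ≤ M := (norm_nonneg _).trans (hM 0 le_rfl zero_le_one)
  have hpow : ∀ τ : ℝ, 0 ≤ τ → τ ≤ 1 → ∀ c : ℝ, 0 ≤ c → ‖(p + τ * d) ^ (c : ℂ)‖ ≤ M ^ c := by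
    intro τ h0 h1 c hc
    rw [Complex.norm_cpow_real]
    exact Real.rpow_le_rpow (norm_nonneg _) (hM τ h0 h1) hc
  have hΦ : ∀ τ : ℝ, 0 ≤ τ → τ ≤ 1 → ∀ v, 0 < v → ‖rPhi s t β q (p + τ * d) v‖ ≤ M ^ (1 + β) * (v ^ β * w v) := by
    intro τ h0 h1 v hv
    unfold rPhi
    rw [norm_mul, norm_mul, Complex.norm_real, Real.norm_of_nonneg (by positivity)]
    have := hw τ h0 h1 v hv
    exact mul_le_mul (hpow τ h0 h1 _ (by linarith)) (mul_le_mul_of_nonneg_left this (by positivity))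
      (by positivity) (by positivity)
  set bd : ℝ → ℝ := fun v => (1 + β) * (v ^ β * w v) + ‖q‖ * M * (v ^ (1 + β) * w v)
    + 2 * s * t * M ^ (2 * s) * (v ^ (2 * s + β) * w v) with hbd
  have ibd : IntegrableOn bd (Ioi 0) :=
    Integrable.add (Integrable.add (i0.const_mul _) (i1.const_mul _)) (i2.const_mul _)
  have hΨ : ∀ τ : ℝ, 0 ≤ τ → τ ≤ 1 → ∀ v, 0 < v → ‖rPsi s t β q (p + τ * d) v‖ ≤ bd v := by
    intro τ h0 h1 v hv
    have hw' := hw τ h0 h1 v hv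
    have hw0 : 0 ≤ w v := (norm_nonneg _).trans hw'
    have hb : ‖((1 + β : ℝ) + q * (p + τ * d) * v - (2 * s * t : ℝ) * (p + τ * d) ^ ((2 * s : ℝ) : ℂ) * ((v ^ (2 * s) : ℝ) : ℂ) : ℂ)‖
        ≤ (1 + β) + ‖q‖ * M * v + 2 * s * t * M ^ (2 * s) * v ^ (2 * s) := by
      refine (norm_sub_le _ _).trans (add_le_add ((norm_add_le _ _).trans (add_le_add ?_ ?_)) ?_)
      · rw [Complex.norm_real, Real.norm_of_nonneg (by positivity)]
      · rw [norm_mul, norm_mul, Complex.norm_real, Real.norm_of_nonneg hv.le]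
        gcongr
        exact hM τ h0 h1
      · rw [norm_mul, norm_mul, Complex.norm_real, Complex.norm_real, Real.norm_of_nonneg (by positivity),
          Real.norm_of_nonneg (by positivity)]
        gcongr
        exact hpow τ h0 h1 _ (by linarith)
    unfold rPsi
    rw [norm_mul, norm_mul, Complex.norm_real, Real.norm_of_nonneg (by positivity)]
    calc _ ≤ v ^ β * w v * ((1 + β) + ‖q‖ * M * v + 2 * s * t * M ^ (2 * s) * v ^ (2 * s)) := by
          gcongr
      _ = bd v := by
          rw [hbd]; simp only
          rw [Real.rpow_add hv, Real.rpow_add hv, Real.rpow_one]; ring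
  have hΦi : ∀ τ : ℝ, 0 ≤ τ → τ ≤ 1 → IntegrableOn (rPhi s t β q (p + τ * d)) (Ioi 0) := by
    intro τ h0 h1
    refine Integrable.mono' (i0.const_mul (M ^ (1 + β))) (aux_rPhi_meas _ _ _ _ _).aestronglyMeasurable ?_
    filter_upwards [ae_restrict_mem measurableSet_Ioi] with v hv
    exact hΦ τ h0 h1 v hv
  have hΨi : ∀ τ : ℝ, 0 ≤ τ → τ ≤ 1 → IntegrableOn (rPsi s t β q (p + τ * d)) (Ioi 0) := by
    intro τ h0 h1
    refine Integrable.mono' ibd (aux_rPsi_meas _ _ _ _ _).aestronglyMeasurable ?_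
    filter_upwards [ae_restrict_mem measurableSet_Ioi] with v hv
    exact hΨ τ h0 h1 v hv
  have hpath : ∀ τ : ℝ, HasDerivAt (fun τ : ℝ => p + τ * d) d τ := by
    intro τ
    have h0 : HasDerivAt (fun v : ℝ => (v : ℂ)) 1 τ := Complex.ofRealCLM.hasDerivAt
    exact ((h0.mul_const d).const_add p).congr_deriv (one_mul d)
  have hPd : ∀ τ : ℝ, 0 ≤ τ → τ ≤ 1 → ∀ v : ℝ, HasDerivAt (fun τ : ℝ => rPhi s t β q (p + τ * d) v)
      ((p + τ * d) ^ (β : ℂ) * rPsi s t β q (p + τ * d) v * d) τ := by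
    intro τ h0 h1 v
    exact HasDerivAt.comp (h₂ := fun a => rPhi s t β q a v) τ (aux_rPhi_deriv s t β q _ v (hre τ h0 h1)) (hpath τ)
  set J : ℝ → ℂ := fun τ => ∫ v in Ioi (0:ℝ), rPhi s t β q (p + τ * d) v with hJ
  have hJd : ∀ τ ∈ Ioo (0:ℝ) 1, HasDerivAt J 0 τ := by
    intro τ hτ
    have h := hasDerivAt_integral_of_dominated_loc_of_deriv_le (μ := volume.restrict (Ioi (0:ℝ)))
      (F := fun τ v => rPhi s t β q (p + (τ:ℝ) * d) v) (x₀ := τ) (s := Ioo (0:ℝ) 1)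
      (F' := fun τ v => (p + (τ:ℝ) * d) ^ (β : ℂ) * rPsi s t β q (p + τ * d) v * d)
      (bound := fun v => M ^ β * bd v * ‖d‖)
      (isOpen_Ioo.mem_nhds hτ)
      (Eventually.of_forall fun τ => (aux_rPhi_meas _ _ _ _ _).aestronglyMeasurable)
      (hΦi τ hτ.1.le hτ.2.le)
      (((aux_rPsi_meas _ _ _ _ _).const_mul _).mul_const _).aestronglyMeasurable
      (by
        filter_upwards [ae_restrict_mem measurableSet_Ioi] with v hv τ' hτ'
        rw [norm_mul, norm_mul]
        have h1 := hΨ τ' hτ'.1.le hτ'.2.le v hv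
        have h2 := hpow τ' hτ'.1.le hτ'.2.le β hβ
        gcongr)
      ((ibd.const_mul _).mul_const _)
      (by
        filter_upwards with v τ' hτ'
        exact hPd τ' hτ'.1.le hτ'.2.le v)
    refine h.2.congr_deriv ?_
    rw [integral_mul_const, integral_const_mul, aux_rPsi_int_zero hs0 hβ (hw τ hτ.1.le hτ.2.le) i1
      (hΨi τ hτ.1.le hτ.2.le)]
    simp
  have hconst : ∀ τ ∈ Ioo (0:ℝ) 1, J τ = J (1/2) := by
    intro τ hτ
    refine isOpen_Ioo.is_const_of_deriv_eq_zero isPreconnected_Ioo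
      (fun τ hτ => (hJd τ hτ).differentiableAt.differentiableWithinAt) (fun τ hτ => (hJd τ hτ).deriv) hτ ?_
    constructor <;> norm_num
  have hcont : Tendsto J (nhdsWithin 0 (Ioi 0)) (nhds (J 0)) := by
    refine tendsto_integral_filter_of_dominated_convergence (fun v => M ^ (1 + β) * (v ^ β * w v)) ?_ ?_
      (i0.const_mul _) ?_
    · exact Eventually.of_forall fun τ => (aux_rPhi_meas _ _ _ _ _).aestronglyMeasurable
    · filter_upwards [Ioo_mem_nhdsGT (zero_lt_one (α := ℝ))] with τ hτ
      filter_upwards [ae_restrict_mem measurableSet_Ioi] with v hv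
      exact hΦ τ hτ.1.le hτ.2.le v hv
    · filter_upwards with v
      exact (hPd 0 le_rfl zero_le_one v).continuousAt.tendsto.mono_left nhdsWithin_le_nhds
  have hev : Tendsto J (nhdsWithin 0 (Ioi 0)) (nhds (J (1/2))) := by
    refine tendsto_const_nhds.congr' ?_
    filter_upwards [Ioo_mem_nhdsGT (zero_lt_one (α := ℝ))] with τ hτ
    exact (hconst τ hτ).symm
  have := tendsto_nhds_unique hcont hev
  simpa [hJ] using this

noncomputable def aA : ℂ := 1 + ((1 / 2 : ℝ) : ℂ) * Complex.I

lemma aux_kappa {s τ : ℝ} (hs0 : 0 < s) (hs1 : s < 1) (h0 : 0 ≤ τ) (h1 : τ ≤ 1) :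
    Real.cos (s * π / 2) ≤ ((1 + (τ:ℂ) * Complex.I) ^ ((2 * s : ℝ) : ℂ)).re := by
  set z : ℂ := 1 + (τ:ℂ) * Complex.I with hz
  have hre : z.re = 1 := by simp [hz]
  have him : z.im = τ := by simp [hz]
  have hpi := Real.pi_pos
  rw [Complex.cpow_ofReal_re]
  have harg0 : 0 ≤ z.arg := by rw [Complex.arg_nonneg_iff, him]; exact h0
  have harg1 : z.arg ≤ π / 4 := by
    have hlt : |z.arg| < π / 2 := Complex.abs_arg_lt_pi_div_two_iff.2 (Or.inl (by rw [hre]; norm_num))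
    rw [abs_lt] at hlt
    have h2 : Real.arctan (Real.tan z.arg) = z.arg := Real.arctan_tan hlt.1 hlt.2
    rw [← h2, Complex.tan_arg, hre, him, div_one, ← Real.arctan_one]
    exact Real.arctan_strictMono.monotone h1
  have hcos : Real.cos (s * π / 2) ≤ Real.cos (z.arg * (2 * s)) := by
    apply Real.cos_le_cos_of_nonneg_of_le_pi (by positivity)
    · nlinarith
    · nlinarith
  have hpos : 0 < Real.cos (s * π / 2) := Real.cos_pos_of_mem_Ioo ⟨by nlinarith, by nlinarith⟩
  have hn : 1 ≤ ‖z‖ := by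
    have := Complex.abs_re_le_norm z
    rw [hre] at this; simpa using this
  have hn2 : 1 ≤ ‖z‖ ^ (2 * s) := Real.one_le_rpow hn (by linarith)
  nlinarith

lemma aux_rE_re (s t : ℝ) (a : ℂ) (v : ℝ) :
    (rE s t Complex.I a v).re = - a.im * v - t * (a ^ ((2 * s : ℝ) : ℂ)).re * v ^ (2 * s) := by
  unfold rE
  rw [Complex.sub_re, Complex.re_mul_ofReal, Complex.re_mul_ofReal, Complex.re_ofReal_mul]
  simp

lemma aux_cosT_one {s ε β : ℝ} (hs0 : 0 < s) (hs1 : s < 1) (hε : 0 < ε) (hβ : 0 ≤ β) :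
    cosT s ε β 1 = (∫ v in Ioi (0:ℝ), rPhi s ε β Complex.I aA v).re := by
  have hpi := Real.pi_pos
  have hpos : 0 < Real.cos (s * π / 2) := Real.cos_pos_of_mem_Ioo ⟨by nlinarith, by nlinarith⟩
  have hk : 0 < ε * Real.cos (s * π / 2) := by positivity
  have hw : ∀ τ : ℝ, 0 ≤ τ → τ ≤ 1 → ∀ v, 0 < v → ‖Complex.exp (rE s ε Complex.I (1 + τ * Complex.I) v)‖
      ≤ rexp (-(ε * Real.cos (s * π / 2) * v ^ (2 * s))) := by
    intro τ h0 h1 v hv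
    rw [Complex.norm_exp, aux_rE_re]
    apply Real.exp_le_exp.2
    have h3 := aux_kappa hs0 hs1 h0 h1
    have h4 : ((1:ℂ) + τ * Complex.I).im = τ := by simp
    rw [h4]
    have h5 : 0 ≤ τ * v := by positivity
    have h6 : ε * Real.cos (s * π / 2) * v ^ (2 * s) ≤
        ε * ((1 + (τ:ℂ) * Complex.I) ^ ((2 * s : ℝ) : ℂ)).re * v ^ (2 * s) := by gcongr
    linarith
  have hrot := aux_rot (s := s) (t := ε) (β := β) (M := 2) (q := Complex.I) (p := 1) (d := Complex.I)
    hs0 hβ hε.le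
    (fun τ h0 h1 => by simp)
    (fun τ h0 h1 => by
      refine (norm_add_le _ _).trans ?_
      rw [norm_mul, Complex.norm_real, Complex.norm_I, norm_one, Real.norm_of_nonneg h0]
      linarith)
    hw (aux_wint hs0 hk hβ) (aux_wint hs0 hk (by linarith)) (aux_wint hs0 hk (by linarith))
  have hIntg : IntegrableOn (rPhi s ε β Complex.I 1) (Ioi 0) := by
    refine Integrable.mono' (aux_wint hs0 hk hβ) (aux_rPhi_meas _ _ _ _ _).aestronglyMeasurable ?_
    filter_upwards [ae_restrict_mem measurableSet_Ioi] with v hv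
    have hv : 0 < v := hv
    have := hw 0 le_rfl zero_le_one v hv
    simp only [Complex.ofReal_zero, zero_mul, add_zero] at this
    unfold rPhi
    rw [Complex.one_cpow, one_mul, norm_mul, Complex.norm_real, Real.norm_of_nonneg (by positivity)]
    gcongr
  unfold aA
  rw [← hrot, ← RCLike.re_eq_complex_re, ← integral_re hIntg]
  unfold cosT
  refine setIntegral_congr_fun measurableSet_Ioi fun v hv => ?_
  have hv : 0 < v := hv
  simp only [rPhi, rE, RCLike.re_eq_complex_re]
  rw [Complex.one_cpow, Complex.one_cpow, one_mul, one_mul, Complex.re_ofReal_mul, Complex.exp_re]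
  have e1 : (Complex.I * 1 * (v:ℂ) - ε * 1 * ((v ^ (2 * s) : ℝ) : ℂ)).re = -(ε * v ^ (2 * s)) := by
    rw [Complex.sub_re, Complex.re_mul_ofReal, Complex.re_mul_ofReal]; simp
  have e2 : (Complex.I * 1 * (v:ℂ) - ε * 1 * ((v ^ (2 * s) : ℝ) : ℂ)).im = v := by
    rw [Complex.sub_im, Complex.im_mul_ofReal, Complex.im_mul_ofReal]; simp
  rw [e1, e2]
  ring

lemma aux_scale {s t β x : ℝ} (hx : 0 < x) :
    x ^ (1 + β) * cosT s t β x = cosT s (t * x ^ (-(2 * s))) β 1 := by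
  unfold cosT
  have h := integral_comp_mul_left_Ioi (fun r : ℝ => r ^ β * (Real.cos (x * r) * rexp (-(t * r ^ (2 * s))))) 0
    (inv_pos.2 hx)
  rw [mul_zero, inv_inv, smul_eq_mul] at h
  have h' : x * ∫ r in Ioi (0:ℝ), r ^ β * (Real.cos (x * r) * rexp (-(t * r ^ (2 * s)))) = _ := h.symm
  rw [Real.rpow_add hx, Real.rpow_one, mul_comm x, mul_assoc, h', ← integral_const_mul]
  refine setIntegral_congr_fun measurableSet_Ioi fun u hu => ?_
  have hu : 0 < u := hu
  rw [Real.mul_rpow (by positivity) hu.le, Real.mul_rpow (by positivity) hu.le, Real.inv_rpow hx.le,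
    Real.inv_rpow hx.le, Real.rpow_neg hx.le, mul_inv_cancel_left₀ hx.ne', one_mul]
  have : x ^ β ≠ 0 := by positivity
  field_simp

lemma aux_aA_re : aA.re = 1 := by simp [aA]
lemma aux_aA_im : aA.im = 1 / 2 := by simp [aA]

lemma aux_W_re {s : ℝ} (hs0 : 0 < s) (hs1 : s < 1) : 0 ≤ (aA ^ ((2 * s : ℝ) : ℂ)).re := by
  have hpi := Real.pi_pos
  have hpos : 0 < Real.cos (s * π / 2) := Real.cos_pos_of_mem_Ioo ⟨by nlinarith, by nlinarith⟩
  exact hpos.le.trans (aux_kappa (τ := 1 / 2) hs0 hs1 (by norm_num) (by norm_num))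

lemma aux_bd {s ε : ℝ} (hs0 : 0 < s) (hs1 : s < 1) (hε : 0 ≤ ε) (v : ℝ) (hv : 0 < v) :
    ‖Complex.exp (rE s ε Complex.I aA v)‖ ≤ rexp (-(1 / 2 * v)) := by
  rw [Complex.norm_exp, aux_rE_re, aux_aA_im]
  apply Real.exp_le_exp.2
  have := aux_W_re hs0 hs1
  have : 0 ≤ ε * (aA ^ ((2 * s : ℝ) : ℂ)).re * v ^ (2 * s) := by positivity
  linarith

lemma aux_eint {β : ℝ} (hβ : 0 ≤ β) : IntegrableOn (fun v : ℝ => v ^ β * rexp (-(1 / 2 * v))) (Ioi 0) := by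
  have := aux_wint (s := 1 / 2) (t := 1 / 2) (by norm_num) (by norm_num) hβ
  simpa using this

lemma aux_rPhi_bd {s ε β : ℝ} (hs0 : 0 < s) (hs1 : s < 1) (hε : 0 ≤ ε) (v : ℝ) (hv : 0 < v) :
    ‖rPhi s ε β Complex.I aA v‖ ≤ ‖aA ^ ((1 + β : ℝ) : ℂ)‖ * (v ^ β * rexp (-(1 / 2 * v))) := by
  unfold rPhi
  rw [norm_mul, norm_mul, Complex.norm_real, Real.norm_of_nonneg (by positivity)]
  have := aux_bd hs0 hs1 hε v hv
  gcongr

lemma aux_rPhi_int {s ε β : ℝ} (hs0 : 0 < s) (hs1 : s < 1) (hε : 0 ≤ ε) (hβ : 0 ≤ β) :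
    IntegrableOn (rPhi s ε β Complex.I aA) (Ioi 0) := by
  refine Integrable.mono' ((aux_eint hβ).const_mul ‖aA ^ ((1 + β : ℝ) : ℂ)‖) (aux_rPhi_meas _ _ _ _ _).aestronglyMeasurable ?_
  filter_upwards [ae_restrict_mem measurableSet_Ioi] with v hv
  exact aux_rPhi_bd hs0 hs1 hε v hv

noncomputable def qQ (s : ℝ) : ℝ := (∫ v in Ioi (0:ℝ), rPhi s 0 (2 * s) Complex.I aA v).re

lemma aux_lim1 {s : ℝ} (hs0 : 0 < s) (hs1 : s < 1) :
    Tendsto (fun ε => cosT s ε (2 * s) 1) (nhdsWithin 0 (Ioi 0)) (nhds (qQ s)) := by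
  have h : Tendsto (fun ε => ∫ v in Ioi (0:ℝ), rPhi s ε (2 * s) Complex.I aA v) (nhdsWithin 0 (Ioi 0))
      (nhds (∫ v in Ioi (0:ℝ), rPhi s 0 (2 * s) Complex.I aA v)) := by
    refine tendsto_integral_filter_of_dominated_convergence
      (fun v => ‖aA ^ ((1 + 2 * s : ℝ) : ℂ)‖ * (v ^ (2 * s) * rexp (-(1 / 2 * v)))) ?_ ?_
      ((aux_eint (by linarith)).const_mul _) ?_
    · exact Eventually.of_forall fun τ => (aux_rPhi_meas _ _ _ _ _).aestronglyMeasurable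
    · filter_upwards [self_mem_nhdsWithin] with ε hε
      filter_upwards [ae_restrict_mem measurableSet_Ioi] with v hv
      exact aux_rPhi_bd hs0 hs1 (le_of_lt hε) v hv
    · filter_upwards with v
      have : Continuous (fun ε : ℝ => rPhi s ε (2 * s) Complex.I aA v) := by
        unfold rPhi rE; fun_prop
      exact (this.tendsto 0).mono_left nhdsWithin_le_nhds
  refine ((Complex.continuous_re.tendsto _).comp h).congr' ?_
  filter_upwards [self_mem_nhdsWithin] with ε hε
  exact (aux_cosT_one hs0 hs1 hε (by linarith)).symm

lemma aux_exp_sub {z : ℂ} (hz : z.re ≤ 0) : ‖Complex.exp z - 1‖ ≤ 2 * ‖z‖ := by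
  rcases le_total ‖z‖ 1 with h | h
  · exact Complex.norm_exp_sub_one_le h
  · refine (norm_sub_le _ _).trans ?_
    rw [Complex.norm_exp, norm_one]
    have := Real.exp_le_one_iff.2 hz
    linarith

lemma aux_zero_re (s : ℝ) : (∫ v in Ioi (0:ℝ), rPhi s 0 0 Complex.I aA v).re = 0 := by
  have ha : aA ≠ 0 := by
    intro h; have := aux_aA_re; rw [h] at this; simp at this
  have h := integral_exp_mul_complex_Ioi (a := Complex.I * aA) (by simp [aux_aA_im]) 0
  have h2 : ∀ v : ℝ, rPhi s 0 0 Complex.I aA v = aA * Complex.exp (Complex.I * aA * v) := by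
    intro v; simp [rPhi, rE]
  simp_rw [h2]
  rw [integral_const_mul, h]
  have : aA * (-Complex.exp (Complex.I * aA * (0:ℝ)) / (Complex.I * aA)) = Complex.I := by
    simp only [Complex.ofReal_zero, mul_zero, Complex.exp_zero]
    field_simp
    simp
  rw [this, Complex.I_re]

lemma aux_diff (s ε v : ℝ) (hv : 0 < v) : rPhi s ε 0 Complex.I aA v - rPhi s 0 0 Complex.I aA v =
    aA * Complex.exp (Complex.I * aA * v) *
      (Complex.exp (ε * (-(aA ^ ((2 * s : ℝ) : ℂ) * ((v ^ (2 * s) : ℝ) : ℂ)))) - 1) := by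
  have e : rE s ε Complex.I aA v = Complex.I * aA * v + ε * (-(aA ^ ((2 * s : ℝ) : ℂ) * ((v ^ (2 * s) : ℝ) : ℂ))) := by
    unfold rE; ring
  have e0 : rE s 0 Complex.I aA v = Complex.I * aA * v := by
    unfold rE; simp
  unfold rPhi
  rw [e, e0, Complex.exp_add]
  simp
  ring

lemma aux_lim0 {s : ℝ} (hs0 : 0 < s) (hs1 : s < 1) :
    Tendsto (fun ε => ε⁻¹ * cosT s ε 0 1) (nhdsWithin 0 (Ioi 0)) (nhds (-qQ s)) := by
  have ha : aA ≠ 0 := by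
    intro h; have := aux_aA_re; rw [h] at this; simp at this
  have hWre := aux_W_re hs0 hs1
  set W := aA ^ ((2 * s : ℝ) : ℂ) with hW
  have h : Tendsto (fun ε : ℝ => ∫ v in Ioi (0:ℝ), ((ε⁻¹ : ℝ) : ℂ) * (rPhi s ε 0 Complex.I aA v - rPhi s 0 0 Complex.I aA v))
      (nhdsWithin 0 (Ioi 0))
      (nhds (∫ v in Ioi (0:ℝ), -rPhi s 0 (2 * s) Complex.I aA v)) := by
    refine tendsto_integral_filter_of_dominated_convergence
      (fun v => ‖aA‖ * (2 * ‖W‖) * (v ^ (2 * s) * rexp (-(1 / 2 * v)))) ?_ ?_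
      ((aux_eint (by linarith)).const_mul _) ?_
    · exact Eventually.of_forall fun τ => (((aux_rPhi_meas _ _ _ _ _).sub (aux_rPhi_meas _ _ _ _ _)).const_mul _).aestronglyMeasurable
    · filter_upwards [self_mem_nhdsWithin] with ε hε
      have hε : 0 < ε := hε
      filter_upwards [ae_restrict_mem measurableSet_Ioi] with v hv
      have hv : 0 < v := hv
      have hv2 : 0 ≤ v ^ (2 * s) := by positivity
      rw [aux_diff s ε v hv, ← hW]
      have h1 : ‖Complex.exp (ε * (-(W * ((v ^ (2 * s) : ℝ) : ℂ)))) - 1‖ ≤ 2 * (ε * (‖W‖ * v ^ (2 * s))) := by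
        refine (aux_exp_sub ?_).trans (le_of_eq ?_)
        · rw [Complex.re_ofReal_mul, Complex.neg_re, Complex.re_mul_ofReal]
          have : 0 ≤ ε * (W.re * v ^ (2 * s)) := by positivity
          linarith
        · rw [norm_mul, norm_neg, norm_mul, Complex.norm_real, Complex.norm_real,
            Real.norm_of_nonneg hε.le, Real.norm_of_nonneg hv2]
      have h2 : ‖Complex.exp (Complex.I * aA * v)‖ = rexp (-(1 / 2 * v)) := by
        rw [Complex.norm_exp]; congr 1
        rw [Complex.re_mul_ofReal]; simp [aux_aA_im]
      rw [norm_mul, norm_mul, norm_mul, h2, Complex.norm_real, Real.norm_of_nonneg (by positivity)]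
      calc _ ≤ ε⁻¹ * (‖aA‖ * rexp (-(1 / 2 * v)) * (2 * (ε * (‖W‖ * v ^ (2 * s))))) := by gcongr
        _ = _ := by field_simp
    · filter_upwards [ae_restrict_mem measurableSet_Ioi] with v hv
      have hv : 0 < v := hv
      set z : ℂ := -(W * ((v ^ (2 * s) : ℝ) : ℂ)) with hz
      have hd : HasDerivAt (fun ε : ℝ => Complex.exp (ε * z)) z 0 := by
        have h0 : HasDerivAt (fun v : ℝ => (v : ℂ)) 1 0 := Complex.ofRealCLM.hasDerivAt
        exact (h0.mul_const z).cexp.congr_deriv (by simp)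
      have h3 := (hasDerivAt_iff_tendsto_slope.1 hd).mono_left
        (nhdsWithin_mono (0:ℝ) (fun y (hy : 0 < y) => (ne_of_gt hy : y ≠ 0)))
      have h4 := h3.const_mul (aA * Complex.exp (Complex.I * aA * v))
      have e1 : aA * Complex.exp (Complex.I * aA * v) * z = -rPhi s 0 (2 * s) Complex.I aA v := by
        have e0 : rE s 0 Complex.I aA v = Complex.I * aA * v := by
          unfold rE; simp
        unfold rPhi
        rw [e0, hz, hW]
        have : aA ^ ((1 + 2 * s : ℝ) : ℂ) = aA * aA ^ ((2 * s : ℝ) : ℂ) := by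
          rw [Complex.ofReal_add, Complex.cpow_add _ _ ha, Complex.ofReal_one, Complex.cpow_one]
        rw [this]; ring
      rw [e1] at h4
      refine h4.congr fun ε => ?_
      rw [aux_diff s ε v hv, slope_def_module]
      simp only [sub_zero, Complex.ofReal_zero, zero_mul, Complex.exp_zero, Complex.real_smul]
      ring
  rw [integral_neg] at h
  have h5 := (Complex.continuous_re.tendsto _).comp h
  rw [Complex.neg_re] at h5
  refine h5.congr' ?_
  filter_upwards [self_mem_nhdsWithin] with ε hε
  have hε : 0 < ε := hε
  simp only [Function.comp_apply]
  rw [integral_const_mul, Complex.re_ofReal_mul, integral_sub (aux_rPhi_int hs0 hs1 hε.le le_rfl)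
    (aux_rPhi_int hs0 hs1 le_rfl le_rfl), Complex.sub_re, aux_zero_re, sub_zero,
    aux_cosT_one hs0 hs1 hε le_rfl]

lemma aux_qQ_neg {s : ℝ} (hs0 : 0 < s) (hs1 : s < 1) : qQ s < 0 := by
  have hpi := Real.pi_pos
  set r : ℂ := 1 / 2 - Complex.I with hr
  have hrre : r.re = 1 / 2 := by simp [hr]
  have hr0 : r ≠ 0 := by intro h; rw [h] at hrre; norm_num at hrre
  have ha : aA = Complex.I * r := by
    rw [hr, aA]; push_cast
    linear_combination Complex.I_mul_I
  have hpw : aA ^ ((1 + 2 * s : ℝ) : ℂ) = Complex.I ^ ((1 + 2 * s : ℝ) : ℂ) * r ^ ((1 + 2 * s : ℝ) : ℂ) := by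
    have h1 : Complex.log (Complex.I * r) = Complex.log Complex.I + Complex.log r := by
      apply Complex.log_mul Complex.I_ne_zero hr0
      have := Complex.abs_arg_lt_pi_div_two_iff.2 (Or.inl (by rw [hrre]; norm_num : 0 < r.re))
      rw [abs_lt] at this
      rw [Complex.arg_I]
      constructor <;> linarith
    rw [ha, Complex.cpow_def_of_ne_zero (mul_ne_zero Complex.I_ne_zero hr0),
      Complex.cpow_def_of_ne_zero Complex.I_ne_zero, Complex.cpow_def_of_ne_zero hr0, h1, add_mul, Complex.exp_add]
  have hrot := aux_rot (s := s) (t := 0) (β := 2 * s) (M := 3) (q := -1) (p := 1 / 2) (d := -2 * Complex.I)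
    (w := fun v => rexp (-(1 / 2 * v))) hs0 (by linarith) le_rfl
    (fun τ h0 h1 => by simp)
    (fun τ h0 h1 => by
      refine (norm_add_le _ _).trans ?_
      rw [norm_mul, norm_mul, Complex.norm_real, Complex.norm_I, Real.norm_of_nonneg h0]
      norm_num
      linarith)
    (fun τ h0 h1 v hv => by
      rw [Complex.norm_exp]
      apply le_of_eq; congr 1
      unfold rE
      simp)
    (aux_eint (by linarith)) (aux_eint (by linarith)) (aux_eint (by linarith))
  have hr' : (1 / 2 : ℂ) + ((1 / 2 : ℝ) : ℂ) * (-2 * Complex.I) = r := by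
    rw [hr]; push_cast; ring
  rw [hr'] at hrot
  set G : ℝ := ∫ v in Ioi (0:ℝ), v ^ (2 * s) * rexp (-(1 / 2 * v)) with hG
  have hGpos : 0 < G := by
    rw [hG, setIntegral_pos_iff_support_of_nonneg_ae]
    · have : Function.support (fun v : ℝ => v ^ (2 * s) * rexp (-(1 / 2 * v))) ∩ Ioi 0 = Ioi 0 := by
        apply inter_eq_right.2
        intro v hv
        have hv : 0 < v := hv
        exact (by positivity : (0:ℝ) < v ^ (2 * s) * rexp (-(1 / 2 * v))).ne'
      rw [this]; simp
    · filter_upwards [ae_restrict_mem measurableSet_Ioi] with v hv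
      have hv : 0 < v := hv
      simp only [Pi.zero_apply]
      positivity
    · exact aux_eint (by linarith)
  have hleft : ∫ v in Ioi (0:ℝ), rPhi s 0 (2 * s) (-1) (1 / 2) v = (((1 / 2 : ℝ) ^ (1 + 2 * s) * G : ℝ) : ℂ) := by
    rw [hG, Complex.ofReal_mul, ← integral_complex_ofReal, ← integral_const_mul]
    refine setIntegral_congr_fun measurableSet_Ioi fun v hv => ?_
    have hv : 0 < v := hv
    simp only [rPhi, rE]
    have e1 : ((1 / 2 : ℂ)) ^ ((1 + 2 * s : ℝ) : ℂ) = (((1 / 2 : ℝ) ^ (1 + 2 * s) : ℝ) : ℂ) := by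
      rw [Complex.ofReal_cpow (by norm_num : (0:ℝ) ≤ 1 / 2)]; norm_num
    have e2 : (-1 * (1 / 2) * (v:ℂ) - ((0:ℝ):ℂ) * (1 / 2) ^ ((2 * s : ℝ) : ℂ) * ((v ^ (2 * s) : ℝ) : ℂ)) =
        ((-(1 / 2 * v) : ℝ) : ℂ) := by push_cast; ring
    rw [e1, e2, Complex.ofReal_mul, Complex.ofReal_exp]
  have hright : ∫ v in Ioi (0:ℝ), rPhi s 0 (2 * s) Complex.I aA v =
      Complex.I ^ ((1 + 2 * s : ℝ) : ℂ) * ∫ v in Ioi (0:ℝ), rPhi s 0 (2 * s) (-1) r v := by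
    rw [← integral_const_mul]
    refine setIntegral_congr_fun measurableSet_Ioi fun v hv => ?_
    simp only [rPhi, rE]
    rw [hpw]
    have : Complex.I * aA = -1 * r := by rw [ha, ← mul_assoc, Complex.I_mul_I]
    rw [this]
    simp
    ring
  unfold qQ
  rw [hright, ← hrot, hleft, Complex.re_mul_ofReal, Complex.cpow_ofReal_re, Complex.norm_I, Complex.arg_I,
    Real.one_rpow, one_mul]
  have : Real.cos (π / 2 * (1 + 2 * s)) = - Real.sin (π * s) := by
    rw [← Real.cos_add_pi_div_two]; congr 1; ring
  rw [this]
  have h1 : 0 < Real.sin (π * s) := Real.sin_pos_of_pos_of_lt_pi (by positivity) (by nlinarith)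
  have h2 : 0 < (1 / 2 : ℝ) ^ (1 + 2 * s) * G := by positivity
  nlinarith

lemma aux_eps {s t : ℝ} (hs0 : 0 < s) (ht : 0 < t) :
    Tendsto (fun x : ℝ => t * x ^ (-(2 * s))) atTop (nhdsWithin 0 (Ioi 0)) := by
  rw [tendsto_nhdsWithin_iff]
  constructor
  · simpa using (tendsto_rpow_neg_atTop (by linarith : 0 < 2 * s)).const_mul t
  · filter_upwards [eventually_gt_atTop 0] with x hx
    exact mem_Ioi.2 (by positivity)

lemma aux_asymp1 {s t : ℝ} (hs0 : 0 < s) (hs1 : s < 1) (ht : 0 < t) :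
    Tendsto (fun x : ℝ => x ^ (1 + 2 * s) * cosT s t (2 * s) x) atTop (nhds (qQ s)) := by
  refine ((aux_lim1 hs0 hs1).comp (aux_eps hs0 ht)).congr' ?_
  filter_upwards [eventually_gt_atTop 0] with x hx
  simp only [Function.comp_apply]
  rw [aux_scale hx]

lemma aux_asymp0 {s t : ℝ} (hs0 : 0 < s) (hs1 : s < 1) (ht : 0 < t) :
    Tendsto (fun x : ℝ => x ^ (1 + 2 * s) * cosT s t 0 x) atTop (nhds (t * (-qQ s))) := by
  refine (((aux_lim0 hs0 hs1).comp (aux_eps hs0 ht)).const_mul t).congr' ?_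
  filter_upwards [eventually_gt_atTop 0] with x hx
  simp only [Function.comp_apply]
  rw [← aux_scale hx, Real.rpow_neg hx.le, add_zero, Real.rpow_one, Real.rpow_add hx, Real.rpow_one]
  have : x ^ (2 * s) ≠ 0 := by positivity
  field_simp

lemma aux_large {s t : ℝ} (hs0 : 0 < s) (hs1 : s < 1) (ht : 0 < t) :
    ∀ᶠ x in atTop, 0 < cosT s t 0 x := by
  have hq := aux_qQ_neg hs0 hs1
  have h := (aux_asymp0 hs0 hs1 ht).eventually (lt_mem_nhds (by nlinarith : (0:ℝ) < t * (-qQ s)))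
  filter_upwards [h, eventually_gt_atTop 0] with x hx hx0
  exact pos_of_mul_pos_right hx (by positivity)

lemma aux_tderiv {s t : ℝ} (hs0 : 0 < s) (ht : 0 < t) (x : ℝ) :
    HasDerivAt (fun τ => cosT s τ 0 x) (-cosT s t (2 * s) x) t := by
  have h := hasDerivAt_integral_of_dominated_loc_of_deriv_le (μ := volume.restrict (Ioi (0:ℝ)))
    (F := fun τ r => r ^ (0:ℝ) * (Real.cos (x * r) * rexp (-(τ * r ^ (2 * s))))) (x₀ := t) (s := Ioi (t / 2))
    (F' := fun τ r => -(r ^ (2 * s) * (Real.cos (x * r) * rexp (-(τ * r ^ (2 * s))))))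
    (bound := fun r => r ^ (2 * s) * rexp (-(t / 2 * r ^ (2 * s))))
    (Ioi_mem_nhds (by linarith))
    (Eventually.of_forall fun τ => Measurable.aestronglyMeasurable (by fun_prop))
    (aux_cosT_int hs0 ht le_rfl x)
    (Measurable.aestronglyMeasurable (by fun_prop))
    (by
      filter_upwards [ae_restrict_mem measurableSet_Ioi] with r hr τ hτ
      have hr : 0 < r := hr
      have hτ : t / 2 < τ := hτ
      rw [norm_neg, norm_mul, norm_mul, Real.norm_of_nonneg (by positivity), Real.norm_of_nonneg (Real.exp_pos _).le,
        Real.norm_eq_abs]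
      have h1 := Real.abs_cos_le_one (x * r)
      have h2 : rexp (-(τ * r ^ (2 * s))) ≤ rexp (-(t / 2 * r ^ (2 * s))) := by
        apply Real.exp_le_exp.2
        have : t / 2 * r ^ (2 * s) ≤ τ * r ^ (2 * s) := by gcongr
        linarith
      calc _ ≤ r ^ (2 * s) * (1 * rexp (-(t / 2 * r ^ (2 * s)))) := by gcongr
        _ = _ := by rw [one_mul])
    (aux_wint hs0 (by linarith) (by linarith))
    (by
      filter_upwards with r τ hτ
      have h1 : HasDerivAt (fun τ : ℝ => -(τ * r ^ (2 * s))) (-(1 * r ^ (2 * s))) τ :=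
        ((hasDerivAt_id τ).mul_const _).neg
      refine ((h1.exp.const_mul (Real.cos (x * r))).const_mul (r ^ (0:ℝ))).congr_deriv ?_
      rw [Real.rpow_zero]; ring)
  refine h.2.congr_deriv ?_
  rw [integral_neg]
  rfl

lemma aux_coef_pos {s : ℝ} (hs0 : 0 < s) (hs1 : s < 1) : 0 < fracLapCoef s := by
  unfold fracLapCoef
  have h1 : 0 < Real.Gamma (s + 1 / 2) := Real.Gamma_pos_of_pos (by linarith)
  have h2 : 0 < Real.Gamma (1 - s) := Real.Gamma_pos_of_pos (by linarith)
  have := Real.pi_pos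
  positivity

lemma aux_pos {s t : ℝ} (hs0 : 0 < s) (hs1 : s < 1) (ht : 0 < t) (x : ℝ) : 0 < cosT s t 0 x := by
  have hpi := Real.pi_pos
  have hnn : ∀ y, 0 ≤ cosT s t 0 y := aux_cosT_nonneg hs0 hs1 ht
  refine lt_of_le_of_ne (hnn x) fun h0 => ?_
  have hmin : IsLocalMin (fun τ => cosT s τ 0 x) t := by
    filter_upwards [lt_mem_nhds ht] with τ hτ
    rw [← h0]
    exact aux_cosT_nonneg hs0 hs1 hτ x
  have hz := hmin.hasDerivAt_eq_zero (aux_tderiv hs0 ht x)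
  have hz' : cosT s t (2 * s) x = 0 := by linarith
  obtain ⟨hIntg, hfl⟩ := aux_fracLap hs0 hs1 ht x
  rw [hz', mul_zero] at hfl
  unfold fracLap at hfl
  have hI : ∫ y in Ioi (0:ℝ), (2 * (2 * fracHeatKernel s t x) - 2 * fracHeatKernel s t (x + y)
      - 2 * fracHeatKernel s t (x - y)) * y ^ (-1 - 2 * s) = 0 :=
    (mul_eq_zero.1 hfl).resolve_left (aux_coef_pos hs0 hs1).ne'
  have hk0 : ∀ y, 0 ≤ fracHeatKernel s t y := by
    intro y; rw [aux_kernel_eq]; have := hnn y; positivity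
  have hx0 : fracHeatKernel s t x = 0 := by rw [aux_kernel_eq, ← h0, mul_zero]
  have hpos : 0 < ∫ y in Ioi (0:ℝ), -((2 * (2 * fracHeatKernel s t x) - 2 * fracHeatKernel s t (x + y)
      - 2 * fracHeatKernel s t (x - y)) * y ^ (-1 - 2 * s)) := by
    have hval : ∀ y : ℝ, -((2 * (2 * fracHeatKernel s t x) - 2 * fracHeatKernel s t (x + y)
      - 2 * fracHeatKernel s t (x - y)) * y ^ (-1 - 2 * s)) =
        (2 * fracHeatKernel s t (x + y) + 2 * fracHeatKernel s t (x - y)) * y ^ (-1 - 2 * s) := by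
      intro y; rw [hx0]; ring
    rw [setIntegral_pos_iff_support_of_nonneg_ae]
    · obtain ⟨R, hR⟩ := eventually_atTop.1 (aux_large hs0 hs1 ht)
      have hsub : Ioi (max 0 (R - x)) ⊆ Function.support (fun y : ℝ => -((2 * (2 * fracHeatKernel s t x)
          - 2 * fracHeatKernel s t (x + y) - 2 * fracHeatKernel s t (x - y)) * y ^ (-1 - 2 * s))) ∩ Ioi 0 := by
        intro y hy
        have hy : max 0 (R - x) < y := hy
        have hy0 : 0 < y := (le_max_left _ _).trans_lt hy
        have hy1 : R - x < y := (le_max_right _ _).trans_lt hy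
        refine ⟨?_, hy0⟩
        rw [Function.mem_support, hval]
        have h1 : 0 < fracHeatKernel s t (x + y) := by
          rw [aux_kernel_eq]
          have := hR (x + y) (by linarith)
          positivity
        have h2 := hk0 (x - y)
        positivity
      refine lt_of_lt_of_le ?_ (measure_mono hsub)
      simp
    · filter_upwards [ae_restrict_mem measurableSet_Ioi] with y hy
      have hy : 0 < y := hy
      rw [hval]
      have h1 := hk0 (x + y)
      have h2 := hk0 (x - y)
      simp only [Pi.zero_apply]
      positivity
    · exact hIntg.neg
  rw [integral_neg, hI] at hpos
  simp at hpos

lemma aux_final {s t : ℝ} (hs : s ∈ Set.Ioo (0:ℝ) 1) (ht : 0 < t) :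
    (∀ x : ℝ, 0 < 2 * fracHeatKernel s t x) ∧
    (∃ R : ℝ, 0 < R ∧ ∀ x : ℝ, R ≤ |x| →
      0 ≤ fracLap s (fun x' => 2 * fracHeatKernel s t x') x + (2/t) * (2 * fracHeatKernel s t x) ∧
      fracLap s (fun x' => 2 * fracHeatKernel s t x') x + (1/(2*t)) * (2 * fracHeatKernel s t x) ≤ 0) ∧
    (∃ L : ℝ, 0 < L ∧
      Tendsto (fun x : ℝ => x ^ (1 + 2*s) * (2 * fracHeatKernel s t x)) atTop (nhds L)) := by
  obtain ⟨hs0, hs1⟩ := hs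
  have hpi := Real.pi_pos
  have hq := aux_qQ_neg hs0 hs1
  have a0 := aux_asymp0 hs0 hs1 ht
  have a1 := aux_asymp1 hs0 hs1 ht
  refine ⟨fun x => ?_, ?_, ?_⟩
  · rw [aux_kernel_eq]
    have := aux_pos hs0 hs1 ht x
    positivity
  · have l2 := a1.add (a0.const_mul (2 / t))
    have l3 := a1.add (a0.const_mul (1 / (2 * t)))
    have v2 : qQ s + 2 / t * (t * -qQ s) = - qQ s := by field_simp; ring
    have v3 : qQ s + 1 / (2 * t) * (t * -qQ s) = qQ s / 2 := by field_simp; ring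
    rw [v2] at l2
    rw [v3] at l3
    have e2 := l2.eventually (lt_mem_nhds (by linarith : 0 < - qQ s))
    have e3 := l3.eventually (gt_mem_nhds (by linarith : qQ s / 2 < 0))
    obtain ⟨R, hR⟩ := eventually_atTop.1 (e2.and e3)
    refine ⟨max R 1, by positivity, fun x hx => ?_⟩
    rw [(aux_fracLap hs0 hs1 ht x).2, aux_kernel_eq]
    have hab : ∀ β, cosT s t β x = cosT s t β |x| := by
      intro β
      rcases abs_choice x with h | h
      · rw [h]
      · rw [h, aux_cosT_even]
    rw [hab, hab]
    have hx0 : 0 < |x| := lt_of_lt_of_le (by positivity) hx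
    obtain ⟨h2, h3⟩ := hR |x| ((le_max_left _ _).trans hx)
    have hp : 0 < |x| ^ (1 + 2 * s) := by positivity
    generalize cosT s t (2 * s) |x| = A at *
    generalize cosT s t 0 |x| = B at *
    have h2' : 0 < A + 2 / t * B := by
      refine pos_of_mul_pos_right (a := |x| ^ (1 + 2 * s)) ?_ hp.le
      linarith
    have h3' : A + 1 / (2 * t) * B < 0 := by
      have : 0 < -(A + 1 / (2 * t) * B) := by
        refine pos_of_mul_pos_right (a := |x| ^ (1 + 2 * s)) ?_ hp.le
        linarith
      linarith
    constructor
    · have : 2 / π * A + 2 / t * (2 * (1 / π * B)) = 2 / π * (A + 2 / t * B) := by ring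
      rw [this]; positivity
    · have : 2 / π * A + 1 / (2 * t) * (2 * (1 / π * B)) = 2 / π * (A + 1 / (2 * t) * B) := by ring
      rw [this]; exact mul_nonpos_of_nonneg_of_nonpos (by positivity) h3'.le
  · refine ⟨2 / π * (t * -qQ s), ?_, ?_⟩
    · have : 0 < - qQ s := by linarith
      positivity
    · refine (a0.const_mul (2 / π)).congr fun x => ?_
      rw [aux_kernel_eq]; ring

/-- `φ^t = 2 p_s(t,·)` is positive, is a supersolution/subsolution of the stated
linear equations for `|x|` large, and has a positive finite limit of `x^{1+2s} φ^t(x)`. -/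
theorem statement14 (s t : ℝ) (hs : s ∈ Set.Ioo (0:ℝ) 1) (ht : 0 < t) :
    (∀ x : ℝ, 0 < 2 * fracHeatKernel s t x) ∧
    (∃ R : ℝ, 0 < R ∧ ∀ x : ℝ, R ≤ |x| →
      0 ≤ fracLap s (fun x' => 2 * fracHeatKernel s t x') x + (2/t) * (2 * fracHeatKernel s t x) ∧
      fracLap s (fun x' => 2 * fracHeatKernel s t x') x + (1/(2*t)) * (2 * fracHeatKernel s t x) ≤ 0) ∧
    (∃ L : ℝ, 0 < L ∧
      Tendsto (fun x : ℝ => x ^ (1 + 2*s) * (2 * fracHeatKernel s t x)) atTop (nhds L)) := by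
  exact aux_final hs ht
end

section
/- Let s ∈ (0,1) and let f : ℝ → ℝ be of class C^{1,γ} for some γ > max(0, 1−2s), with f′(−1) < 0 and f′(1) < 0 (i.e., G″(−1) > 0 and G″(1) > 0). Let v be a bounded C² function on ℝ with |v(x)| < 1 for all x, solving (-∂ₓₓ)^s v = f(v) at every point and satisfying lim_{x→−∞} v(x) = −1 and lim_{x→+∞} v(x) = 1. Then v′(x) > 0 for every x ∈ ℝ, i.e., v is a layer solution. -/
open Real MeasureTheory Filter Set

/-- The second difference of `v`. -/
noncomputable def secDiff (v : ℝ → ℝ) (x y : ℝ) : ℝ := 2 * v x - v (x + y) - v (x - y)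

lemma fracLapCoef_pos' {s : ℝ} (h0 : 0 < s) (h1 : s < 1) : 0 < fracLapCoef s := by
  unfold fracLapCoef
  have a1 : 0 < Real.Gamma (s + 1/2) := Real.Gamma_pos_of_pos (by linarith)
  have a2 : 0 < Real.Gamma (1 - s) := Real.Gamma_pos_of_pos (by linarith)
  have a3 : 0 < Real.sqrt π := Real.sqrt_pos.mpr Real.pi_pos
  have a4 : (0:ℝ) < (4:ℝ) ^ s := Real.rpow_pos_of_pos (by norm_num) s
  positivity

lemma kernel_integrable {s : ℝ} (h0 : 0 < s) (h1 : s < 1) :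
    IntegrableOn (fun y : ℝ => min (y ^ 2) 1 * y ^ (-1 - 2*s)) (Ioi 0) := by
  rw [← Ioc_union_Ioi_eq_Ioi (zero_le_one (α := ℝ))]
  apply IntegrableOn.union
  · have h : IntegrableOn (fun y : ℝ => y ^ (1 - 2*s)) (Ioc 0 1) := by
      have := (intervalIntegral.intervalIntegrable_rpow' (a := 0) (b := 1) (r := 1 - 2*s)
        (by linarith))
      exact (intervalIntegrable_iff_integrableOn_Ioc_of_le zero_le_one).1 this
    refine h.congr_fun (fun y hy => ?_) measurableSet_Ioc
    have hy0 : 0 < y := hy.1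
    have : min (y^2) 1 = y^2 := min_eq_left (by have := hy.2; nlinarith)
    simp only [this]
    rw [← Real.rpow_natCast y 2, ← Real.rpow_add hy0]
    congr 1
    push_cast; ring
  · have h : IntegrableOn (fun y : ℝ => y ^ (-1 - 2*s)) (Ioi 1) :=
      integrableOn_Ioi_rpow_of_lt (by linarith) one_pos
    refine h.congr_fun (fun y hy => ?_) measurableSet_Ioi
    have hy0 : 1 < y := hy
    have : min (y^2) 1 = 1 := min_eq_right (by nlinarith)
    simp only [this, one_mul]

lemma sdiff_bound {v : ℝ → ℝ} (hv : ContDiff ℝ 2 v) (hb : ∀ x, |v x| < 1) (x : ℝ) :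
    ∃ C : ℝ, ∀ y : ℝ, 0 < y → |secDiff v x y| ≤ C * min (y ^ 2) 1 := by
  have hd : Differentiable ℝ v := hv.differentiable (by norm_num)
  have hv' : ContDiff ℝ 1 (deriv v) := by
    have : ContDiff ℝ (1 + 1) v := by simpa [one_add_one_eq_two] using hv
    exact (contDiff_succ_iff_deriv.1 this).2.2
  have hd' : Differentiable ℝ (deriv v) := hv'.differentiable (by norm_num)
  have hc'' : Continuous (deriv (deriv v)) := hv'.continuous_deriv (by norm_num)
  obtain ⟨L, hL⟩ := (isCompact_Icc (a := x - 1) (b := x + 1)).exists_bound_of_continuousOn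
    hc''.continuousOn
  have hL0 : 0 ≤ L := le_trans (norm_nonneg _) (hL x ⟨by linarith, by linarith⟩)
  refine ⟨2 * L + 4, fun y hy => ?_⟩
  have h4 : |secDiff v x y| ≤ 4 := by
    have a := abs_lt.1 (hb x)
    have b := abs_lt.1 (hb (x+y))
    have c := abs_lt.1 (hb (x-y))
    unfold secDiff
    rw [abs_le]; constructor <;> linarith [a.1, a.2, b.1, b.2, c.1, c.2]
  rcases le_or_gt y 1 with hy1 | hy1
  · have hmin : min (y^2) 1 = y^2 := min_eq_left (by nlinarith)
    rw [hmin]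
    have hder : ∀ u ∈ Icc (0:ℝ) y, HasDerivWithinAt (fun u => secDiff v x u)
        (- deriv v (x + u) + deriv v (x - u)) (Icc 0 y) u := by
      intro u _
      have e1 : HasDerivAt (fun u => v (x + u)) (deriv v (x + u)) u := by
        simpa using (hd (x+u)).hasDerivAt.comp_const_add x u
      have e2 : HasDerivAt (fun u => v (x - u)) (-deriv v (x - u)) u := by
        simpa using (hd (x-u)).hasDerivAt.comp_const_sub x u
      have := ((hasDerivAt_const u (2 * v x)).sub e1).sub e2
      refine (HasDerivAt.congr_deriv this ?_).hasDerivWithinAt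
      ring
    have hbd : ∀ u ∈ Icc (0:ℝ) y, ‖- deriv v (x + u) + deriv v (x - u)‖ ≤ 2 * L * y := by
      intro u hu
      have := (convex_Icc (x-1) (x+1)).norm_image_sub_le_of_norm_deriv_le
        (f := deriv v) (C := L) (fun z _ => hd' z) hL
        (x := x + u) (y := x - u) ⟨by linarith [hu.1], by linarith [hu.2]⟩
        ⟨by linarith [hu.2], by linarith [hu.1]⟩
      have e : ‖x - u - (x + u)‖ = 2 * u := by
        rw [show x - u - (x + u) = -(2*u) by ring, norm_neg, Real.norm_eq_abs,
          abs_of_nonneg (by linarith [hu.1])]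
      rw [e] at this
      rw [neg_add_eq_sub]
      refine this.trans ?_
      nlinarith [hu.2]
    have := (convex_Icc (0:ℝ) y).norm_image_sub_le_of_norm_hasDerivWithin_le hder hbd
      (x := 0) (y := y) ⟨le_refl _, hy.le⟩ ⟨hy.le, le_refl _⟩
    have z : secDiff v x 0 = 0 := by unfold secDiff; simp; ring
    simp only [z, sub_zero, Real.norm_eq_abs, abs_of_pos hy] at this
    nlinarith [sq_nonneg y]
  · have hmin : min (y^2) 1 = 1 := min_eq_right (by nlinarith)
    rw [hmin]; linarith

lemma sdiff_integrable {s : ℝ} (h0 : 0 < s) (h1 : s < 1) {v : ℝ → ℝ}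
    (hv : ContDiff ℝ 2 v) (hb : ∀ x, |v x| < 1) (x : ℝ) :
    IntegrableOn (fun y => secDiff v x y * y ^ (-1 - 2*s)) (Ioi 0) := by
  obtain ⟨C, hC⟩ := sdiff_bound hv hb x
  have hvc := hv.continuous
  refine Integrable.mono' ((kernel_integrable h0 h1).const_mul C) ?_ ?_
  · apply Measurable.aestronglyMeasurable
    have : Measurable (fun y => secDiff v x y) := by
      unfold secDiff
      exact Continuous.measurable (by fun_prop)
    exact this.mul (by fun_prop)
  · refine (ae_restrict_iff' measurableSet_Ioi).2 (Eventually.of_forall fun y hy => ?_)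
    have hy0 : (0:ℝ) < y := hy
    have hk : 0 < y ^ (-1 - 2*s) := Real.rpow_pos_of_pos hy0 _
    rw [norm_mul, Real.norm_eq_abs, Real.norm_eq_abs, abs_of_pos hk, ← mul_assoc]
    exact mul_le_mul_of_nonneg_right (hC y hy0) hk.le

/-- Quantitative strong maximum principle. -/
lemma barrier {s : ℝ} (h0 : 0 < s) (h1 : s < 1) (Λ x0 x1 c δ : ℝ) (hΛ : 0 ≤ Λ)
    (hx : x0 ≠ x1) (hc : 0 < c) (hδ : 0 < δ) :
    ∃ a : ℝ, 0 < a ∧ ∀ w : ℝ → ℝ, Continuous w → (∀ x, 0 ≤ w x) →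
      (∀ x, IntegrableOn (fun y => secDiff w x y * y ^ (-1 - 2*s)) (Ioi 0)) →
      (∀ x, -Λ * w x ≤ ∫ y in Ioi (0:ℝ), secDiff w x y * y ^ (-1 - 2*s)) →
      (∀ z, |z - x1| < δ → c ≤ w z) → a ≤ w x0 := by
  obtain ⟨r, hr⟩ : ∃ r, r = |x1 - x0| / 2 := ⟨_, rfl⟩
  have hr0 : 0 < r := by
    rw [hr]; have : 0 < |x1 - x0| := abs_pos.2 (sub_ne_zero.2 hx.symm)
    linarith
  obtain ⟨ε, hε⟩ : ∃ ε, ε = min δ r := ⟨_, rfl⟩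
  have hε0 : 0 < ε := by rw [hε]; exact lt_min hδ hr0
  have hεδ : ε ≤ δ := by rw [hε]; exact min_le_left _ _
  have hεr : ε ≤ r := by rw [hε]; exact min_le_right _ _
  obtain ⟨K, hK⟩ : ∃ K, K = (4 * r) ^ (-1 - 2*s) := ⟨_, rfl⟩
  have hK0 : 0 < K := by rw [hK]; exact Real.rpow_pos_of_pos (by linarith) _
  obtain ⟨B, hB⟩ : ∃ B, B = 2 * (1 + 1 / r ^ 2) := ⟨_, rfl⟩
  have hB0 : 0 < B := by rw [hB]; positivity
  obtain ⟨A, hA⟩ : ∃ A, A = ∫ y in Ioi (0:ℝ), min (y ^ 2) 1 * y ^ (-1 - 2*s) := ⟨_, rfl⟩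
  have hA0 : 0 ≤ A := by
    rw [hA]
    refine setIntegral_nonneg measurableSet_Ioi fun y hy => ?_
    have hk : 0 < y ^ (-1 - 2*s) := Real.rpow_pos_of_pos hy _
    have : 0 ≤ min (y^2) 1 := le_min (sq_nonneg y) zero_le_one
    positivity
  have hden : 0 < B * A + Λ + 1 := by positivity
  refine ⟨c * K * (2 * ε) / (B * A + Λ + 1), by positivity, ?_⟩
  obtain ⟨a, ha⟩ : ∃ a, a = c * K * (2 * ε) / (B * A + Λ + 1) := ⟨_, rfl⟩
  rw [← ha]
  have ha0 : 0 < a := by rw [ha]; positivity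
  have hae : a * (B * A + Λ + 1) = c * K * (2 * ε) := by
    rw [ha]; field_simp
  intro w hw hw0 hinteg hineq hwc
  by_contra hlt
  push Not at hlt
  obtain ⟨η, hη⟩ : ∃ η : ℝ → ℝ, η = fun x => max 0 (1 - (x - x0)^2 / r^2) := ⟨_, rfl⟩
  have hηc : Continuous η := by rw [hη]; fun_prop
  have hη0 : ∀ x, 0 ≤ η x := fun x => by rw [hη]; exact le_max_left _ _
  have hηge : ∀ x, 1 - (x - x0)^2 / r^2 ≤ η x := fun x => by rw [hη]; exact le_max_right _ _
  have hη1 : ∀ x, η x ≤ 1 := fun x => by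
    rw [hη]; exact max_le zero_le_one (by have : 0 ≤ (x-x0)^2/r^2 := by positivity
                                          linarith)
  have hηout : ∀ x, r ≤ |x - x0| → η x = 0 := fun x hx => by
    rw [hη]; apply max_eq_left
    have : 1 ≤ (x - x0)^2 / r^2 := by
      rw [le_div_iff₀ (by positivity), one_mul, ← sq_abs (x - x0)]
      exact pow_le_pow_left₀ hr0.le hx 2
    linarith
  obtain ⟨g, hg⟩ : ∃ g : ℝ → ℝ, g = fun x => w x - a * η x := ⟨_, rfl⟩
  have hgx : ∀ x, g x = w x - a * η x := fun x => by rw [hg]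
  have hgc : Continuous g := by rw [hg]; fun_prop
  have hgout : ∀ x, r ≤ |x - x0| → g x = w x := fun x hx => by
    rw [hgx, hηout x hx]; ring
  have hη00 : η x0 = 1 := by rw [hη]; simp
  have hgx0 : g x0 < 0 := by rw [hgx, hη00]; linarith
  obtain ⟨m, hm⟩ : ∃ m, ∀ y, g m ≤ g y := by
    apply hgc.exists_forall_le' x0
    have : ∀ᶠ x in cocompact ℝ, x ∉ Metric.closedBall x0 r :=
      (isCompact_closedBall x0 r).compl_mem_cocompact
    filter_upwards [this] with x hx
    rw [Metric.mem_closedBall, Real.dist_eq, not_le] at hx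
    rw [hgout x hx.le]
    linarith [hw0 x]
  have hgm : g m < 0 := lt_of_le_of_lt (hm x0) hgx0
  have hmr : |m - x0| < r := by
    by_contra h
    push Not at h
    rw [hgout m h] at hgm
    linarith [hw0 m]
  have hηm : 0 < η m := by
    rcases (hη0 m).lt_or_eq with h | h
    · exact h
    · rw [hgx, ← h] at hgm; linarith [hw0 m]
  have hwm : w m ≤ a := by
    have := hη1 m
    have := hgx m
    nlinarith
  obtain ⟨d, hd⟩ : ∃ d, d = |x1 - m| := ⟨_, rfl⟩
  have h2r : |x1 - x0| = 2 * r := by rw [hr]; ring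
  have hdlow : r < d := by
    have : |x1 - x0| ≤ |x1 - m| + |m - x0| := abs_sub_le _ _ _
    rw [hd]; linarith
  have hdup : d < 3 * r := by
    have : |x1 - m| ≤ |x1 - x0| + |x0 - m| := abs_sub_le _ _ _
    rw [abs_sub_comm x0 m] at this
    rw [hd]; linarith
  have hηs : ∀ y, 0 < y → secDiff η m y ≤ B * min (y^2) 1 := by
    intro y hy
    have e1 : secDiff η m y ≤ 2 := by
      unfold secDiff; linarith [hη0 (m+y), hη0 (m-y), hη1 m]
    have e2 : secDiff η m y ≤ 2 * (y^2 / r^2) := by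
      have e : η m = 1 - (m - x0)^2/r^2 := by
        have h := hηm
        simp only [hη] at h ⊢
        rcases max_choice 0 (1 - (m - x0)^2/r^2) with h' | h'
        · rw [h'] at h; exact absurd h (lt_irrefl _)
        · exact h'
      have := hηge (m+y)
      have := hηge (m-y)
      have key : 2 * (1 - (m - x0)^2/r^2) - (1 - (m + y - x0)^2/r^2) - (1 - (m - y - x0)^2/r^2)
        = 2 * (y^2 / r^2) := by ring
      unfold secDiff; linarith
    have hr2 : 0 < 1 / r^2 := by positivity
    rcases le_total (y^2) 1 with h | h
    · rw [min_eq_left h, hB]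
      have : y^2 / r^2 = 1 / r^2 * y^2 := by ring
      nlinarith [sq_nonneg y]
    · rw [min_eq_right h, hB]; linarith
  have hsplit : ∀ y, secDiff w m y = secDiff g m y + a * secDiff η m y := by
    intro y; unfold secDiff; simp only [hgx]; ring
  have hgs : ∀ y, secDiff g m y ≤ 0 := by
    intro y; unfold secDiff; linarith [hm (m+y), hm (m-y)]
  have hgJ : ∀ y, y ∈ Ioo (d - ε) (d + ε) → secDiff g m y ≤ -c := by
    intro y hy
    have hz : ∀ z, |z - x1| < ε → c ≤ g z := by
      intro z hz
      have : |x1 - x0| ≤ |x1 - z| + |z - x0| := abs_sub_le _ _ _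
      rw [abs_sub_comm x1 z] at this
      rw [hgout z (by linarith)]
      exact hwc z (by linarith)
    rcases le_total 0 (x1 - m) with h | h
    · rw [abs_of_nonneg h] at hd
      have := hz (m + y) (by rw [abs_lt]; constructor <;> linarith [hy.1, hy.2])
      unfold secDiff; linarith [hm (m-y)]
    · rw [abs_of_nonpos h] at hd
      have := hz (m - y) (by rw [abs_lt]; constructor <;> linarith [hy.1, hy.2])
      unfold secDiff; linarith [hm (m+y)]
  have hsub : Ioo (d - ε) (d + ε) ⊆ Ioi 0 := fun y hy => by
    have := hy.1
    show 0 < y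
    linarith
  have hi2 : IntegrableOn ((Ioo (d - ε) (d + ε)).indicator (fun _ : ℝ => c * K)) (Ioi 0) := by
    have : IntegrableOn (fun _ : ℝ => c * K) (Ioo (d - ε) (d + ε)) :=
      integrableOn_const (by simp)
    exact ((integrable_indicator_iff measurableSet_Ioo).2 this).integrableOn
  have hi1 : IntegrableOn (fun y : ℝ => a * B * (min (y ^ 2) 1 * y ^ (-1 - 2*s))) (Ioi 0) :=
    (kernel_integrable h0 h1).const_mul (a * B)
  have hmain : ∫ y in Ioi (0:ℝ), secDiff w m y * y ^ (-1 - 2*s) ≤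
      ∫ y in Ioi (0:ℝ), (a * B * (min (y ^ 2) 1 * y ^ (-1 - 2*s)) -
        (Ioo (d - ε) (d + ε)).indicator (fun _ : ℝ => c * K) y) := by
    refine setIntegral_mono_on (hinteg m) (hi1.sub hi2) measurableSet_Ioi fun y hy => ?_
    have hy0 : (0:ℝ) < y := hy
    have hk : 0 < y ^ (-1 - 2*s) := Real.rpow_pos_of_pos hy _
    have e1 := mul_le_mul_of_nonneg_left (hηs y hy0) ha0.le
    rw [hsplit]
    by_cases hyJ : y ∈ Ioo (d - ε) (d + ε)
    · rw [indicator_of_mem hyJ]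
      have hKy : K ≤ y ^ (-1 - 2*s) := by
        rw [hK]
        exact Real.rpow_le_rpow_of_nonpos hy0 (by linarith [hyJ.2]) (by linarith)
      have e2 := hgJ y hyJ
      have e3 : (secDiff g m y + a * secDiff η m y) * y ^ (-1 - 2*s) ≤
        (-c + a * (B * min (y^2) 1)) * y ^ (-1 - 2*s) :=
        mul_le_mul_of_nonneg_right (by linarith) hk.le
      nlinarith
    · rw [indicator_of_notMem hyJ]
      have e3 : (secDiff g m y + a * secDiff η m y) * y ^ (-1 - 2*s) ≤
        (a * (B * min (y^2) 1)) * y ^ (-1 - 2*s) :=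
        mul_le_mul_of_nonneg_right (by linarith [hgs y]) hk.le
      linarith
  rw [integral_sub hi1 hi2, integral_const_mul, ← hA, setIntegral_indicator measurableSet_Ioo,
    inter_eq_self_of_subset_right hsub, setIntegral_const, Real.volume_real_Ioo_of_le (by linarith),
    smul_eq_mul] at hmain
  have := hineq m
  have : Λ * w m ≤ Λ * a := mul_le_mul_of_nonneg_left hwm hΛ
  nlinarith

lemma trans_sdiff {s : ℝ} (h0 : 0 < s) (h1 : s < 1) {f v : ℝ → ℝ}
    (hv : ContDiff ℝ 2 v) (hb : ∀ x, |v x| < 1) (heq : ∀ x : ℝ, fracLap s v x = f (v x))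
    (q t x : ℝ) :
    IntegrableOn (fun y => secDiff (fun z => q * (v (z + t) - v z)) x y * y ^ (-1 - 2*s)) (Ioi 0) ∧
    ∫ y in Ioi (0:ℝ), secDiff (fun z => q * (v (z + t) - v z)) x y * y ^ (-1 - 2*s) =
      q * ((f (v (x + t)) - f (v x)) / fracLapCoef s) := by
  have i1 := sdiff_integrable h0 h1 hv hb (x + t)
  have i2 := sdiff_integrable h0 h1 hv hb x
  have hc := fracLapCoef_pos' h0 h1
  have e : (fun y => secDiff (fun z => q * (v (z + t) - v z)) x y * y ^ (-1 - 2*s)) =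
      fun y => q * (secDiff v (x + t) y * y ^ (-1 - 2*s) - secDiff v x y * y ^ (-1 - 2*s)) := by
    funext y
    unfold secDiff
    beta_reduce
    rw [show x + y + t = x + t + y by ring, show x - y + t = x + t - y by ring]
    ring
  rw [e]
  refine ⟨(i1.sub i2).const_mul q, ?_⟩
  rw [integral_const_mul, integral_sub i1 i2, ← heq, ← heq]
  unfold fracLap secDiff
  field_simp

lemma anti_near {f : ℝ → ℝ} (hf : ContDiff ℝ 1 f) {p : ℝ} (hp : deriv f p < 0) :
    ∃ τ, 0 < τ ∧ ∀ u w, |u - p| < τ → |w - p| < τ → u < w → f w < f u := by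
  have hc : Continuous (deriv f) := hf.continuous_deriv (by norm_num)
  have : ∀ᶠ x in nhds p, deriv f x < 0 := hc.continuousAt.eventually (gt_mem_nhds hp)
  obtain ⟨τ, hτ, h⟩ := Metric.eventually_nhds_iff_ball.1 this
  refine ⟨τ, hτ, fun u w hu hw huw => ?_⟩
  have := strictAntiOn_of_deriv_neg (convex_ball p τ) hf.continuous.continuousOn
    (fun x hx => h x (interior_subset hx))
  exact this (by rwa [Metric.mem_ball, Real.dist_eq]) (by rwa [Metric.mem_ball, Real.dist_eq]) huw

theorem statement15 (s γ : ℝ) (hs : s ∈ Set.Ioo (0:ℝ) 1)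
    (hγ : max 0 (1 - 2*s) < γ)
    (f : ℝ → ℝ) (hf : IsC1Holder γ f)
    (hfm : deriv f (-1) < 0) (hfp : deriv f 1 < 0)
    (v : ℝ → ℝ)
    (hsm : ContDiff ℝ 2 v)
    (hbd : ∀ x : ℝ, |v x| < 1)
    (heq : ∀ x : ℝ, fracLap s v x = f (v x))
    (hlimNeg : Tendsto v atBot (nhds (-1)))
    (hlimPos : Tendsto v atTop (nhds 1)) :
    ∀ x : ℝ, 0 < deriv v x := by
  obtain ⟨h0, h1⟩ := hs
  have hf1 := hf.1
  have hc := fracLapCoef_pos' h0 h1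
  have hvc := hsm.continuous
  have hvd : Differentiable ℝ v := hsm.differentiable (by norm_num)
  have hb1 : ∀ x, -1 < v x := fun x => (abs_lt.1 (hbd x)).1
  have hb2 : ∀ x, v x < 1 := fun x => (abs_lt.1 (hbd x)).2
  -- Lipschitz constant
  obtain ⟨L, hL⟩ := (isCompact_Icc (a := (-1:ℝ)) (b := 1)).exists_bound_of_continuousOn
    (hf1.continuous_deriv (by norm_num)).continuousOn
  have hL0 : 0 ≤ L := le_trans (norm_nonneg _) (hL 0 ⟨by norm_num, by norm_num⟩)
  have hlip : ∀ x y, |f (v y) - f (v x)| ≤ L * |v y - v x| := fun x y =>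
    (convex_Icc (-1:ℝ) 1).norm_image_sub_le_of_norm_deriv_le
      (fun z _ => (hf1.differentiable (by norm_num)) z) hL
      ⟨(hb1 x).le, (hb2 x).le⟩ ⟨(hb1 y).le, (hb2 y).le⟩
  obtain ⟨Λ, hΛ⟩ : ∃ Λ, Λ = L / fracLapCoef s := ⟨_, rfl⟩
  have hΛ0 : 0 ≤ Λ := by rw [hΛ]; positivity
  -- the strong maximum principle for translates
  have hQ : ∀ x0 x1 c δ : ℝ, x0 ≠ x1 → 0 < c → 0 < δ → ∃ a, 0 < a ∧ ∀ q t : ℝ, 0 < q →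
      (∀ x, v x ≤ v (x + t)) → (∀ z, |z - x1| < δ → c ≤ q * (v (z + t) - v z)) →
      a ≤ q * (v (x0 + t) - v x0) := by
    intro x0 x1 c δ hx hc0 hδ
    obtain ⟨a, ha, h⟩ := barrier h0 h1 Λ x0 x1 c δ hΛ0 hx hc0 hδ
    refine ⟨a, ha, fun q t hq hP hz => ?_⟩
    refine h (fun z => q * (v (z + t) - v z)) (by fun_prop)
      (fun x => mul_nonneg hq.le (by linarith [hP x]))
      (fun x => (trans_sdiff h0 h1 hsm hbd heq q t x).1) (fun x => ?_) hz
    rw [(trans_sdiff h0 h1 hsm hbd heq q t x).2]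
    have e := (abs_le.1 (hlip x (x + t))).1
    rw [abs_of_nonneg (by linarith [hP x])] at e
    have : -Λ * (v (x + t) - v x) ≤ (f (v (x + t)) - f (v x)) / fracLapCoef s := by
      rw [le_div_iff₀ hc, hΛ]
      field_simp
      linarith
    have := mul_le_mul_of_nonneg_left this hq.le
    linarith
  -- zones
  obtain ⟨τm, hτm, hm⟩ := anti_near hf1 hfm
  obtain ⟨τp, hτp, hp⟩ := anti_near hf1 hfp
  obtain ⟨Rp, hRp⟩ := eventually_atTop.1 (hlimPos.eventually (lt_mem_nhds (show 1 - τp < 1 by linarith)))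
  obtain ⟨Rm, hRm⟩ := eventually_atBot.1
    (hlimNeg.eventually (gt_mem_nhds (show (-1:ℝ) < -1 + τm by linarith)))
  -- key: a failure occurs in a compact set
  have key : ∀ t, 0 < t → (∃ x, v (x + t) < v x) → ∃ x ∈ Icc Rm Rp, v (x + t) < v x := by
    rintro t ht ⟨x0, hx0⟩
    obtain ⟨w, hw⟩ : ∃ w : ℝ → ℝ, w = fun z => 1 * (v (z + t) - v z) := ⟨_, rfl⟩
    have hwx : ∀ x, w x = v (x + t) - v x := fun x => by rw [hw]; ring
    have hwc : Continuous w := by rw [hw]; fun_prop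
    obtain ⟨m, hmin⟩ : ∃ m, ∀ y, w m ≤ w y := by
      apply hwc.exists_forall_le' x0
      rw [cocompact_eq_atBot_atTop, eventually_sup]
      have hneg : w x0 < 0 := by rw [hwx]; linarith
      constructor
      · have : Tendsto w atBot (nhds (1 * (-1 - -1))) := by
          rw [hw]
          exact ((hlimNeg.comp (tendsto_atBot_add_const_right _ t tendsto_id)).sub hlimNeg).const_mul 1
        exact (this.eventually (lt_mem_nhds (by simpa using hneg))).mono fun _ h => h.le
      · have : Tendsto w atTop (nhds (1 * (1 - 1))) := by
          rw [hw]
          exact ((hlimPos.comp (tendsto_atTop_add_const_right _ t tendsto_id)).sub hlimPos).const_mul 1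
        exact (this.eventually (lt_mem_nhds (by simpa using hneg))).mono fun _ h => h.le
    have hwm : v (m + t) < v m := by
      have := hmin x0
      rw [hwx, hwx] at this; linarith
    have hle : f (v (m + t)) ≤ f (v m) := by
      have e := (trans_sdiff h0 h1 hsm hbd heq 1 t m).2
      rw [← hw] at e
      have : ∫ y in Ioi (0:ℝ), secDiff w m y * y ^ (-1 - 2*s) ≤ 0 := by
        refine setIntegral_nonpos measurableSet_Ioi fun y hy => ?_
        have hk : 0 < y ^ (-1 - 2*s) := Real.rpow_pos_of_pos hy _
        refine mul_nonpos_of_nonpos_of_nonneg ?_ hk.le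
        unfold secDiff; linarith [hmin (m+y), hmin (m-y)]
      rw [e, one_mul, div_nonpos_iff] at this
      rcases this with h | h
      · linarith [h.2]
      · linarith [h.1]
    refine ⟨m, ⟨?_, ?_⟩, hwm⟩
    · by_contra h
      push Not at h
      have := hRm m h.le
      have := hm (v (m+t)) (v m) (by rw [abs_lt]; constructor <;> linarith [hb1 (m+t)])
        (by rw [abs_lt]; constructor <;> linarith [hb1 m]) hwm
      linarith
    · by_contra h
      push Not at h
      have := hRp m h.le
      have := hRp (m + t) (by linarith)
      have := hp (v (m+t)) (v m) (by rw [abs_lt]; constructor <;> linarith [hb2 (m+t)])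
        (by rw [abs_lt]; constructor <;> linarith [hb2 m]) hwm
      linarith
  -- sliding
  have slide : ∀ t, 0 < t → ∀ x, v x ≤ v (x + t) := by
    by_contra hcon
    push Not at hcon
    obtain ⟨t0, ht0, hbad⟩ := hcon
    -- open set of strict failure
    have hV : IsOpen {t : ℝ | ∃ x, v (x + t) < v x} := by
      have : {t : ℝ | ∃ x, v (x + t) < v x} = ⋃ x, {t : ℝ | v (x + t) < v x} := by
        ext t; simp
      rw [this]
      exact isOpen_iUnion fun x => isOpen_lt (by fun_prop) (by fun_prop)
    have hpos : ∀ t, 0 < t → (∀ x, v x ≤ v (x + t)) → ∀ x, v x < v (x + t) := by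
      intro t ht hP x0
      by_contra hno
      push Not at hno
      have hex : ∃ x1, v x1 < v (x1 + t) := by
        by_contra hno2
        push Not at hno2
        have hper : ∀ x, v (x + t) = v x := fun x => le_antisymm (hno2 x) (hP x)
        have hper' : ∀ n : ℕ, v (0 + n * t) = v 0 := by
          intro n
          induction n with
          | zero => simp
          | succ k ih =>
            rw [← ih, ← hper (0 + k * t)]; congr 1; push_cast; ring
        have l1 : Tendsto (fun n : ℕ => v (0 + n * t)) atTop (nhds 1) := by
          refine hlimPos.comp (tendsto_atTop_add_const_left _ 0 ?_)
          exact tendsto_natCast_atTop_atTop.atTop_mul_const ht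
        simp only [hper'] at l1
        have := tendsto_nhds_unique l1 tendsto_const_nhds
        linarith [hb2 0]
      obtain ⟨x1, hx1⟩ := hex
      have hne : x0 ≠ x1 := by rintro rfl; linarith
      have hco : Continuous fun z => v (z + t) - v z := by fun_prop
      have hev : ∀ᶠ z in nhds x1, (v (x1 + t) - v x1) / 2 < v (z + t) - v z :=
        hco.continuousAt.eventually (lt_mem_nhds (by linarith))
      obtain ⟨δ, hδ, hball⟩ := Metric.eventually_nhds_iff_ball.1 hev
      obtain ⟨a, ha, h⟩ := hQ x0 x1 ((v (x1 + t) - v x1) / 2) δ hne (by linarith) hδ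
      have := h 1 t one_pos hP (fun z hz => by
        have := hball z (by rwa [Metric.mem_ball, Real.dist_eq])
        linarith)
      linarith
    have hU : IsOpen {t : ℝ | 0 < t ∧ ∀ x, v x ≤ v (x + t)} := by
      rw [isOpen_iff_mem_nhds]
      rintro t ⟨ht, hP⟩
      have hev : ∀ᶠ t' in nhds t, ∀ x ∈ Icc Rm Rp, v x < v (x + t') := by
        have hop : IsOpen {p : ℝ × ℝ | v p.2 < v (p.2 + p.1)} :=
          isOpen_lt (by fun_prop) (by fun_prop)
        have := (isCompact_Icc (a := Rm) (b := Rp)).eventually_forall_of_forall_eventually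
          (x₀ := t) (P := fun t' x => v x < v (x + t'))
          (fun x _ => hop.mem_nhds (show (t, x) ∈ _ from hpos t ht hP x))
        exact this
      filter_upwards [hev, lt_mem_nhds ht] with t' h1' h2'
      refine ⟨h2', ?_⟩
      by_contra hno
      push Not at hno
      obtain ⟨x, hx, hxx⟩ := key t' h2' hno
      linarith [h1' x hx]
    have hT : ∃ T, 0 < T ∧ ∀ x, v x ≤ v (x + T) := by
      obtain ⟨M, hM1, hM⟩ : ∃ M, M < 1 ∧ ∀ x ∈ Icc Rm Rp, v x ≤ M := by
        rcases (Icc Rm Rp).eq_empty_or_nonempty with h | h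
        · exact ⟨0, by norm_num, by simp [h]⟩
        · obtain ⟨z, _, hz⟩ := isCompact_Icc.exists_isMaxOn h hvc.continuousOn
          exact ⟨v z, hb2 z, fun x hx => hz hx⟩
      obtain ⟨S, hS⟩ := eventually_atTop.1 (hlimPos.eventually (lt_mem_nhds hM1))
      refine ⟨max 1 (S - Rm), lt_of_lt_of_le one_pos (le_max_left _ _), ?_⟩
      by_contra hno
      push Not at hno
      obtain ⟨x, hx, hxx⟩ := key _ (lt_of_lt_of_le one_pos (le_max_left _ _)) hno
      have := hS (x + max 1 (S - Rm)) (by linarith [le_max_right 1 (S - Rm), hx.1])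
      linarith [hM x hx]
    obtain ⟨T, hT0, hT⟩ := hT
    obtain ⟨t, _, ht1, x, hx⟩ := isPreconnected_Ioi (a := (0:ℝ)) _ _ hU hV
      (fun t ht => by
        by_cases h : ∀ x, v x ≤ v (x + t)
        · exact Or.inl ⟨ht, h⟩
        · push Not at h; exact Or.inr h)
      ⟨T, hT0, hT0, hT⟩ ⟨t0, ht0, hbad⟩
    linarith [ht1.2 x]
  -- conclusion
  have hv'c : Continuous (deriv v) := hsm.continuous_deriv (by norm_num)
  obtain ⟨x1, hx1⟩ : ∃ x1, 0 < deriv v x1 := by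
    by_contra hno
    push Not at hno
    have hanti := antitone_of_deriv_nonpos hvd hno
    have hcst : ∀ x, 0 ≤ x → v x ≤ v 0 := fun x hx => hanti hx
    have := le_of_tendsto hlimPos (eventually_atTop.2 ⟨0, hcst⟩)
    linarith [hb2 0]
  intro x0
  by_cases hne : x0 = x1
  · rw [hne]; exact hx1
  have hev : ∀ᶠ z in nhds x1, deriv v x1 / 2 < deriv v z :=
    hv'c.continuousAt.eventually (lt_mem_nhds (by linarith))
  obtain ⟨δ, hδ, hball⟩ := Metric.eventually_nhds_iff_ball.1 hev
  obtain ⟨a, ha, h⟩ := hQ x0 x1 (deriv v x1 / 2) (δ / 2) hne (by linarith) (by linarith)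
  have hlow : ∀ t, 0 < t → t < δ / 2 → a ≤ t⁻¹ * (v (x0 + t) - v x0) := by
    intro t ht htδ
    refine h t⁻¹ t (inv_pos.2 ht) (slide t ht) fun z hz => ?_
    obtain ⟨ξ, hξ, hξe⟩ := exists_deriv_eq_slope v (show z < z + t by linarith)
      hvc.continuousOn hvd.differentiableOn
    have hb := hball ξ (by
      rw [Metric.mem_ball, Real.dist_eq]
      rw [abs_lt] at hz ⊢
      constructor <;> linarith [hξ.1, hξ.2, hz.1, hz.2])
    rw [hξe, add_sub_cancel_left, div_eq_inv_mul (v (z + t) - v z)] at hb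
    exact hb.le
  have hslope := (hvd x0).hasDerivAt.tendsto_slope_zero_right
  refine lt_of_lt_of_le ha (ge_of_tendsto hslope ?_)
  have : Ioo (0:ℝ) (δ/2) ∈ nhdsWithin (0:ℝ) (Ioi 0) := Ioo_mem_nhdsGT (by linarith)
  filter_upwards [this] with t ht
  simpa using hlow t ht.1 ht.2
end
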